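/- For every ε > 0: with y = T^{1/4}, ∫_T^{2T} |R₁(x)|^6·|R₂(x)| dx ≤ C(ε)·T^{11/4 − 1/336 + ε} for all T ≥ 10. -/

import Mathlib

open MeasureTheory

/-- The divisor function `d(n)`. -/
def divfun (n : ℕ) : ℕ := n.divisors.card

/-- The error term in the Dirichlet divisor problem. -/
noncomputable def DirichletDelta (x : ℝ) : ℝ :=
  (∑ n ∈ Finset.Icc 1 ⌊x⌋₊, (divfun n : ℝ)) - x * Real.log x -
    (2 * Real.eulerMascheroniConstant - 1) * x

/-- The truncated Voronoï sum `R₁(x)` with truncation parameter `y`. -/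
noncomputable def R1 (y x : ℝ) : ℝ :=
  (1 / (Real.sqrt 2 * Real.pi)) * ∑ n ∈ Finset.Icc 1 ⌊y⌋₊,
    (divfun n : ℝ) / (n : ℝ) ^ ((3 : ℝ) / 4) * x ^ ((1 : ℝ) / 4) *
      Real.cos (4 * Real.pi * Real.sqrt (n * x) - Real.pi / 4)

/-- The tail `R₂(x) = Δ(x) - R₁(x)`. -/
noncomputable def R2 (y x : ℝ) : ℝ := DirichletDelta x - R1 y x

lemma divisor_bound (ε : ℝ) (hε : 0 < ε) :
    ∃ C : ℝ, 1 ≤ C ∧ ∀ n : ℕ, 1 ≤ n → (divfun n : ℝ) ≤ C * (n : ℝ) ^ ε := by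
  set c : ℝ := min 1 (ε * Real.log 2) with hc
  have hl : 0 < Real.log 2 := Real.log_pos (by norm_num)
  have hc0 : 0 < c := lt_min one_pos (by positivity)
  have hc1 : c ≤ 1 := min_le_left _ _
  set P : ℕ := ⌈(2 : ℝ) ^ (1 / ε)⌉₊ with hP
  have hinv : 1 ≤ 1 / c := by rw [le_div_iff₀ hc0]; linarith
  refine ⟨(1 / c) ^ P, one_le_pow₀ hinv, fun n hn => ?_⟩
  have hn0 : n ≠ 0 := by omega
  have key : ∀ p : ℕ, p.Prime → ∀ e : ℕ, ((e + 1 : ℕ) : ℝ) ≤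
      (if p < P then 1 / c else 1) * ((p : ℝ) ^ e) ^ ε := by
    intro p hp e
    have hp2 : (2 : ℝ) ≤ p := by exact_mod_cast hp.two_le
    have hrw : ((p : ℝ) ^ e) ^ ε = ((p : ℝ) ^ ε) ^ e := by
      rw [← Real.rpow_natCast, ← Real.rpow_natCast, ← Real.rpow_mul (by positivity),
        ← Real.rpow_mul (by positivity), mul_comm]
    rw [hrw]
    split_ifs with h
    · have h1 : 1 + ε * Real.log 2 ≤ (p : ℝ) ^ ε := by
        calc 1 + ε * Real.log 2 ≤ Real.exp (ε * Real.log 2) := by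
              linarith [Real.add_one_le_exp (ε * Real.log 2)]
          _ = (2 : ℝ) ^ ε := by rw [Real.rpow_def_of_pos (by norm_num), mul_comm]
          _ ≤ _ := Real.rpow_le_rpow (by norm_num) hp2 hε.le
      have h2 : 1 + (e : ℝ) * c ≤ ((p : ℝ) ^ ε) ^ e := by
        calc 1 + (e : ℝ) * c ≤ (1 + c) ^ e := one_add_mul_le_pow (by linarith) e
          _ ≤ _ := by
            apply pow_le_pow_left₀ (by linarith)
            linarith [min_le_right 1 (ε * Real.log 2)]
      push_cast
      rw [div_mul_eq_mul_div, one_mul, le_div_iff₀ hc0]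
      nlinarith
    · push_neg at h
      have h1 : (2 : ℝ) ≤ (p : ℝ) ^ ε := by
        have : (2 : ℝ) ^ (1 / ε) ≤ p := (Nat.le_ceil _).trans (by exact_mod_cast h)
        calc (2 : ℝ) = ((2 : ℝ) ^ (1 / ε)) ^ ε := by
              rw [← Real.rpow_mul (by norm_num)]; field_simp; simp
          _ ≤ _ := Real.rpow_le_rpow (by positivity) this hε.le
      have h2 : 1 + (e : ℝ) * 1 ≤ ((p : ℝ) ^ ε) ^ e := by
        calc 1 + (e : ℝ) * 1 ≤ (1 + 1) ^ e := one_add_mul_le_pow (by norm_num) e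
          _ ≤ _ := pow_le_pow_left₀ (by norm_num) (by linarith) e
      push_cast
      linarith
  unfold divfun
  rw [Nat.card_divisors hn0]
  have hprod : (n : ℝ) = ∏ p ∈ n.primeFactors, (p : ℝ) ^ (n.factorization p) := by
    conv_lhs => rw [← Nat.prod_factorization_pow_eq_self hn0]
    rw [Finsupp.prod]; push_cast; rfl
  have hpos : (n : ℝ) ^ ε = ∏ p ∈ n.primeFactors, ((p : ℝ) ^ (n.factorization p)) ^ ε := by
    conv_lhs => rw [hprod]
    rw [Real.finsetProd_rpow]
    intros; positivity
  rw [hpos]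
  push_cast
  calc ∏ p ∈ n.primeFactors, ((n.factorization p : ℝ) + 1)
      ≤ ∏ p ∈ n.primeFactors, ((if p < P then 1 / c else 1) * ((p : ℝ) ^ (n.factorization p)) ^ ε) := by
        apply Finset.prod_le_prod
        · intros; positivity
        · intro p hp
          have := key p (Nat.prime_of_mem_primeFactors hp) (n.factorization p)
          push_cast at this
          exact this
    _ = (∏ p ∈ n.primeFactors, (if p < P then 1 / c else 1)) *
        ∏ p ∈ n.primeFactors, ((p : ℝ) ^ (n.factorization p)) ^ ε := Finset.prod_mul_distrib
    _ ≤ _ := by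
        apply mul_le_mul_of_nonneg_right _ (by positivity)
        rw [Finset.prod_ite, Finset.prod_const, Finset.prod_const_one, mul_one]
        apply pow_le_pow_right₀ hinv
        calc _ ≤ (Finset.range P).card := Finset.card_le_card (by
              intro p hp; simp at hp ⊢; exact hp.2)
          _ = P := Finset.card_range P

lemma hyp_count_aux (N M a : ℕ) (hM : N ≤ M) (ha : 1 ≤ a) :
    ∑ b ∈ Finset.Icc 1 M, (if a * b ≤ N then 1 else 0) = N / a := by
  rw [← Finset.sum_filter, Finset.sum_const, smul_eq_mul, mul_one]
  have : (Finset.Icc 1 M).filter (fun b => a * b ≤ N) = Finset.Icc 1 (N / a) := by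
    ext b
    simp only [Finset.mem_filter, Finset.mem_Icc]
    rw [Nat.le_div_iff_mul_le (by omega), mul_comm b a]
    constructor
    · rintro ⟨⟨h1, h2⟩, h3⟩; exact ⟨h1, h3⟩
    · rintro ⟨h1, h3⟩
      refine ⟨⟨h1, ?_⟩, h3⟩
      nlinarith
  rw [this]; simp

lemma hyp_count (N P Q : ℕ)
    (h1 : ∀ a b : ℕ, 1 ≤ a → 1 ≤ b → a * b ≤ N → a ≤ P ∨ b ≤ Q)
    (h2 : ∀ a b : ℕ, 1 ≤ a → 1 ≤ b → a ≤ P → b ≤ Q → a * b ≤ N) :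
    ∑ n ∈ Finset.Icc 1 N, divfun n + P * Q =
      ∑ a ∈ Finset.Icc 1 P, N / a + ∑ b ∈ Finset.Icc 1 Q, N / b := by
  set M := N + P + Q with hM
  have e1 : ∑ n ∈ Finset.Icc 1 N, divfun n =
      ∑ a ∈ Finset.Icc 1 M, ∑ b ∈ Finset.Icc 1 M, (if a * b ≤ N then 1 else 0) := by
    have := ArithmeticFunction.sum_Ioc_sigma0_eq_sum_div N
    have hI : Finset.Ioc 0 N = Finset.Icc 1 N := by ext; simp [Nat.succ_le_iff]
    rw [hI] at this
    have h3 : ∑ n ∈ Finset.Icc 1 N, divfun n = ∑ n ∈ Finset.Icc 1 N, N / n := by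
      rw [← this]
      refine Finset.sum_congr rfl fun n _ => ?_
      simp [divfun, ArithmeticFunction.sigma_zero_apply]
    rw [h3]
    rw [← Finset.sum_subset (Finset.Icc_subset_Icc_right (show N ≤ M by omega))
      (f := fun a => ∑ b ∈ Finset.Icc 1 M, (if a * b ≤ N then 1 else 0))]
    · refine Finset.sum_congr rfl fun n hn => ?_
      rw [hyp_count_aux N M n (by omega) (Finset.mem_Icc.1 hn).1]
    · intro a ha ha'
      simp only [Finset.mem_Icc, not_and, not_le] at ha ha'
      rw [hyp_count_aux N M a (by omega) ha.1]
      exact Nat.div_eq_of_lt (ha' ha.1)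
  have ePQ : ∀ K : ℕ, K ≤ M → ∑ a ∈ Finset.Icc 1 K, N / a =
      ∑ a ∈ Finset.Icc 1 M, ∑ b ∈ Finset.Icc 1 M, (if a ≤ K ∧ a * b ≤ N then 1 else 0) := by
    intro K hK
    rw [← Finset.sum_subset (Finset.Icc_subset_Icc_right hK)
      (f := fun a => ∑ b ∈ Finset.Icc 1 M, (if a ≤ K ∧ a * b ≤ N then 1 else 0))]
    · refine Finset.sum_congr rfl fun n hn => ?_
      have hn' := Finset.mem_Icc.1 hn
      rw [← hyp_count_aux N M n (by omega) hn'.1]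
      refine Finset.sum_congr rfl fun b _ => ?_
      simp [hn'.2]
    · intro a ha ha'
      simp only [Finset.mem_Icc, not_and, not_le] at ha ha'
      refine Finset.sum_eq_zero fun b _ => ?_
      have := ha' ha.1
      rw [if_neg]; omega
  have e4 : P * Q = ∑ a ∈ Finset.Icc 1 M, ∑ b ∈ Finset.Icc 1 M,
      (if a ≤ P ∧ b ≤ Q then 1 else 0) := by
    have : ∀ K, K ≤ M → ∑ a ∈ Finset.Icc 1 M, (if a ≤ K then 1 else 0) = K := by
      intro K hK
      rw [← Finset.sum_filter, Finset.sum_const, smul_eq_mul, mul_one]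
      have : (Finset.Icc 1 M).filter (fun b => b ≤ K) = Finset.Icc 1 K := by
        ext b
        simp only [Finset.mem_filter, Finset.mem_Icc]
        omega
      rw [this]; simp
    conv_lhs => rw [← this P (by omega), ← this Q (by omega), Finset.sum_mul_sum]
    refine Finset.sum_congr rfl fun a _ => Finset.sum_congr rfl fun b _ => ?_
    by_cases h : a ≤ P <;> by_cases h' : b ≤ Q <;> simp [h, h']
  rw [e1, e4, ePQ P (by omega), ePQ Q (by omega)]
  conv_rhs => 
    arg 2
    rw [Finset.sum_comm]
  rw [← Finset.sum_add_distrib, ← Finset.sum_add_distrib]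
  refine Finset.sum_congr rfl fun a ha => ?_
  rw [← Finset.sum_add_distrib, ← Finset.sum_add_distrib]
  refine Finset.sum_congr rfl fun b hb => ?_
  have ha' := (Finset.mem_Icc.1 ha).1
  have hb' := (Finset.mem_Icc.1 hb).1
  have g1 := h1 a b ha' hb'
  have g2 := h2 a b ha' hb'
  rw [mul_comm b a]
  clear e1 e4 ePQ h1 h2
  generalize a * b = z at *
  split_ifs <;> first | rfl | omega

/-- sawtooth -/
noncomputable def saw (t : ℝ) : ℝ := Int.fract t - 1 / 2

lemma abs_saw_le (t : ℝ) : |saw t| ≤ 1 / 2 := by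
  unfold saw
  have h1 := Int.fract_nonneg t
  have h2 := Int.fract_lt_one t
  rw [abs_le]; constructor <;> linarith

lemma harm_step (n : ℕ) (hn : 1 ≤ n) :
    Real.log (n + 1 : ℝ) - Real.log n ≤ (1 / (n : ℝ) + 1 / (n + 1)) / 2 ∧
    (1 / (n : ℝ) + 1 / (n + 1)) / 2 - (1 / (n : ℝ) ^ 2 - 1 / (n + 1 : ℝ) ^ 2) / 2 ≤
      Real.log (n + 1 : ℝ) - Real.log n := by
  have hn' : (1 : ℝ) ≤ n := by exact_mod_cast hn
  have hn0 : (0 : ℝ) < n := by linarith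
  rw [← Real.log_div (by positivity) (by positivity)]
  have hx : ((n : ℝ) + 1) / n = 1 + 1 / n := by field_simp
  constructor
  · have h1 : (0 : ℝ) ≤ Real.log (((n : ℝ) + 1) / n) := by
      apply Real.log_nonneg; rw [hx]; have : 0 < 1 / (n : ℝ) := by positivity
      linarith
    have h2 := Real.self_le_sinh_iff.2 h1
    rw [Real.sinh_log (by positivity)] at h2
    refine h2.trans (le_of_eq ?_)
    field_simp; ring
  · have h1 := Real.le_log_one_add_of_nonneg (x := 1 / (n : ℝ)) (by positivity)
    rw [hx]
    refine le_trans ?_ h1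
    have e : 2 * (1 / (n : ℝ)) / (1 / (n : ℝ) + 2) = 2 / (1 + 2 * n) := by field_simp
    rw [e]
    have : (1 / (n : ℝ) + 1 / (n + 1)) / 2 - (1 / (n : ℝ) ^ 2 - 1 / (n + 1 : ℝ) ^ 2) / 2
      - 2 / (1 + 2 * n) = ( - (3 * (n:ℝ)^2 + 3 * n + 1)) / (2 * (n : ℝ) ^ 2 * (n + 1) ^ 2 * (1 + 2 * n)) := by
      field_simp; ring
    have h3 : ( - (3 * (n:ℝ)^2 + 3 * n + 1)) / (2 * (n : ℝ) ^ 2 * (n + 1) ^ 2 * (1 + 2 * n)) ≤ 0 := by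
      apply div_nonpos_of_nonpos_of_nonneg
      · nlinarith
      · positivity
    linarith

lemma harm_nat (n : ℕ) (hn : 1 ≤ n) :
    |(harmonic n : ℝ) - Real.log n - Real.eulerMascheroniConstant - 1 / (2 * n)| ≤ 1 / (2 * (n : ℝ) ^ 2) := by
  have hl := Real.tendsto_harmonic_sub_log
  have t0 : Filter.Tendsto (fun n : ℕ => 1 / (2 * (n : ℝ))) Filter.atTop (nhds 0) := by
    have := (tendsto_one_div_atTop_nhds_zero_nat (𝕜 := ℝ)).const_mul (1 / 2)
    simp only [mul_zero] at this
    refine this.congr fun n => ?_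
    field_simp
  have t1 : Filter.Tendsto (fun n : ℕ => 1 / (2 * (n : ℝ) ^ 2)) Filter.atTop (nhds 0) := by
    have h := (tendsto_one_div_atTop_nhds_zero_nat (𝕜 := ℝ))
    have := (h.mul h).const_mul (1 / 2)
    simp only [mul_zero] at this
    refine this.congr fun n => ?_
    field_simp
  have hs : ∀ n : ℕ, (harmonic (n + 1) : ℝ) = harmonic n + 1 / (n + 1) := by
    intro n; rw [harmonic_succ]; push_cast; simp
  have up : ∀ m, n ≤ m → (harmonic n : ℝ) - Real.log n - 1 / (2 * n) ≤
      (harmonic m : ℝ) - Real.log m - 1 / (2 * m) := by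
    intro m hm
    induction m, hm using Nat.le_induction with
    | base => exact le_rfl
    | succ m hm ih =>
      refine ih.trans ?_
      have := (harm_step m (by omega)).1
      rw [hs]; push_cast
      have e1 : 1 / (2 * (m : ℝ)) = (1 / (m : ℝ)) / 2 := by ring
      have e2 : 1 / (2 * ((m : ℝ) + 1)) = (1 / ((m : ℝ) + 1)) / 2 := by
        rw [div_div]; ring
      rw [e1, e2]
      linarith
  have dn : ∀ m, n ≤ m → (harmonic m : ℝ) - Real.log m - 1 / (2 * m) + 1 / (2 * (m : ℝ) ^ 2) ≤
      (harmonic n : ℝ) - Real.log n - 1 / (2 * n) + 1 / (2 * (n : ℝ) ^ 2) := by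
    intro m hm
    induction m, hm using Nat.le_induction with
    | base => exact le_rfl
    | succ m hm ih =>
      refine le_trans ?_ ih
      have := (harm_step m (by omega)).2
      rw [hs]; push_cast
      have e1 : 1 / (2 * (m : ℝ)) = (1 / (m : ℝ)) / 2 := by ring
      have e2 : 1 / (2 * ((m : ℝ) + 1)) = (1 / ((m : ℝ) + 1)) / 2 := by
        rw [div_div]; ring
      have e3 : 1 / (2 * (m : ℝ) ^ 2) = (1 / (m : ℝ) ^ 2) / 2 := by ring
      have e4 : 1 / (2 * ((m : ℝ) + 1) ^ 2) = (1 / ((m : ℝ) + 1) ^ 2) / 2 := by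
        rw [div_div]; ring
      rw [e1, e2, e3, e4]
      linarith
  have l1 : (harmonic n : ℝ) - Real.log n - 1 / (2 * n) ≤ Real.eulerMascheroniConstant := by
    have := hl.sub t0
    rw [sub_zero] at this
    exact ge_of_tendsto this (Filter.eventually_atTop.2 ⟨n, up⟩)
  have l2 : Real.eulerMascheroniConstant ≤
      (harmonic n : ℝ) - Real.log n - 1 / (2 * n) + 1 / (2 * (n : ℝ) ^ 2) := by
    have := (hl.sub t0).add t1
    rw [sub_zero, add_zero] at this
    exact le_of_tendsto this (Filter.eventually_atTop.2 ⟨n, dn⟩)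
  rw [abs_le]
  have : 0 ≤ 1 / (2 * (n : ℝ) ^ 2) := by positivity
  constructor <;> linarith

lemma harm_real : ∃ C : ℝ, 0 < C ∧ ∀ A : ℝ, 1 / 3 ≤ A →
    |(harmonic ⌊A⌋₊ : ℝ) - Real.log A - Real.eulerMascheroniConstant + saw A / A| ≤ C / A ^ 2 := by
  have hl3 : Real.log 3 ≤ 2 := by
    have := Real.log_le_sub_one_of_pos (show (0:ℝ) < 3 by norm_num); linarith
  refine ⟨20, by norm_num, fun A hA => ?_⟩
  have hA0 : 0 < A := by linarith
  rcases lt_or_ge A 1 with h | h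
  · have hf : ⌊A⌋₊ = 0 := Nat.floor_eq_zero.2 h
    rw [hf]
    have h1 : Real.log A ≤ 0 := Real.log_nonpos hA0.le h.le
    have h2 : -2 ≤ Real.log A := by
      have : Real.log (1 / 3) ≤ Real.log A := Real.log_le_log (by norm_num) hA
      rw [one_div, Real.log_inv] at this; linarith
    have h3 : |saw A / A| ≤ 3 / 2 := by
      rw [abs_div, abs_of_pos hA0, div_le_iff₀ hA0]
      have := abs_saw_le A
      nlinarith
    have h4 : (20 : ℝ) ≤ 20 / A ^ 2 := by
      rw [le_div_iff₀ (by positivity)]; nlinarith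
    have g1 := Real.one_half_lt_eulerMascheroniConstant
    have g2 := Real.eulerMascheroniConstant_lt_two_thirds
    have h5 := abs_le.1 h3
    simp only [harmonic_zero, Rat.cast_zero]
    rw [abs_le]; constructor <;> linarith [h5.1, h5.2]
  · set n := ⌊A⌋₊ with hn
    have hn1 : 1 ≤ n := Nat.le_floor (by simpa using h)
    have hn1' : (1 : ℝ) ≤ n := by exact_mod_cast hn1
    have hnA : (n : ℝ) ≤ A := Nat.floor_le hA0.le
    have hnA' : A < n + 1 := Nat.lt_floor_add_one A
    have hfr : Int.fract A = A - n := by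
      rw [Int.fract, hn, natCast_floor_eq_intCast_floor hA0.le]
    set θ := A - n with hθ
    have hθ0 : 0 ≤ θ := by linarith
    have hθ1 : θ < 1 := by linarith
    have hx := harm_nat n hn1
    have hAn : A = n + θ := by rw [hθ]; ring
    have hsaw : saw A = θ - 1 / 2 := by rw [saw, hfr]
    have hlog : Real.log A - Real.log n = Real.log (1 + θ / n) := by
      rw [← Real.log_div (by positivity) (by positivity)]
      congr 1; rw [hAn]; field_simp
    have hn0 : (0:ℝ) < n := by linarith
    have hu : Real.log (1 + θ / n) ≤ θ / n := by
      have := Real.log_le_sub_one_of_pos (show 0 < 1 + θ / n by positivity); linarith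
    have hlow : θ / n - θ ^ 2 / n ^ 2 ≤ Real.log (1 + θ / n) := by
      have h1 := Real.le_log_one_add_of_nonneg (x := θ / (n : ℝ)) (by positivity)
      refine le_trans ?_ h1
      rw [le_div_iff₀ (by positivity)]
      have : (θ / n - θ ^ 2 / n ^ 2) * (θ / n + 2) = 2 * (θ / n) - (θ/n)^2 - (θ/n)^3 := by
        field_simp; ring
      rw [this]; have : 0 ≤ θ / n := by positivity
      nlinarith [pow_nonneg this 2, pow_nonneg this 3]
    have hd : 0 ≤ 1 / (n : ℝ) - 1 / A ∧ 1 / (n : ℝ) - 1 / A ≤ 1 / n ^ 2 := by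
      have e : 1 / (n : ℝ) - 1 / A = θ / (n * A) := by rw [hθ]; field_simp
      rw [e]
      refine ⟨by positivity, ?_⟩
      apply div_le_div₀ (by norm_num) hθ1.le (by positivity)
      nlinarith
    have hq : 1 / (n : ℝ) ^ 2 ≤ 4 / A ^ 2 := by
      rw [div_le_div_iff₀ (by positivity) (by positivity)]
      nlinarith
    have hq2 : θ ^ 2 / (n : ℝ) ^ 2 ≤ 1 / n ^ 2 := by
      apply div_le_div_of_nonneg_right _ (by positivity); nlinarith
    have e1 : (harmonic n : ℝ) - Real.log A - Real.eulerMascheroniConstant + saw A / A =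
      ((harmonic n : ℝ) - Real.log n - Real.eulerMascheroniConstant - 1 / (2 * n)) -
      (Real.log (1 + θ / n) - θ / n) + (1 / 2 - θ) * (1 / n - 1 / A) := by
      rw [← hlog, hsaw]; field_simp; ring
    rw [e1]
    have hx' := abs_le.1 hx
    have e2 : 1 / (2 * (n : ℝ) ^ 2) = (1 / (n : ℝ) ^ 2) / 2 := by ring
    rw [e2] at hx'
    have h20 : 20 / A ^ 2 = 5 * (4 / A ^ 2) := by ring
    have hp : 0 < 1 / (n : ℝ) ^ 2 := by positivity
    have m1 : |(1 / 2 - θ) * (1 / (n : ℝ) - 1 / A)| ≤ 1 / n ^ 2 := by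
      rw [abs_mul, abs_of_nonneg hd.1]
      have : |1 / 2 - θ| ≤ 1 := by rw [abs_le]; constructor <;> linarith
      calc _ ≤ 1 * (1 / (n : ℝ) - 1 / A) := mul_le_mul_of_nonneg_right this hd.1
        _ ≤ _ := by linarith [hd.2]
    have m1' := abs_le.1 m1
    rw [abs_le]; constructor <;> linarith [hx'.1, hx'.2, m1'.1, m1'.2]

lemma sum_floor_eq (x : ℝ) (hx : 0 ≤ x) (P : ℕ) :
    ((∑ a ∈ Finset.Icc 1 P, ⌊x⌋₊ / a : ℕ) : ℝ) =
      x * harmonic P - (∑ a ∈ Finset.Icc 1 P, saw (x / a)) - P / 2 := by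
  have h : ∀ a ∈ Finset.Icc 1 P, ((⌊x⌋₊ / a : ℕ) : ℝ) = x * (1 / (a : ℝ)) - saw (x / a) - 1 / 2 := by
    intro a _
    rw [← Nat.floor_div_natCast, saw, Int.fract, natCast_floor_eq_intCast_floor (by positivity)]
    ring
  push_cast
  have hh : ((harmonic P : ℚ) : ℝ) = ∑ a ∈ Finset.Icc 1 P, 1 / (a : ℝ) := by
    rw [harmonic_eq_sum_Icc]; push_cast; simp
  rw [hh, Finset.mul_sum]
  have : ∀ a ∈ Finset.Icc 1 P, (((⌊x⌋₊ / a : ℕ)) : ℝ) = x * (1 / (a : ℝ)) - saw (x / a) - 1 / 2 := h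
  rw [Finset.sum_congr rfl this, Finset.sum_sub_distrib, Finset.sum_sub_distrib]
  simp
  ring

lemma hyperbola : ∃ C : ℝ, 0 < C ∧ ∀ x A B : ℝ, 1 ≤ x → 0 < A → A * B = x →
    Real.sqrt x / 3 ≤ A → A ≤ 3 * Real.sqrt x →
    |DirichletDelta x + ∑ a ∈ Finset.Icc 1 ⌊A⌋₊, saw (x / a) +
      ∑ b ∈ Finset.Icc 1 ⌊B⌋₊, saw (x / b)| ≤ C := by
  obtain ⟨C, hC, hH⟩ := harm_real
  refine ⟨18 * C + 10, by positivity, fun x A B hx hA hAB h1 h2 => ?_⟩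
  have hs1 : 1 ≤ Real.sqrt x := Real.one_le_sqrt.2 hx
  have hss : Real.sqrt x * Real.sqrt x = x := Real.mul_self_sqrt (by linarith)
  have hB : B = x / A := by rw [← hAB]; field_simp
  have hB0 : 0 < B := by rw [hB]; positivity
  have hB1 : Real.sqrt x / 3 ≤ B := by
    rw [hB, le_div_iff₀ hA]; nlinarith
  have hc := hyp_count ⌊x⌋₊ ⌊A⌋₊ ⌊B⌋₊ (by
    intro a b ha hb hab
    by_contra! hcon
    have ha' := (Nat.floor_lt hA.le).1 hcon.1
    have hb' := (Nat.floor_lt hB0.le).1 hcon.2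
    have h3 : ((a * b : ℕ) : ℝ) ≤ x := (Nat.le_floor_iff (by linarith)).1 hab
    push_cast at h3
    nlinarith) (by
    intro a b ha hb hab hbb
    have ha' := (Nat.le_floor_iff hA.le).1 hab
    have hb' := (Nat.le_floor_iff hB0.le).1 hbb
    apply Nat.le_floor
    push_cast
    rw [← hAB]
    gcongr)
  have hc' : (∑ n ∈ Finset.Icc 1 ⌊x⌋₊, (divfun n : ℝ)) + (⌊A⌋₊ : ℝ) * ⌊B⌋₊ =
      (x * harmonic ⌊A⌋₊ - (∑ a ∈ Finset.Icc 1 ⌊A⌋₊, saw (x / a)) - ⌊A⌋₊ / 2) +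
      (x * harmonic ⌊B⌋₊ - (∑ a ∈ Finset.Icc 1 ⌊B⌋₊, saw (x / a)) - ⌊B⌋₊ / 2) := by
    rw [← sum_floor_eq x (by linarith), ← sum_floor_eq x (by linarith)]
    exact_mod_cast hc
  have hfA : (⌊A⌋₊ : ℝ) = A - 1 / 2 - saw A := by
    rw [saw, Int.fract, natCast_floor_eq_intCast_floor hA.le]; ring
  have hfB : (⌊B⌋₊ : ℝ) = B - 1 / 2 - saw B := by
    rw [saw, Int.fract, natCast_floor_eq_intCast_floor hB0.le]; ring
  have HA := hH A (by linarith)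
  have HB := hH B (by linarith)
  set eA := (harmonic ⌊A⌋₊ : ℝ) - Real.log A - Real.eulerMascheroniConstant + saw A / A with heA
  set eB := (harmonic ⌊B⌋₊ : ℝ) - Real.log B - Real.eulerMascheroniConstant + saw B / B with heB
  have hlog : Real.log x = Real.log A + Real.log B := by
    rw [← hAB, Real.log_mul hA.ne' hB0.ne']
  have kA : |x * eA| ≤ 9 * C := by
    rw [abs_mul, abs_of_pos (by linarith)]
    calc x * |eA| ≤ x * (C / A ^ 2) := by gcongr
      _ = C * (x / A ^ 2) := by ring
      _ ≤ C * 9 := by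
        gcongr
        rw [div_le_iff₀ (by positivity)]; nlinarith
      _ = _ := by ring
  have kB : |x * eB| ≤ 9 * C := by
    rw [abs_mul, abs_of_pos (by linarith)]
    calc x * |eB| ≤ x * (C / B ^ 2) := by gcongr
      _ = C * (x / B ^ 2) := by ring
      _ ≤ C * 9 := by
        gcongr
        rw [div_le_iff₀ (by positivity)]; nlinarith
      _ = _ := by ring
  have iA : (harmonic ⌊A⌋₊ : ℝ) = eA + Real.log A + Real.eulerMascheroniConstant - saw A / A := by
    rw [heA]; ring
  have iB : (harmonic ⌊B⌋₊ : ℝ) = eB + Real.log B + Real.eulerMascheroniConstant - saw B / B := by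
    rw [heB]; ring
  have xA : x * (saw A / A) = B * saw A := by rw [← hAB]; field_simp
  have xB : x * (saw B / B) = A * saw B := by rw [← hAB]; field_simp
  have main : DirichletDelta x + ∑ a ∈ Finset.Icc 1 ⌊A⌋₊, saw (x / a) +
      ∑ b ∈ Finset.Icc 1 ⌊B⌋₊, saw (x / b) = x * eA + x * eB +
       (1 / 2 + saw A) / 2 + (1 / 2 + saw B) / 2 - (1 / 2 + saw A) * (1 / 2 + saw B) := by
    unfold DirichletDelta
    rw [eq_sub_of_add_eq hc', hlog, hfA, hfB, iA, iB]
    have e : x * (eA + Real.log A + Real.eulerMascheroniConstant - saw A / A) =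
      x * eA + x * Real.log A + x * Real.eulerMascheroniConstant - B * saw A := by rw [← xA]; ring
    have e' : x * (eB + Real.log B + Real.eulerMascheroniConstant - saw B / B) =
      x * eB + x * Real.log B + x * Real.eulerMascheroniConstant - A * saw B := by rw [← xB]; ring
    rw [e, e']
    linear_combination -hAB
  rw [main]
  have sA := abs_le.1 (abs_saw_le A)
  have sB := abs_le.1 (abs_saw_le B)
  have pA := abs_le.1 kA
  have pB := abs_le.1 kB
  have q0 : 0 ≤ (1 / 2 + saw A) * (1 / 2 + saw B) := mul_nonneg (by linarith [sA.1]) (by linarith [sB.1])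
  have q1 : (1 / 2 + saw A) * (1 / 2 + saw B) ≤ 1 := by
    have := mul_le_mul (show 1 / 2 + saw A ≤ 1 by linarith [sA.2]) (show 1 / 2 + saw B ≤ 1 by linarith [sB.2]) (by linarith [sB.1]) (by norm_num)
    linarith
  rw [abs_le]; constructor <;> linarith [sA.1, sA.2, sB.1, sB.2, pA.1, pA.2, pB.1, pB.2]

/-- smooth cut -/
noncomputable def gz (s : ℝ) : ℝ := 2 * Real.smoothTransition ((1 - s) / 2)

lemma smoothTransition_add (t : ℝ) : Real.smoothTransition t + Real.smoothTransition (1 - t) = 1 := by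
  have h := Real.smoothTransition.pos_denom t
  unfold Real.smoothTransition
  rw [show 1 - (1 - t) = t by ring, add_comm (expNegInvGlue (1 - t)) (expNegInvGlue t), ← add_div, div_self h.ne']

lemma gz_contDiff {n : ℕ∞} : ContDiff ℝ n gz := by
  unfold gz
  exact contDiff_const.mul (Real.smoothTransition.contDiff.comp ((contDiff_const.sub contDiff_id).div_const 2))

lemma gz_add (s : ℝ) : gz s + gz (-s) = 2 := by
  unfold gz
  have := smoothTransition_add ((1 - s) / 2)
  rw [show 1 - (1 - s) / 2 = (1 - -s) / 2 by ring] at this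
  linarith

lemma gz_left {s : ℝ} (h : s ≤ -1) : gz s = 2 := by
  unfold gz; rw [Real.smoothTransition.one_of_one_le (by linarith)]; norm_num

lemma gz_right {s : ℝ} (h : 1 ≤ s) : gz s = 0 := by
  unfold gz; rw [Real.smoothTransition.zero_of_nonpos (by linarith)]; norm_num

lemma gz_nonneg (s : ℝ) : 0 ≤ gz s := by
  unfold gz; have := Real.smoothTransition.nonneg ((1 - s) / 2); linarith

lemma gz_le (s : ℝ) : gz s ≤ 2 := by
  unfold gz; have := Real.smoothTransition.le_one ((1 - s) / 2); linarith

/-- averaging weight -/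
noncomputable def wz (s : ℝ) : ℝ := - deriv gz s / 2

lemma wz_cont : Continuous wz := by
  unfold wz
  exact ((gz_contDiff (n := 1)).continuous_deriv le_rfl).neg.div_const 2

lemma gz_diff : Differentiable ℝ gz := (gz_contDiff (n := 1)).differentiable (by norm_num)

lemma wz_even (s : ℝ) : wz (-s) = wz s := by
  have h : gz = fun s => 2 - gz (-s) := by
    funext s; linarith [gz_add s]
  have h2 : deriv gz s = deriv gz (-s) := by
    conv_lhs => rw [h]
    rw [deriv_const_sub, deriv_comp_neg]; simp
  unfold wz; rw [h2]

lemma wz_integral (a b : ℝ) : ∫ t in a..b, wz t = (gz a - gz b) / 2 := by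
  unfold wz
  rw [intervalIntegral.integral_div, intervalIntegral.integral_neg, intervalIntegral.integral_deriv_eq_sub]
  · ring
  · intro x _; exact gz_diff x
  · exact ((gz_contDiff (n := 1)).continuous_deriv le_rfl).intervalIntegrable _ _

lemma wz_ind (s : ℝ) : ∫ t in (-1 : ℝ)..1, (if s ≤ -t then wz t else 0) = gz s / 2 := by
  rcases le_or_gt 1 s with h | h
  · rw [gz_right h]
    rw [show (0:ℝ) / 2 = ∫ t in (-1 : ℝ)..1, (0:ℝ) by simp]
    apply intervalIntegral.integral_congr_ae
    apply Filter.Eventually.of_forall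
    intro t ht
    rw [Set.uIoc_of_le (by norm_num)] at ht
    rw [if_neg]; linarith [ht.1]
  rcases le_or_gt s (-1) with h' | h'
  · rw [gz_left h']
    have : ∫ t in (-1 : ℝ)..1, (if s ≤ -t then wz t else 0) = ∫ t in (-1 : ℝ)..1, wz t := by
      apply intervalIntegral.integral_congr
      intro t ht
      rw [Set.uIcc_of_le (by norm_num)] at ht
      simp only
      rw [if_pos]; linarith [ht.2]
    rw [this, wz_integral, gz_left le_rfl, gz_right le_rfl]; norm_num
  · have := intervalIntegral.integral_indicator (f := wz) (μ := volume) (a₁ := -1) (a₂ := -s) (a₃ := 1)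
      ⟨by linarith, by linarith⟩
    rw [wz_integral, gz_left le_rfl] at this
    have e : (2 - gz (-s)) / 2 = gz s / 2 := by linarith [gz_add s]
    rw [← e, ← this]
    apply intervalIntegral.integral_congr
    intro t _
    simp only [Set.indicator, Set.mem_ofPred_eq]
    congr 1
    simp [le_neg]

lemma wz_ind' (s : ℝ) : ∫ t in (-1 : ℝ)..1, (if s ≤ t then wz t else 0) = gz s / 2 := by
  rw [← wz_ind s]
  have := intervalIntegral.integral_comp_neg (a := -1) (b := 1) (fun t => if s ≤ t then wz t else 0)
  simp only [wz_even, neg_neg] at this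
  rw [this]

lemma ite_wz_integrable (s a b : ℝ) : IntervalIntegrable (fun t => if s ≤ t then wz t else 0) volume a b := by
  have h := wz_cont.intervalIntegrable (μ := volume) a b
  have : (fun t => if s ≤ t then wz t else 0) = (Set.Ici s).indicator wz := by
    funext t; simp [Set.indicator]
  rw [this]
  exact ⟨h.1.indicator measurableSet_Ici, h.2.indicator measurableSet_Ici⟩

lemma ite_wz_integrable' (s a b : ℝ) : IntervalIntegrable (fun t => if s ≤ -t then wz t else 0) volume a b := by
  have h := wz_cont.intervalIntegrable (μ := volume) a b
  have : (fun t => if s ≤ -t then wz t else 0) = (Set.Iic (-s)).indicator wz := by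
    funext t; simp [Set.indicator, le_neg]
  rw [this]
  exact ⟨h.1.indicator measurableSet_Iic, h.2.indicator measurableSet_Iic⟩

lemma cut_avg : ∃ C : ℝ, 0 < C ∧ ∀ U : ℝ, 1 ≤ U → ∀ N : ℕ, 3 * U ≤ N →
    |DirichletDelta (U ^ 2) + ∑ a ∈ Finset.Icc 1 N, gz (Real.log (a / U)) * saw (U ^ 2 / a)| ≤ C := by
  obtain ⟨C, hC, hH⟩ := hyperbola
  obtain ⟨M, hM⟩ := (isCompact_Icc (a := (-1:ℝ)) (b := 1)).exists_bound_of_continuousOn wz_cont.continuousOn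
  have hM0 : 0 ≤ M := (norm_nonneg _).trans (hM 0 (by norm_num))
  refine ⟨M * C * 2 + 1, by positivity, fun U hU N hN => ?_⟩
  have hU0 : 0 < U := by linarith
  have he3 : Real.exp 1 ≤ 3 := by linarith [Real.exp_one_lt_d9]
  set D := DirichletDelta (U ^ 2)
  -- sums as indicator sums
  have hsum : ∀ τ : ℝ, τ ≤ 1 → ∑ a ∈ Finset.Icc 1 ⌊U * Real.exp τ⌋₊, saw (U ^ 2 / a) =
      ∑ a ∈ Finset.Icc 1 N, (if Real.log (a / U) ≤ τ then saw (U ^ 2 / a) else 0) := by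
    intro τ hτ
    rw [← Finset.sum_filter]
    refine Finset.sum_congr ?_ fun _ _ => rfl
    ext a
    simp only [Finset.mem_Icc, Finset.mem_filter]
    have key : 1 ≤ a → (a ≤ ⌊U * Real.exp τ⌋₊ ↔ Real.log (a / U) ≤ τ) := by
      intro ha
      have ha' : (0:ℝ) < a := by exact_mod_cast ha
      rw [Nat.le_floor_iff (by positivity), Real.log_le_iff_le_exp (by positivity), div_le_iff₀ hU0, mul_comm]
    constructor
    · rintro ⟨h1, h2⟩
      refine ⟨⟨h1, ?_⟩, (key h1).1 h2⟩
      have h3 := (Nat.le_floor_iff (by positivity)).1 h2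
      have : (a : ℝ) ≤ N := by
        refine h3.trans (le_trans ?_ hN)
        have : Real.exp τ ≤ 3 := (Real.exp_le_exp.2 hτ).trans he3
        nlinarith
      exact_mod_cast this
    · rintro ⟨⟨h1, h2⟩, h3⟩
      exact ⟨h1, (key h1).2 h3⟩
  have hF : ∀ τ ∈ Set.Icc (-1:ℝ) 1, |D + ∑ a ∈ Finset.Icc 1 N, (if Real.log (a / U) ≤ τ then saw (U ^ 2 / a) else 0)
      + ∑ a ∈ Finset.Icc 1 N, (if Real.log (a / U) ≤ -τ then saw (U ^ 2 / a) else 0)| ≤ C := by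
    intro τ hτ
    rw [← hsum τ hτ.2, ← hsum (-τ) (by linarith [hτ.1])]
    have hsq : Real.sqrt (U ^ 2) = U := Real.sqrt_sq hU0.le
    apply hH (U ^ 2) (U * Real.exp τ) (U * Real.exp (-τ)) (by nlinarith) (by positivity)
    · rw [Real.exp_neg]; field_simp
    · rw [hsq]
      have : Real.exp (-1) ≤ Real.exp τ := Real.exp_le_exp.2 hτ.1
      have h3 : 1 / 3 ≤ Real.exp (-1) := by
        rw [Real.exp_neg, ← one_div]
        exact one_div_le_one_div_of_le (Real.exp_pos _) he3
      nlinarith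
    · rw [hsq]
      have : Real.exp τ ≤ 3 := (Real.exp_le_exp.2 hτ.2).trans he3
      nlinarith
  have hI : ∫ t in (-1:ℝ)..1, wz t * (D + ∑ a ∈ Finset.Icc 1 N, (if Real.log (a / U) ≤ t then saw (U ^ 2 / a) else 0)
      + ∑ a ∈ Finset.Icc 1 N, (if Real.log (a / U) ≤ -t then saw (U ^ 2 / a) else 0)) =
      D + ∑ a ∈ Finset.Icc 1 N, gz (Real.log (a / U)) * saw (U ^ 2 / a) := by
    have e : ∀ t : ℝ, wz t * (D + ∑ a ∈ Finset.Icc 1 N, (if Real.log (a / U) ≤ t then saw (U ^ 2 / a) else 0)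
      + ∑ a ∈ Finset.Icc 1 N, (if Real.log (a / U) ≤ -t then saw (U ^ 2 / a) else 0)) =
      wz t * D + (∑ a ∈ Finset.Icc 1 N, (if Real.log (a / U) ≤ t then wz t else 0) * saw (U ^ 2 / a)) +
       ∑ a ∈ Finset.Icc 1 N, (if Real.log (a / U) ≤ -t then wz t else 0) * saw (U ^ 2 / a) := by
      intro t
      rw [mul_add, mul_add, Finset.mul_sum, Finset.mul_sum]
      congr 1
      · congr 1
        refine Finset.sum_congr rfl fun a _ => ?_
        split_ifs <;> simp
      · refine Finset.sum_congr rfl fun a _ => ?_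
        split_ifs <;> simp
    simp_rw [e]
    have i1 : IntervalIntegrable (fun t => wz t * D) volume (-1) 1 :=
      (wz_cont.mul continuous_const).intervalIntegrable _ _
    have i2 : ∀ a ∈ Finset.Icc 1 N, IntervalIntegrable (fun t => (if Real.log ((a:ℝ) / U) ≤ t then wz t else 0) * saw (U ^ 2 / a)) volume (-1) 1 :=
      fun a _ => (ite_wz_integrable _ _ _).mul_const _
    have i3 : ∀ a ∈ Finset.Icc 1 N, IntervalIntegrable (fun t => (if Real.log ((a:ℝ) / U) ≤ -t then wz t else 0) * saw (U ^ 2 / a)) volume (-1) 1 :=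
      fun a _ => (ite_wz_integrable' _ _ _).mul_const _
    have j2 : IntervalIntegrable (fun t => ∑ a ∈ Finset.Icc 1 N, (if Real.log ((a:ℝ) / U) ≤ t then wz t else 0) * saw (U ^ 2 / a)) volume (-1) 1 := by
      have := IntervalIntegrable.sum _ i2
      rw [Finset.sum_fn] at this
      exact this
    have j3 : IntervalIntegrable (fun t => ∑ a ∈ Finset.Icc 1 N, (if Real.log ((a:ℝ) / U) ≤ -t then wz t else 0) * saw (U ^ 2 / a)) volume (-1) 1 := by
      have := IntervalIntegrable.sum _ i3
      rw [Finset.sum_fn] at this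
      exact this
    rw [intervalIntegral.integral_add (i1.add j2) j3, intervalIntegral.integral_add i1 j2,
      intervalIntegral.integral_finsetSum i2, intervalIntegral.integral_finsetSum i3]
    simp only [intervalIntegral.integral_mul_const, wz_ind, wz_ind', wz_integral]
    rw [gz_left le_rfl, gz_right le_rfl, add_assoc, ← Finset.sum_add_distrib]
    congr 1
    · ring
    · refine Finset.sum_congr rfl fun a _ => ?_
      ring
  rw [← hI, ← Real.norm_eq_abs]
  have := intervalIntegral.norm_integral_le_of_norm_le_const (a := (-1:ℝ)) (b := 1) (C := M * C)
    (f := fun t => wz t * (D + ∑ a ∈ Finset.Icc 1 N, (if Real.log (a / U) ≤ t then saw (U ^ 2 / a) else 0)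
      + ∑ a ∈ Finset.Icc 1 N, (if Real.log (a / U) ≤ -t then saw (U ^ 2 / a) else 0))) (by
    intro t ht
    rw [Set.uIoc_of_le (by norm_num)] at ht
    have ht' : t ∈ Set.Icc (-1:ℝ) 1 := ⟨ht.1.le, ht.2⟩
    rw [norm_mul]
    exact mul_le_mul (hM t ht') (hF t ht') (norm_nonneg _) hM0)
  refine this.trans ?_
  norm_num

/-- the full cut-off function -/
noncomputable def gc (S s : ℝ) : ℝ := gz s * Real.smoothTransition (s + S)

lemma cut_avg2 : ∃ C : ℝ, 0 < C ∧ ∀ U : ℝ, 1 ≤ U → ∀ S : ℝ, ∀ N : ℕ, 3 * U ≤ N →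
    |DirichletDelta (U ^ 2) + ∑ a ∈ Finset.Icc 1 N, gc S (Real.log (a / U)) * saw (U ^ 2 / a)| ≤
      C * (1 + U * Real.exp (-S)) := by
  obtain ⟨C, hC, hH⟩ := cut_avg
  refine ⟨C + 3, by positivity, fun U hU S N hN => ?_⟩
  have hU0 : 0 < U := by linarith
  have he3 : Real.exp 1 ≤ 3 := by linarith [Real.exp_one_lt_d9]
  have h1 := hH U hU N hN
  have h2 : |∑ a ∈ Finset.Icc 1 N, (gz (Real.log (a / U)) - gc S (Real.log (a / U))) * saw (U ^ 2 / a)| ≤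
      3 * (U * Real.exp (-S)) := by
    calc _ ≤ ∑ a ∈ Finset.Icc 1 N, |(gz (Real.log (a / U)) - gc S (Real.log (a / U))) * saw (U ^ 2 / a)| :=
          Finset.abs_sum_le_sum_abs _ _
      _ ≤ ∑ a ∈ Finset.Icc 1 N, (if a ≤ ⌊U * Real.exp (1 - S)⌋₊ then (1:ℝ) else 0) := by
          refine Finset.sum_le_sum fun a ha => ?_
          have ha' : (0:ℝ) < a := by exact_mod_cast (Finset.mem_Icc.1 ha).1
          split_ifs with h
          · have q1 : |gz (Real.log (a / U)) - gc S (Real.log (a / U))| ≤ 2 := by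
              have e : gz (Real.log (a / U)) - gc S (Real.log (a / U)) =
                gz (Real.log (a / U)) * (1 - Real.smoothTransition (Real.log (a / U) + S)) := by unfold gc; ring
              rw [e, abs_mul, abs_of_nonneg (gz_nonneg _)]
              have b1 := Real.smoothTransition.nonneg (Real.log (a / U) + S)
              have b2 := Real.smoothTransition.le_one (Real.log (a / U) + S)
              rw [abs_of_nonneg (by linarith)]
              nlinarith [gz_nonneg (Real.log (a / U)), gz_le (Real.log (a / U))]
            rw [abs_mul]
            have := mul_le_mul q1 (abs_saw_le (U ^ 2 / a)) (abs_nonneg _) (by norm_num)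
            linarith
          · rw [Nat.le_floor_iff (by positivity), not_le] at h
            have : 1 - S ≤ Real.log (a / U) := by
              rw [Real.le_log_iff_exp_le (by positivity), le_div_iff₀ hU0]; linarith
            rw [gc, Real.smoothTransition.one_of_one_le (by linarith)]
            simp
      _ ≤ ⌊U * Real.exp (1 - S)⌋₊ := by
          rw [← Finset.sum_filter, Finset.sum_const, nsmul_eq_mul, mul_one]
          have : (Finset.Icc 1 N).filter (fun a => a ≤ ⌊U * Real.exp (1 - S)⌋₊) ⊆ Finset.Icc 1 ⌊U * Real.exp (1 - S)⌋₊ := by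
            intro a; simp only [Finset.mem_filter, Finset.mem_Icc]; tauto
          have := Finset.card_le_card this
          rw [Nat.card_Icc, Nat.add_sub_cancel] at this
          exact_mod_cast this
      _ ≤ U * Real.exp (1 - S) := Nat.floor_le (by positivity)
      _ ≤ _ := by
          rw [sub_eq_add_neg, Real.exp_add]
          have : 0 < U * Real.exp (-S) := by positivity
          nlinarith
  have e : DirichletDelta (U ^ 2) + ∑ a ∈ Finset.Icc 1 N, gc S (Real.log (a / U)) * saw (U ^ 2 / a) =
    (DirichletDelta (U ^ 2) + ∑ a ∈ Finset.Icc 1 N, gz (Real.log (a / U)) * saw (U ^ 2 / a)) -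
    ∑ a ∈ Finset.Icc 1 N, (gz (Real.log (a / U)) - gc S (Real.log (a / U))) * saw (U ^ 2 / a) := by
    simp_rw [sub_mul]; rw [Finset.sum_sub_distrib]; ring
  rw [e]
  refine (abs_sub _ _).trans ?_
  have : 0 < U * Real.exp (-S) := by positivity
  nlinarith

lemma delta_diff (ε : ℝ) (hε : 0 < ε) : ∃ C : ℝ, 0 < C ∧ ∀ x y : ℝ, 1 ≤ x → x ≤ y →
    |DirichletDelta y - DirichletDelta x| ≤ C * y ^ ε * (1 + (y - x)) := by
  obtain ⟨C, hC, hd⟩ := divisor_bound ε hε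
  refine ⟨C + 1 / ε + 2, by positivity, fun x y hx hxy => ?_⟩
  have hy : 1 ≤ y := hx.trans hxy
  have hye : 1 ≤ y ^ ε := Real.one_le_rpow hy hε.le
  have hfl : ⌊x⌋₊ ≤ ⌊y⌋₊ := Nat.floor_le_floor hxy
  have hs : ∑ n ∈ Finset.Icc 1 ⌊y⌋₊, (divfun n : ℝ) - ∑ n ∈ Finset.Icc 1 ⌊x⌋₊, (divfun n : ℝ) =
      ∑ n ∈ Finset.Ioc ⌊x⌋₊ ⌊y⌋₊, (divfun n : ℝ) := by
    rw [sub_eq_iff_eq_add, add_comm]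
    have : Finset.Icc 1 ⌊y⌋₊ = Finset.Icc 1 ⌊x⌋₊ ∪ Finset.Ioc ⌊x⌋₊ ⌊y⌋₊ := by
      ext n; simp only [Finset.mem_Icc, Finset.mem_union, Finset.mem_Ioc]; omega
    rw [this, Finset.sum_union]
    rw [Finset.disjoint_left]
    intro n; simp only [Finset.mem_Icc, Finset.mem_Ioc]; omega
  have hs1 : ∑ n ∈ Finset.Ioc ⌊x⌋₊ ⌊y⌋₊, (divfun n : ℝ) ≤ C * y ^ ε * (1 + (y - x)) := by
    calc ∑ n ∈ Finset.Ioc ⌊x⌋₊ ⌊y⌋₊, (divfun n : ℝ) ≤ ∑ n ∈ Finset.Ioc ⌊x⌋₊ ⌊y⌋₊, C * y ^ ε := by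
          refine Finset.sum_le_sum fun n hn => ?_
          have hn' := Finset.mem_Ioc.1 hn
          refine (hd n (by omega)).trans ?_
          have : (n : ℝ) ≤ y := (Nat.le_floor_iff (by linarith)).1 hn'.2
          gcongr
      _ = ((⌊y⌋₊ : ℝ) - ⌊x⌋₊) * (C * y ^ ε) := by
          rw [Finset.sum_const, Nat.card_Ioc, nsmul_eq_mul, Nat.cast_sub hfl]
      _ ≤ (1 + (y - x)) * (C * y ^ ε) := by
          have h1 := Nat.floor_le (show 0 ≤ y by linarith)
          have h2 := Nat.lt_floor_add_one x
          gcongr; linarith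
      _ = _ := by ring
  have hs0 : 0 ≤ ∑ n ∈ Finset.Ioc ⌊x⌋₊ ⌊y⌋₊, (divfun n : ℝ) := Finset.sum_nonneg fun _ _ => Nat.cast_nonneg _
  have hl : Real.log y ≤ y ^ ε / ε := Real.log_le_rpow_div (by linarith) hε
  have hl0 : 0 ≤ Real.log y := Real.log_nonneg hy
  have hxl : 0 ≤ x * (Real.log y - Real.log x) ∧ x * (Real.log y - Real.log x) ≤ y - x := by
    have h1 : Real.log x ≤ Real.log y := Real.log_le_log (by linarith) hxy
    refine ⟨mul_nonneg (by linarith) (by linarith), ?_⟩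
    rw [← Real.log_div (by linarith) (by linarith)]
    have := Real.log_le_sub_one_of_pos (show 0 < y / x by positivity)
    calc x * Real.log (y / x) ≤ x * (y / x - 1) := by gcongr
      _ = y - x := by field_simp
  have hg : |(2 * Real.eulerMascheroniConstant - 1)| ≤ 1 := by
    have g1 := Real.one_half_lt_eulerMascheroniConstant
    have g2 := Real.eulerMascheroniConstant_lt_two_thirds
    rw [abs_le]; constructor <;> linarith
  have e : DirichletDelta y - DirichletDelta x = ∑ n ∈ Finset.Ioc ⌊x⌋₊ ⌊y⌋₊, (divfun n : ℝ) -
      (y - x) * Real.log y - x * (Real.log y - Real.log x) - (2 * Real.eulerMascheroniConstant - 1) * (y - x) := by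
    rw [← hs]; unfold DirichletDelta; ring
  have h5 : (y - x) * Real.log y ≤ (1 / ε) * y ^ ε * (1 + (y - x)) := by
    have : (y - x) * Real.log y ≤ (1 + (y - x)) * (y ^ ε / ε) := by
      apply mul_le_mul (by linarith) hl hl0 (by linarith)
    refine this.trans (le_of_eq (by ring))
  have h6 : (y - x) ≤ y ^ ε * (1 + (y - x)) := by nlinarith
  have h7 : |(2 * Real.eulerMascheroniConstant - 1) * (y - x)| ≤ y - x := by
    rw [abs_mul, abs_of_nonneg (show 0 ≤ y - x by linarith)]
    have := mul_le_mul_of_nonneg_right hg (show 0 ≤ y - x by linarith)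
    linarith
  have h7' := abs_le.1 h7
  have h8 : 0 ≤ (y - x) * Real.log y := mul_nonneg (by linarith) hl0
  have h9 : (C + 1 / ε + 2) * y ^ ε * (1 + (y - x)) = C * y ^ ε * (1 + (y - x)) + (1 / ε) * y ^ ε * (1 + (y - x))
    + y ^ ε * (1 + (y - x)) + y ^ ε * (1 + (y - x)) := by ring
  have h10 : 0 ≤ C * y ^ ε * (1 + (y - x)) := hs0.trans hs1
  have h11 := h8.trans h5
  rw [e, h9, abs_le]
  constructor <;> linarith [hxl.1, hxl.2, h7'.1, h7'.2]

lemma delta_crude : ∃ C : ℝ, 0 < C ∧ ∀ U : ℝ, 1 ≤ U → |DirichletDelta (U ^ 2)| ≤ C * U := by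
  obtain ⟨C, hC, h⟩ := cut_avg
  refine ⟨C + 4, by positivity, fun U hU => ?_⟩
  have h1 := h U hU ⌈3 * U⌉₊ (Nat.le_ceil _)
  have h2 : |∑ a ∈ Finset.Icc 1 ⌈3 * U⌉₊, gz (Real.log (a / U)) * saw (U ^ 2 / a)| ≤ 4 * U := by
    calc _ ≤ ∑ a ∈ Finset.Icc 1 ⌈3 * U⌉₊, |gz (Real.log (a / U)) * saw (U ^ 2 / a)| := Finset.abs_sum_le_sum_abs _ _
      _ ≤ ∑ a ∈ Finset.Icc 1 ⌈3 * U⌉₊, (1 : ℝ) := by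
          refine Finset.sum_le_sum fun a _ => ?_
          rw [abs_mul, abs_of_nonneg (gz_nonneg _)]
          have := mul_le_mul (gz_le (Real.log (a / U))) (abs_saw_le (U ^ 2 / a)) (abs_nonneg _) (by norm_num)
          linarith
      _ ≤ _ := by
          simp
          have := Nat.ceil_lt_add_one (show 0 ≤ 3 * U by linarith)
          linarith
  have h1' := abs_le.1 h1
  have h2' := abs_le.1 h2
  have : C ≤ C * U := by nlinarith
  rw [abs_le]; constructor <;> linarith [h1'.1, h1'.2, h2'.1, h2'.2]

lemma delta_smooth (ε : ℝ) (hε : 0 < ε) : ∃ C : ℝ, 0 < C ∧ ∀ u h v : ℝ, 2 ≤ u → 0 < h → h ≤ 1 →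
    v ∈ Set.Icc (-1:ℝ) 1 →
    |DirichletDelta (u ^ 2) / u - DirichletDelta ((u + h * v) ^ 2) / (u + h * v)| ≤ C * u ^ ε * (1 / u + h) := by
  obtain ⟨C, hC, hd⟩ := delta_diff (ε / 2) (by positivity)
  obtain ⟨C', hC', hc⟩ := delta_crude
  refine ⟨C * 4 ^ (ε/2) * 5 + 2 * C', by positivity, fun u h v hu h0 h1 hv => ?_⟩
  have hhv : |h * v| ≤ h := by
    rw [abs_mul, abs_of_pos h0]
    have : |v| ≤ 1 := abs_le.2 hv
    nlinarith
  have hhv' := abs_le.1 hhv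
  set U := u + h * v with hU
  have hU1 : u / 2 ≤ U := by linarith [hhv'.1]
  have hU11 : 1 ≤ U := by linarith
  have hU2 : U ≤ 2 * u := by linarith [hhv'.2]
  have hUu : |U - u| ≤ h := by rw [hU]; simpa using hhv
  have hue : 1 ≤ u ^ ε := Real.one_le_rpow (by linarith) hε.le
  have hdiffsq : |U ^ 2 - u ^ 2| ≤ 3 * u * h := by
    have : U ^ 2 - u ^ 2 = (U - u) * (U + u) := by ring
    rw [this, abs_mul, abs_of_pos (show 0 < U + u by linarith)]
    have := mul_le_mul hUu (show U + u ≤ 3 * u by linarith) (by linarith) h0.le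
    linarith
  have hpow : ∀ z : ℝ, 0 ≤ z → z ≤ 2 * u → (z ^ 2) ^ (ε / 2) ≤ 4 ^ (ε/2) * u ^ ε := by
    intro z hz0 hz
    have : (4:ℝ) ^ (ε/2) * u ^ ε = ((2 * u) ^ 2) ^ (ε / 2) := by
      rw [mul_pow, Real.mul_rpow (by norm_num) (by positivity)]
      congr 1
      · norm_num
      · rw [← Real.rpow_natCast, ← Real.rpow_mul (by linarith)]; congr 1; push_cast; ring
    rw [this]
    gcongr
  have hD : |DirichletDelta (U ^ 2) - DirichletDelta (u ^ 2)| ≤ C * (4 ^ (ε/2) * u ^ ε) * (1 + 3 * u * h) := by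
    rcases le_total (u ^ 2) (U ^ 2) with hle | hle
    · refine (hd (u ^ 2) (U ^ 2) (by nlinarith) hle).trans ?_
      have := (abs_le.1 hdiffsq).2
      have h3 := hpow U (by linarith) hU2
      gcongr
    · rw [abs_sub_comm]
      refine (hd (U ^ 2) (u ^ 2) (by nlinarith) hle).trans ?_
      have := (abs_le.1 hdiffsq).1
      have h3 := hpow u (by linarith) (by linarith)
      gcongr
      linarith
  have e : DirichletDelta (u ^ 2) / u - DirichletDelta (U ^ 2) / U =
     -(DirichletDelta (U ^ 2) - DirichletDelta (u ^ 2)) / u + DirichletDelta (U ^ 2) / U * ((U - u) / u) := by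
    field_simp; ring
  rw [e]
  refine (abs_add_le _ _).trans ?_
  have t1 : |-(DirichletDelta (U ^ 2) - DirichletDelta (u ^ 2)) / u| ≤ C * 4 ^ (ε/2) * 5 * u ^ ε * (1 / u + h) := by
    rw [abs_div, abs_neg, abs_of_pos (show 0 < u by linarith)]
    calc _ ≤ C * (4 ^ (ε/2) * u ^ ε) * (1 + 3 * u * h) / u := by gcongr
      _ = C * 4 ^ (ε/2) * u ^ ε * (1 / u + 3 * h) := by field_simp
      _ ≤ C * 4 ^ (ε/2) * u ^ ε * (5 * (1 / u + h)) := by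
          gcongr
          have : 0 < 1 / u := by positivity
          linarith
      _ = _ := by ring
  have t2 : |DirichletDelta (U ^ 2) / U * ((U - u) / u)| ≤ 2 * C' * u ^ ε * (1 / u + h) := by
    have q1 : |DirichletDelta (U ^ 2) / U| ≤ C' := by
      rw [abs_div, abs_of_pos (show 0 < U by linarith), div_le_iff₀ (by linarith)]
      exact hc U hU11
    have q2 : |(U - u) / u| ≤ h := by
      rw [abs_div, abs_of_pos (show 0 < u by linarith), div_le_iff₀ (by linarith)]
      nlinarith
    rw [abs_mul]
    have q3 := mul_le_mul q1 q2 (abs_nonneg _) hC'.le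
    have q4 : 0 < 1 / u := by positivity
    have q5 : C' * h ≤ 2 * C' * u ^ ε * (1 / u + h) := by
      calc C' * h ≤ (2 * C') * 1 * (1 / u + h) := by nlinarith [mul_pos hC' q4, mul_pos hC' h0]
        _ ≤ _ := by gcongr
    linarith
  calc _ ≤ C * 4 ^ (ε/2) * 5 * u ^ ε * (1 / u + h) + 2 * C' * u ^ ε * (1 / u + h) := add_le_add t1 t2
    _ = _ := by ring

/-- combined pointwise -/
lemma delta_pointwise (ε : ℝ) (hε : 0 < ε) : ∃ C : ℝ, 0 < C ∧ ∀ u h v S : ℝ, 2 ≤ u → 0 < h → h ≤ 1 →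
    v ∈ Set.Icc (-1:ℝ) 1 → ∀ N : ℕ, 3 * (u + 1) ≤ N →
    |DirichletDelta (u ^ 2) / u + ∑ a ∈ Finset.Icc 1 N,
      (u + h * v)⁻¹ * gc S (Real.log (a / (u + h * v))) * saw ((u + h * v) ^ 2 / a)| ≤
      C * u ^ ε * (1 / u + h + Real.exp (-S)) := by
  obtain ⟨C, hC, hd⟩ := delta_smooth ε hε
  obtain ⟨C', hC', hc⟩ := cut_avg2
  refine ⟨C + 2 * C', by positivity, fun u h v S hu h0 h1 hv N hN => ?_⟩
  have H1 := hd u h v hu h0 h1 hv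
  have hhv : |h * v| ≤ h := by
    rw [abs_mul, abs_of_pos h0]
    have : |v| ≤ 1 := abs_le.2 hv
    nlinarith
  have hhv' := abs_le.1 hhv
  set U := u + h * v with hU
  have hU1 : u / 2 ≤ U := by linarith [hhv'.1]
  have hU11 : 1 ≤ U := by linarith
  have hue : 1 ≤ u ^ ε := Real.one_le_rpow (by linarith) hε.le
  have H2 := hc U hU11 S N (by linarith [hhv'.2])
  have e : DirichletDelta (u ^ 2) / u + ∑ a ∈ Finset.Icc 1 N,
      U⁻¹ * gc S (Real.log (a / U)) * saw (U ^ 2 / a) =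
     (DirichletDelta (u ^ 2) / u - DirichletDelta (U ^ 2) / U) + (DirichletDelta (U ^ 2) + ∑ a ∈ Finset.Icc 1 N,
      gc S (Real.log (a / U)) * saw (U ^ 2 / a)) / U := by
    have : ∑ a ∈ Finset.Icc 1 N, U⁻¹ * gc S (Real.log (a / U)) * saw (U ^ 2 / a) =
      (∑ a ∈ Finset.Icc 1 N, gc S (Real.log (a / U)) * saw (U ^ 2 / a)) / U := by
      rw [Finset.sum_div]
      refine Finset.sum_congr rfl fun a _ => ?_
      field_simp
    rw [this]; ring
  rw [e]
  refine (abs_add_le _ _).trans ?_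
  have t2 : |(DirichletDelta (U ^ 2) + ∑ a ∈ Finset.Icc 1 N,
      gc S (Real.log (a / U)) * saw (U ^ 2 / a)) / U| ≤ 2 * C' * u ^ ε * (1 / u + Real.exp (-S)) := by
    rw [abs_div, abs_of_pos (show 0 < U by linarith)]
    calc _ ≤ C' * (1 + U * Real.exp (-S)) / U := by gcongr
      _ = C' * 1 * (1 / U + Real.exp (-S)) := by field_simp
      _ ≤ C' * u ^ ε * (2 * (1 / u) + 2 * Real.exp (-S)) := by
          have : 1 / U ≤ 2 * (1 / u) := by
            calc 1 / U ≤ 1 / (u / 2) := one_div_le_one_div_of_le (by linarith) hU1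
              _ = _ := by field_simp
          have := Real.exp_pos (-S)
          gcongr
          linarith
      _ = _ := by ring
  have q4 : 0 < 1 / u := by positivity
  have := Real.exp_pos (-S)
  have k1 : C * u ^ ε * (1 / u + h) ≤ C * u ^ ε * (1 / u + h + Real.exp (-S)) := mul_le_mul_of_nonneg_left (by linarith) (by positivity)
  have k2 : 2 * C' * u ^ ε * (1 / u + Real.exp (-S)) ≤ 2 * C' * u ^ ε * (1 / u + h + Real.exp (-S)) := mul_le_mul_of_nonneg_left (by linarith) (by positivity)
  calc _ ≤ C * u ^ ε * (1 / u + h + Real.exp (-S)) + 2 * C' * u ^ ε * (1 / u + h + Real.exp (-S)) :=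
        add_le_add (H1.trans k1) (t2.trans k2)
    _ = _ := by ring

/-- integrated sawtooth -/
noncomputable def sawTwo (t : ℝ) : ℝ := (Int.fract t ^ 2 - Int.fract t + 1 / 6) / 2

lemma sawTwo_cont : Continuous sawTwo := by
  have := ContinuousOn.comp_fract'' (α := ℝ) (f := fun t : ℝ => (t ^ 2 - t + 1 / 6) / 2)
    (by fun_prop) (by norm_num)
  exact this

lemma bern2 (x : ℝ) : Polynomial.eval x (Polynomial.map (algebraMap ℚ ℝ) (Polynomial.bernoulli 2)) =
    x ^ 2 - x + 1 / 6 := by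
  rw [Polynomial.bernoulli]
  simp [Finset.sum_range_succ, _root_.bernoulli_two, _root_.bernoulli_one]
  ring

lemma sawTwo_hasSum (t : ℝ) : HasSum (fun n : ℕ => 1 / (2 * Real.pi ^ 2 * (n:ℝ) ^ 2) *
    Real.cos (2 * Real.pi * n * t)) (sawTwo t) := by
  have h := hasSum_one_div_nat_pow_mul_cos (k := 1) one_ne_zero (x := Int.fract t)
    ⟨Int.fract_nonneg t, (Int.fract_lt_one t).le⟩
  have h2 := h.mul_left (1 / (2 * Real.pi ^ 2))
  rw [show 2 * 1 = 2 from rfl, bern2] at h2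
  convert! h2 using 1
  · funext n
    have : Real.cos (2 * Real.pi * n * Int.fract t) = Real.cos (2 * Real.pi * n * t) := by
      have e : 2 * Real.pi * n * t = 2 * Real.pi * n * Int.fract t + ((n * ⌊t⌋ : ℤ) : ℝ) * (2 * Real.pi) := by
        have := Int.fract_add_floor t
        push_cast
        linear_combination (- 2 * Real.pi * n) * this
      rw [e, Real.cos_add_int_mul_two_pi]
    rw [this]; ring
  · unfold sawTwo
    have := Real.pi_ne_zero
    simp [Nat.factorial]
    field_simp

lemma sawTwo_comp_deriv {p : ℝ → ℝ} {p' x : ℝ} {a b : ℝ} (hx : x ∈ Set.Ioo a b)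
    (hm : MonotoneOn p (Set.Ioo a b)) (hp : HasDerivAt p p' x) :
    HasDerivWithinAt (fun y => sawTwo (p y)) (saw (p x) * p') (Set.Ioi x) x := by
  set m := ⌊p x⌋
  have h1 : HasDerivAt (fun y => ((p y - m) ^ 2 - (p y - m) + 1 / 6) / 2) (saw (p x) * p') x := by
    have h2 := (hp.sub_const (m : ℝ))
    have h3 := (((h2.pow 2).sub h2).add_const (1/6)).div_const 2
    convert! h3 using 1
    have : saw (p x) = p x - m - 1/2 := rfl
    rw [this]
    push_cast
    ring
  refine h1.hasDerivWithinAt.congr_of_eventuallyEq ?_ ?_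
  · have e1 : ∀ᶠ y in nhdsWithin x (Set.Ioi x), p y < m + 1 := by
      apply Filter.Eventually.filter_mono nhdsWithin_le_nhds
      exact hp.continuousAt.eventually_lt continuousAt_const (Int.lt_floor_add_one _)
    have e2 : ∀ᶠ y in nhdsWithin x (Set.Ioi x), y ∈ Set.Ioo a b :=
      Filter.Eventually.filter_mono nhdsWithin_le_nhds (Ioo_mem_nhds hx.1 hx.2)
    filter_upwards [e1, e2, self_mem_nhdsWithin] with y hy1 hy2 hy3
    have hge : p x ≤ p y := hm hx hy2 (le_of_lt hy3)
    have hfl : ⌊p y⌋ = m := by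
      rw [Int.floor_eq_iff]; exact ⟨(Int.floor_le (p x)).trans hge, hy1⟩
    unfold sawTwo
    rw [Int.fract, hfl]
  · unfold sawTwo
    rw [Int.fract]

lemma saw_measurable : Measurable saw := by
  unfold saw
  exact measurable_fract.sub_const _

lemma saw_fourier {p p' ω ω' : ℝ → ℝ} (hpc : Continuous p) (hp'c : Continuous p')
    (hp : ∀ x, HasDerivAt p (p' x) x) (hm : MonotoneOn p (Set.Icc (-1) 1))
    (hω : ∀ x ∈ Set.Icc (-1:ℝ) 1, HasDerivAt ω (ω' x) x)
    (hω' : ContinuousOn ω' (Set.Icc (-1) 1)) (h1 : ω (-1) = 0) (h2 : ω 1 = 0) :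
    HasSum (fun n : ℕ => 1 / (Real.pi * n) * ∫ v in (-1:ℝ)..1, ω v * (p' v * Real.sin (2 * Real.pi * n * p v)))
      (- ∫ v in (-1:ℝ)..1, ω v * (saw (p v) * p' v)) := by
  have hu : Set.uIcc (-1:ℝ) 1 = Set.Icc (-1) 1 := Set.uIcc_of_le (by norm_num)
  have hωc : ContinuousOn ω (Set.Icc (-1) 1) := fun x hx => (hω x hx).continuousAt.continuousWithinAt
  have hω'i : IntervalIntegrable ω' volume (-1) 1 := by
    apply ContinuousOn.intervalIntegrable; rw [hu]; exact hω'
  have hsi : IntervalIntegrable (fun v => saw (p v) * p' v) volume (-1) 1 := by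
    have := hp'c.intervalIntegrable (μ := volume) (-1) 1
    have hb : ∀ s : Set ℝ, IntegrableOn p' s volume → IntegrableOn (fun v => saw (p v) * p' v) s volume := by
      intro s hs
      exact Integrable.bdd_mul (c := 1/2) hs (saw_measurable.comp hpc.measurable).aestronglyMeasurable
        (Filter.Eventually.of_forall fun v => abs_saw_le _)
    exact ⟨hb _ this.1, hb _ this.2⟩
  have ibp1 : ∫ v in (-1:ℝ)..1, ω v * (saw (p v) * p' v) = - ∫ v in (-1:ℝ)..1, ω' v * sawTwo (p v) := by
    rw [intervalIntegral.integral_mul_deriv_eq_deriv_mul_of_hasDeriv_right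
      (u := ω) (v := fun v => sawTwo (p v)) (u' := ω') (v' := fun v => saw (p v) * p' v)
      (by rw [hu]; exact hωc) (sawTwo_cont.comp hpc).continuousOn]
    · simp [h1, h2]
    · intro x hx
      rw [min_eq_left (by norm_num), max_eq_right (by norm_num)] at hx
      exact (hω x ⟨hx.1.le, hx.2.le⟩).hasDerivWithinAt
    · intro x hx
      rw [min_eq_left (by norm_num), max_eq_right (by norm_num)] at hx
      exact sawTwo_comp_deriv hx (hm.mono Set.Ioo_subset_Icc_self) (hp x)
    · exact hω'i
    · exact hsi
  rw [ibp1, neg_neg]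
  obtain ⟨M, hM⟩ := (isCompact_Icc (a := (-1:ℝ)) (b := 1)).exists_bound_of_continuousOn hω'
  have hsumm : Summable (fun n : ℕ => M * (1 / (2 * Real.pi ^ 2 * (n:ℝ) ^ 2))) := by
    have := (Real.summable_one_div_nat_pow (p := 2)).2 (by norm_num)
    have := (this.mul_left (1 / (2 * Real.pi ^ 2))).mul_left M
    refine this.congr fun n => ?_
    ring
  have key := intervalIntegral.hasSum_integral_of_dominated_convergence (a := -1) (b := 1) (μ := volume)
    (F := fun (n : ℕ) v => ω' v * (1 / (2 * Real.pi ^ 2 * (n:ℝ) ^ 2) * Real.cos (2 * Real.pi * n * p v)))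
    (f := fun v => ω' v * sawTwo (p v))
    (fun n _ => M * (1 / (2 * Real.pi ^ 2 * (n:ℝ) ^ 2))) (by
      intro n
      have : IntervalIntegrable (fun v => ω' v * (1 / (2 * Real.pi ^ 2 * (n:ℝ) ^ 2) * Real.cos (2 * Real.pi * n * p v))) volume (-1) 1 := by
        apply ContinuousOn.intervalIntegrable
        rw [hu]
        apply hω'.mul
        apply Continuous.continuousOn
        fun_prop
      exact this.def'.aestronglyMeasurable) (by
      intro n
      refine Filter.Eventually.of_forall fun v hv => ?_
      rw [Set.uIoc_of_le (by norm_num)] at hv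
      rw [norm_mul, norm_mul]
      have b1 := hM v ⟨hv.1.le, hv.2⟩
      have b2 := Real.abs_cos_le_one (2 * Real.pi * n * p v)
      rw [Real.norm_of_nonneg (show 0 ≤ 1 / (2 * Real.pi ^ 2 * (n:ℝ) ^ 2) by positivity)]
      have b0 := (norm_nonneg _).trans b1
      apply mul_le_mul b1 _ (by positivity) b0
      exact mul_le_of_le_one_right (by positivity) b2)
    (Filter.Eventually.of_forall fun v _ => hsumm)
    (by simp) (Filter.Eventually.of_forall fun v _ => (sawTwo_hasSum (p v)).mul_left _)
  convert! key using 1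
  funext n
  rcases Nat.eq_zero_or_pos n with h0 | hn
  · subst h0; simp
  have hn' : (0:ℝ) < n := by exact_mod_cast hn
  have ibp2 := intervalIntegral.integral_mul_deriv_eq_deriv_mul (a := (-1:ℝ)) (b := 1) (u := ω) (u' := ω')
    (v := fun v => Real.cos (2 * Real.pi * n * p v))
    (v' := fun v => - Real.sin (2 * Real.pi * n * p v) * (2 * Real.pi * n * p' v)) (by rw [hu]; exact hω) (by
      intro x _
      exact ((hp x).const_mul (2 * Real.pi * n)).cos) hω'i (by
      apply Continuous.intervalIntegrable; fun_prop)
  simp only [h1, h2, zero_mul, sub_zero, zero_sub] at ibp2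
  have e1 : ∫ v in (-1:ℝ)..1, ω v * (- Real.sin (2 * Real.pi * n * p v) * (2 * Real.pi * n * p' v)) =
     -(2 * Real.pi * n) * ∫ v in (-1:ℝ)..1, ω v * (p' v * Real.sin (2 * Real.pi * n * p v)) := by
    rw [← intervalIntegral.integral_const_mul]
    apply intervalIntegral.integral_congr
    intro v _
    simp only
    ring
  rw [e1] at ibp2
  have e2 : ∫ v in (-1:ℝ)..1, ω' v * (1 / (2 * Real.pi ^ 2 * (n:ℝ) ^ 2) * Real.cos (2 * Real.pi * n * p v)) =
     1 / (2 * Real.pi ^ 2 * (n:ℝ) ^ 2) * ∫ v in (-1:ℝ)..1, ω' v * Real.cos (2 * Real.pi * n * p v) := by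
    rw [← intervalIntegral.integral_const_mul]
    apply intervalIntegral.integral_congr
    intro v _
    simp only
    ring
  rw [e2, neg_eq_iff_eq_neg.1 ibp2.symm]
  have := Real.pi_ne_zero
  field_simp

/-- bump used for averaging -/
noncomputable def phiB : ContDiffBump (0:ℝ) := ⟨1/2, 1, by norm_num, by norm_num⟩

/-- normalized bump -/
noncomputable def phi (v : ℝ) : ℝ := phiB.normed volume v

lemma phi_contDiff {n : ℕ∞} : ContDiff ℝ n phi := phiB.contDiff_normed
lemma phi_cont : Continuous phi := phiB.continuous_normed
lemma phi_nonneg (v : ℝ) : 0 ≤ phi v := phiB.nonneg_normed v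
lemma phi_compact : HasCompactSupport phi := phiB.hasCompactSupport_normed
lemma phi_support : Function.support phi = Set.Ioo (-1) 1 := by
  have : Function.support phi = Metric.ball 0 1 := phiB.support_normed_eq
  rw [this, Real.ball_eq_Ioo]; norm_num
lemma phi_zero {v : ℝ} (h : v ∉ Set.Ioo (-1:ℝ) 1) : phi v = 0 := by
  rw [← phi_support] at h; simpa using h
lemma phi_int : ∫ v in (-1:ℝ)..1, phi v = 1 := by
  rw [intervalIntegral.integral_eq_integral_of_support_subset]
  · exact phiB.integral_normed
  · rw [phi_support]; exact Set.Ioo_subset_Ioc_self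

lemma gc_contDiff {S : ℝ} {n : ℕ∞} : ContDiff ℝ n (gc S) := by
  unfold gc
  exact gz_contDiff.mul (Real.smoothTransition.contDiff.comp (contDiff_id.add contDiff_const))
lemma gc_cont {S : ℝ} : Continuous (gc S) := (gc_contDiff (n := 0)).continuous
lemma gc_nonneg (S s : ℝ) : 0 ≤ gc S s := mul_nonneg (gz_nonneg s) (Real.smoothTransition.nonneg _)
lemma gc_le (S s : ℝ) : gc S s ≤ 2 := by
  unfold gc
  have := gz_le s; have := gz_nonneg s
  have := Real.smoothTransition.nonneg (s + S); have := Real.smoothTransition.le_one (s + S)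
  nlinarith
lemma gc_right {S s : ℝ} (h : 1 ≤ s) : gc S s = 0 := by unfold gc; rw [gz_right h, zero_mul]
lemma gc_left {S s : ℝ} (h : s ≤ -S) : gc S s = 0 := by
  unfold gc; rw [Real.smoothTransition.zero_of_nonpos (by linarith), mul_zero]

lemma shift_pos {u h v : ℝ} (hu : 2 ≤ u) (h0 : 0 < h) (h1 : h ≤ 1) (hv : v ∈ Set.Icc (-1:ℝ) 1) :
    u / 2 ≤ u + h * v ∧ 1 ≤ u + h * v ∧ u + h * v ≤ u + 1 := by
  have a : -h ≤ h * v := by nlinarith [hv.1]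
  have b : h * v ≤ h := by nlinarith [hv.2]
  refine ⟨by linarith, by linarith, by linarith⟩

lemma saw_avg {u h S : ℝ} (hu : 2 ≤ u) (h0 : 0 < h) (h1 : h ≤ 1) {a : ℝ} (ha : 0 < a) :
    HasSum (fun n : ℕ => 1 / (Real.pi * n) * ∫ v in (-1:ℝ)..1,
      phi v * ((u + h * v)⁻¹ * gc S (Real.log (a / (u + h * v)))) * Real.sin (2 * Real.pi * (n * (u + h * v) ^ 2 / a)))
    (- ∫ v in (-1:ℝ)..1, phi v * ((u + h * v)⁻¹ * gc S (Real.log (a / (u + h * v))) * saw ((u + h * v) ^ 2 / a))) := by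
  set ω : ℝ → ℝ := fun v => a / (2 * h) * (phi v * ((u + h * v)⁻¹ * (u + h * v)⁻¹ * gc S (Real.log (a / (u + h * v))))) with hω
  set O : Set ℝ := {v | 0 < u + h * v} with hO
  have hOo : IsOpen O := isOpen_lt continuous_const (by fun_prop)
  have hsub : Set.Icc (-1:ℝ) 1 ⊆ O := fun v hv => by
    have := (shift_pos hu h0 h1 hv).2.1
    show 0 < u + h * v
    linarith
  have hC : ContDiffOn ℝ 1 ω O := by
    have hU : ContDiffOn ℝ 1 (fun v : ℝ => u + h * v) O := by fun_prop
    have hUi : ContDiffOn ℝ 1 (fun v : ℝ => (u + h * v)⁻¹) O := hU.inv fun v hv => ne_of_gt hv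
    have hl : ContDiffOn ℝ 1 (fun v : ℝ => Real.log (a / (u + h * v))) O := by
      apply ContDiffOn.log
      · simp_rw [div_eq_mul_inv]
        exact contDiffOn_const.mul hUi
      · intro v hv; exact (div_pos ha hv).ne'
    have hg : ContDiffOn ℝ 1 (fun v : ℝ => gc S (Real.log (a / (u + h * v)))) O :=
      (gc_contDiff (n := 1)).comp_contDiffOn hl
    exact contDiffOn_const.mul ((phi_contDiff (n := 1)).contDiffOn.mul ((hUi.mul hUi).mul hg))
  have key := saw_fourier (p := fun v => (u + h * v) ^ 2 / a) (p' := fun v => 2 * (u + h * v) * h / a)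
    (ω := ω) (ω' := deriv ω) (by fun_prop) (by fun_prop) (by
      intro x
      have := ((((hasDerivAt_id x).const_mul h).const_add u).pow 2).div_const a
      convert! this using 1
      simp) (by
      intro x hx y hy hxy
      have := (shift_pos hu h0 h1 hx).2.1
      show (u + h * x) ^ 2 / a ≤ (u + h * y) ^ 2 / a
      have : h * x ≤ h * y := by nlinarith
      gcongr) (by
      intro x hx
      exact ((hC.differentiableOn (by norm_num)).differentiableAt (hOo.mem_nhds (hsub hx))).hasDerivAt)
      ((hC.continuousOn_deriv_of_isOpen hOo le_rfl).mono hsub)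
      (by simp [hω, phi_zero (v := -1) (by simp)]) (by simp [hω, phi_zero (v := 1) (by simp)])
  convert! key using 1
  · funext n
    congr 1
    apply intervalIntegral.integral_congr
    intro v hv
    rw [Set.uIcc_of_le (by norm_num)] at hv
    have := (shift_pos hu h0 h1 hv).2.1
    have : 0 < u + h * v := by linarith
    simp only [hω]
    rw [show 2 * Real.pi * (n:ℝ) * ((u + h * v) ^ 2 / a) = 2 * Real.pi * (n * (u + h * v) ^ 2 / a) by ring]
    field_simp
  · congr 1
    apply intervalIntegral.integral_congr
    intro v hv
    rw [Set.uIcc_of_le (by norm_num)] at hv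
    have := (shift_pos hu h0 h1 hv).2.1
    have : 0 < u + h * v := by linarith
    simp only [hω]
    field_simp

lemma delta_series (ε : ℝ) (hε : 0 < ε) : ∃ C : ℝ, 0 < C ∧ ∀ u h S : ℝ, 2 ≤ u → 0 < h → h ≤ 1 →
    ∀ N : ℕ, 3 * (u + 1) ≤ N → ∃ W : ℝ, |DirichletDelta (u ^ 2) / u - W| ≤ C * u ^ ε * (1 / u + h + Real.exp (-S)) ∧
    HasSum (fun n : ℕ => 1 / (Real.pi * n) * ∑ a ∈ Finset.Icc 1 N, ∫ v in (-1:ℝ)..1,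
      phi v * ((u + h * v)⁻¹ * gc S (Real.log (a / (u + h * v)))) * Real.sin (2 * Real.pi * (n * (u + h * v) ^ 2 / a))) W := by
  obtain ⟨C, hC, hp⟩ := delta_pointwise ε hε
  refine ⟨C, hC, fun u h S hu h0 h1 N hN => ?_⟩
  set H : ℕ → ℝ → ℝ := fun a v => (u + h * v)⁻¹ * gc S (Real.log (a / (u + h * v))) * saw ((u + h * v) ^ 2 / a) with hH
  have hHi : ∀ a ∈ Finset.Icc 1 N, IntervalIntegrable (fun v => phi v * H a v) volume (-1) 1 := by
    intro a ha
    have hm : Measurable (H a) := by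
      have := gc_cont (S := S).measurable
      have := saw_measurable
      simp only [hH]
      fun_prop
    have : IntegrableOn (fun v => phi v * H a v) (Set.Ioc (-1) 1) volume := by
      refine Integrable.mono' (g := fun v => phi v * 2) ?_ (phi_cont.measurable.mul hm).aestronglyMeasurable ?_
      · exact ((phi_cont.mul continuous_const).intervalIntegrable (-1) 1).1
      · refine (ae_restrict_iff' measurableSet_Ioc).2 (Filter.Eventually.of_forall fun v hv => ?_)
        have hU := (shift_pos hu h0 h1 ⟨hv.1.le, hv.2⟩).2.1
        rw [norm_mul, Real.norm_of_nonneg (phi_nonneg v)]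
        apply mul_le_mul_of_nonneg_left _ (phi_nonneg v)
        simp only [hH]
        rw [norm_mul, norm_mul, Real.norm_of_nonneg (gc_nonneg _ _)]
        have b1 : ‖(u + h * v)⁻¹‖ ≤ 1 := by
          rw [Real.norm_of_nonneg (by positivity)]; exact inv_le_one_of_one_le₀ hU
        have b2 := gc_le S (Real.log (a / (u + h * v)))
        have b3 : ‖saw ((u + h * v) ^ 2 / a)‖ ≤ 1/2 := abs_saw_le _
        calc _ ≤ 1 * 2 * (1/2:ℝ) := by gcongr; exact gc_nonneg _ _
          _ ≤ 2 := by norm_num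
    rw [intervalIntegrable_iff, Set.uIoc_of_le (by norm_num)]
    exact this
  refine ⟨∑ a ∈ Finset.Icc 1 N, - ∫ v in (-1:ℝ)..1, phi v * H a v, ?_, ?_⟩
  · have e : DirichletDelta (u ^ 2) / u - ∑ a ∈ Finset.Icc 1 N, - ∫ v in (-1:ℝ)..1, phi v * H a v =
      ∫ v in (-1:ℝ)..1, phi v * (DirichletDelta (u ^ 2) / u + ∑ a ∈ Finset.Icc 1 N, H a v) := by
      simp_rw [mul_add]
      rw [intervalIntegral.integral_add]
      · rw [intervalIntegral.integral_mul_const, phi_int, one_mul]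
        simp_rw [Finset.mul_sum]
        rw [intervalIntegral.integral_finsetSum hHi]
        simp
      · exact (phi_cont.mul continuous_const).intervalIntegrable _ _
      · simp_rw [Finset.mul_sum]
        have := IntervalIntegrable.sum _ hHi
        rw [Finset.sum_fn] at this
        exact this
    rw [e]
    set K := C * u ^ ε * (1 / u + h + Real.exp (-S))
    have : ‖∫ v in (-1:ℝ)..1, phi v * (DirichletDelta (u ^ 2) / u + ∑ a ∈ Finset.Icc 1 N, H a v)‖ ≤
        ∫ v in (-1:ℝ)..1, phi v * K := by
      apply intervalIntegral.norm_integral_le_of_norm_le (by norm_num)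
      · refine Filter.Eventually.of_forall fun v hv => ?_
        rw [norm_mul, Real.norm_of_nonneg (phi_nonneg v)]
        apply mul_le_mul_of_nonneg_left _ (phi_nonneg v)
        exact hp u h v S hu h0 h1 ⟨hv.1.le, hv.2⟩ N hN
      · exact (phi_cont.mul continuous_const).intervalIntegrable _ _
    rw [intervalIntegral.integral_mul_const, phi_int, one_mul] at this
    exact this
  · simp_rw [Finset.mul_sum]
    apply hasSum_sum
    intro a ha
    apply saw_avg hu h0 h1
    have := (Finset.mem_Icc.1 ha).1
    exact_mod_cast this

/-- `e(x)` -/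
noncomputable def ec (x : ℝ) : ℂ := Complex.exp (2 * Real.pi * x * Complex.I)

lemma ec_cont : Continuous ec := by unfold ec; fun_prop
lemma ec_norm (x : ℝ) : ‖ec x‖ = 1 := by
  unfold ec
  rw [show (2 * Real.pi * x * Complex.I : ℂ) = ((2 * Real.pi * x : ℝ) : ℂ) * Complex.I by push_cast; ring]
  exact Complex.norm_exp_ofReal_mul_I _
lemma ec_add (x y : ℝ) : ec (x + y) = ec x * ec y := by
  unfold ec; rw [← Complex.exp_add]; congr 1; push_cast; ring
lemma ec_im (x : ℝ) : (ec x).im = Real.sin (2 * Real.pi * x) := by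
  unfold ec
  rw [show (2 * Real.pi * x * Complex.I : ℂ) = ((2 * Real.pi * x : ℝ) : ℂ) * Complex.I by push_cast; ring]
  exact Complex.exp_ofReal_mul_I_im _
lemma ec_re (x : ℝ) : (ec x).re = Real.cos (2 * Real.pi * x) := by
  unfold ec
  rw [show (2 * Real.pi * x * Complex.I : ℂ) = ((2 * Real.pi * x : ℝ) : ℂ) * Complex.I by push_cast; ring]
  exact Complex.exp_ofReal_mul_I_re _
lemma ec_deriv {p : ℝ → ℝ} {p' x : ℝ} (hp : HasDerivAt p p' x) :
    HasDerivAt (fun y => ec (p y)) (2 * Real.pi * Complex.I * p' * ec (p x)) x := by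
  unfold ec
  have h1 := hp.ofReal_comp
  have h2 := ((h1.const_mul (2 * Real.pi : ℂ)).mul_const Complex.I).cexp
  convert! h2 using 1
  ring

/-- multiplicative cutoff -/
noncomputable def Gc (S y : ℝ) : ℝ := if 0 < y then gc S (Real.log y) else 0

lemma Gc_small {S y : ℝ} (h : y ≤ Real.exp (-S)) : Gc S y = 0 := by
  unfold Gc
  split_ifs with h0
  · apply gc_left
    rw [Real.log_le_iff_le_exp h0]; exact h
  · rfl
lemma Gc_large {S y : ℝ} (h : Real.exp 1 ≤ y) : Gc S y = 0 := by
  unfold Gc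
  split_ifs with h0
  · apply gc_right
    rw [Real.le_log_iff_exp_le h0]; exact h
  · rfl
lemma Gc_nonneg (S y : ℝ) : 0 ≤ Gc S y := by
  unfold Gc; split_ifs; exacts [gc_nonneg _ _, le_rfl]
lemma Gc_le (S y : ℝ) : Gc S y ≤ 2 := by
  unfold Gc; split_ifs; exacts [gc_le _ _, by norm_num]
lemma Gc_meas {S : ℝ} : Measurable (Gc S) := by
  unfold Gc
  exact Measurable.ite measurableSet_Ioi (gc_cont.measurable.comp Real.measurable_log) measurable_const

/-- for each fixed `U` the summand is continuous -/
lemma Gc_ec_cont {S U c : ℝ} (hU : 0 < U) : Continuous (fun x : ℝ => (Gc S (x / U) : ℂ) * ec (c / x)) := by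
  rw [continuous_iff_continuousAt]
  intro x
  rcases lt_or_ge 0 x with hx | hx
  · have : (fun x : ℝ => (Gc S (x / U) : ℂ) * ec (c / x)) =ᶠ[nhds x]
      fun x => (gc S (Real.log (x / U)) : ℂ) * ec (c / x) := by
      filter_upwards [Ioi_mem_nhds hx] with y hy
      unfold Gc
      rw [if_pos (div_pos hy hU)]
    refine ContinuousAt.congr ?_ this.symm
    apply ContinuousAt.mul
    · apply Complex.continuous_ofReal.continuousAt.comp
      apply gc_cont.continuousAt.comp
      exact ContinuousAt.log (by fun_prop) (div_pos hx hU).ne'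
    · apply ec_cont.continuousAt.comp
      exact continuousAt_const.div continuousAt_id hx.ne'
  · have : (fun x : ℝ => (Gc S (x / U) : ℂ) * ec (c / x)) =ᶠ[nhds x] fun x => 0 := by
      have hd : x < U * Real.exp (-S) := hx.trans_lt (by positivity)
      filter_upwards [Iio_mem_nhds hd] with y hy
      rw [Gc_small, Complex.ofReal_zero, zero_mul]
      rw [div_le_iff₀ hU, mul_comm]; exact le_of_lt hy
    exact ContinuousAt.congr continuousAt_const this.symm

/-- averaged summand -/
noncomputable def FF (u h S : ℝ) (n : ℕ) (x : ℝ) : ℂ := ∫ v in (-1:ℝ)..1,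
  ((phi v * (u + h * v)⁻¹ : ℝ) : ℂ) * ((Gc S (x / (u + h * v)) : ℂ) * ec (n * (u + h * v) ^ 2 / x))

/-- its Fourier transform -/
noncomputable def JJ (u h S : ℝ) (n : ℕ) (m : ℝ) : ℂ := ∫ v in (-1:ℝ)..1,
  (phi v : ℂ) * ∫ s in (-S)..1, ((gc S s * Real.exp s : ℝ) : ℂ) * ec ((u + h * v) * (n * Real.exp (-s) - m * Real.exp s))

lemma FF_integrand_bound {u h S x v : ℝ} (n : ℕ) (hu : 2 ≤ u) (h0 : 0 < h) (h1 : h ≤ 1) (hv : v ∈ Set.Icc (-1:ℝ) 1) :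
    ‖((phi v * (u + h * v)⁻¹ : ℝ) : ℂ) * ((Gc S (x / (u + h * v)) : ℂ) * ec (n * (u + h * v) ^ 2 / x))‖ ≤
      phi v * 2 := by
  have hU := (shift_pos hu h0 h1 hv).2.1
  rw [norm_mul, norm_mul, ec_norm, mul_one, Complex.norm_real, Complex.norm_real, norm_mul,
    Real.norm_of_nonneg (phi_nonneg v), Real.norm_of_nonneg (Gc_nonneg _ _)]
  have b1 : ‖(u + h * v)⁻¹‖ ≤ 1 := by
    rw [Real.norm_of_nonneg (by positivity)]; exact inv_le_one_of_one_le₀ hU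
  have b2 := Gc_le S (x / (u + h * v))
  have := phi_nonneg v
  calc _ ≤ phi v * 1 * 2 := by gcongr; exact Gc_nonneg _ _
    _ = _ := by ring

lemma FF_integrand_meas {u h S : ℝ} (n : ℕ) : Measurable (fun z : ℝ × ℝ => 
    ((phi z.2 * (u + h * z.2)⁻¹ : ℝ) : ℂ) * ((Gc S (z.1 / (u + h * z.2)) : ℂ) * ec (n * (u + h * z.2) ^ 2 / z.1))) := by
  have h1 := phi_cont.measurable
  have h2 := Gc_meas (S := S)
  have h3 := ec_cont.measurable
  fun_prop

lemma FF_integrand_meas1 {u h S : ℝ} (n : ℕ) (x : ℝ) : Measurable (fun v : ℝ => 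
    ((phi v * (u + h * v)⁻¹ : ℝ) : ℂ) * ((Gc S (x / (u + h * v)) : ℂ) * ec (n * (u + h * v) ^ 2 / x))) := by
  have h1 := phi_cont.measurable
  have h2 := Gc_meas (S := S)
  have h3 := ec_cont.measurable
  fun_prop

lemma FF_cont {u h S : ℝ} (n : ℕ) (hu : 2 ≤ u) (h0 : 0 < h) (h1 : h ≤ 1) : Continuous (FF u h S n) := by
  unfold FF
  apply intervalIntegral.continuous_of_dominated_interval (bound := fun v => phi v * 2)
  · intro x
    apply Measurable.aestronglyMeasurable
    exact FF_integrand_meas1 n x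
  · intro x
    refine Filter.Eventually.of_forall fun v hv => ?_
    rw [Set.uIoc_of_le (by norm_num)] at hv
    exact FF_integrand_bound n hu h0 h1 ⟨hv.1.le, hv.2⟩
  · exact (phi_cont.mul continuous_const).intervalIntegrable _ _
  · refine Filter.Eventually.of_forall fun v hv => ?_
    rw [Set.uIoc_of_le (by norm_num)] at hv
    have hU := (shift_pos hu h0 h1 ⟨hv.1.le, hv.2⟩).2.1
    exact continuous_const.mul (Gc_ec_cont (by linarith))

lemma FF_nonpos {u h S x : ℝ} (n : ℕ) (hu : 2 ≤ u) (h0 : 0 < h) (h1 : h ≤ 1) (hx : x ≤ 0) : FF u h S n x = 0 := by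
  unfold FF
  rw [show (0:ℂ) = ∫ v in (-1:ℝ)..1, (0:ℂ) by simp]
  apply intervalIntegral.integral_congr
  intro v hv
  rw [Set.uIcc_of_le (by norm_num)] at hv
  have hU := (shift_pos hu h0 h1 hv).2.1
  simp only
  rw [Gc_small]
  · simp
  · exact (div_nonpos_of_nonpos_of_nonneg hx (by linarith)).trans (Real.exp_pos _).le

lemma FF_large {u h S x : ℝ} (n : ℕ) (hu : 2 ≤ u) (h0 : 0 < h) (h1 : h ≤ 1) (hx : 3 * (u + 1) ≤ x) : FF u h S n x = 0 := by
  unfold FF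
  rw [show (0:ℂ) = ∫ v in (-1:ℝ)..1, (0:ℂ) by simp]
  apply intervalIntegral.integral_congr
  intro v hv
  rw [Set.uIcc_of_le (by norm_num)] at hv
  have hU := (shift_pos hu h0 h1 hv).2
  simp only
  rw [Gc_large]
  · simp
  · rw [le_div_iff₀ (by linarith)]
    have := Real.exp_one_lt_d9
    have : Real.exp 1 ≤ 3 := by linarith
    have : 0 < Real.exp 1 := Real.exp_pos _
    nlinarith

lemma FF_inner {U S m : ℝ} (n : ℕ) (hU : 0 < U) (hS : 0 ≤ S) :
    ∫ x : ℝ, ((U⁻¹ : ℝ) : ℂ) * ((Gc S (x / U) : ℂ) * ec (n * U ^ 2 / x)) * ec (-(m * x)) =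
    ∫ s in (-S)..1, ((gc S s * Real.exp s : ℝ) : ℂ) * ec (U * (n * Real.exp (-s) - m * Real.exp s)) := by
  have e1 : ∫ x : ℝ, ((U⁻¹ : ℝ) : ℂ) * ((Gc S (x / U) : ℂ) * ec (n * U ^ 2 / x)) * ec (-(m * x)) =
      ∫ y : ℝ, (Gc S y : ℂ) * ec (n * U / y) * ec (-(m * (U * y))) := by
    have := Measure.integral_comp_div (fun y : ℝ => (Gc S y : ℂ) * ec (n * U / y) * ec (-(m * (U * y)))) U
    rw [abs_of_pos hU] at this
    have h2 := congrArg (fun z => ((U⁻¹ : ℝ) : ℂ) * z) this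
    simp only [Complex.real_smul] at h2
    rw [← mul_assoc, ← Complex.ofReal_mul, inv_mul_cancel₀ hU.ne', Complex.ofReal_one, one_mul] at h2
    rw [← h2, ← integral_const_mul]
    congr 1
    funext x
    rw [show (n:ℝ) * U / (x / U) = n * U ^ 2 / x by
      rcases eq_or_ne x 0 with h | h
      · simp [h]
      · field_simp, show U * (x / U) = x by field_simp]
    ring
  rw [e1]
  have hle : Real.exp (-S) ≤ Real.exp 1 := Real.exp_le_exp.2 (by linarith)
  have e2 : ∫ y : ℝ, (Gc S y : ℂ) * ec (n * U / y) * ec (-(m * (U * y))) =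
      ∫ y in (Real.exp (-S))..(Real.exp 1), (Gc S y : ℂ) * ec (n * U / y) * ec (-(m * (U * y))) := by
    rw [intervalIntegral.integral_eq_integral_of_support_subset]
    intro y hy
    constructor
    · by_contra hc
      exact hy (by simp only [Gc_small (not_lt.1 hc)]; simp)
    · by_contra hc
      exact hy (by simp only [Gc_large (not_le.1 hc).le]; simp)
  rw [e2]
  have hc : Continuous (fun y : ℝ => (Gc S y : ℂ) * ec (n * U / y) * ec (-(m * (U * y)))) := by
    have := Gc_ec_cont (S := S) (U := 1) (c := n * U) one_pos
    simp only [div_one] at this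
    exact this.mul (ec_cont.comp (by fun_prop))
  have := intervalIntegral.integral_deriv_smul_comp (a := -S) (b := 1) (f := Real.exp) (f' := Real.exp)
    (g := fun y : ℝ => (Gc S y : ℂ) * ec (n * U / y) * ec (-(m * (U * y))))
    (fun x _ => Real.hasDerivAt_exp x) Real.continuous_exp.continuousOn hc
  rw [← this]
  apply intervalIntegral.integral_congr
  intro s _
  simp only [Function.comp, Complex.real_smul]
  rw [Gc, if_pos (Real.exp_pos s), Real.log_exp, mul_assoc, ← ec_add]
  rw [show (n:ℝ) * U / Real.exp s + -(m * (U * Real.exp s)) = U * (n * Real.exp (-s) - m * Real.exp s) by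
    rw [Real.exp_neg]; field_simp; ring]
  push_cast
  ring

open FourierTransform in
lemma FF_fourier {u h S : ℝ} (n : ℕ) (hu : 2 ≤ u) (h0 : 0 < h) (h1 : h ≤ 1) (hS : 0 ≤ S) (m : ℝ) :
    𝓕 (FF u h S n) m = JJ u h S n m := by
  rw [Real.fourier_real_eq_integral_exp_smul]
  set k : ℝ → ℝ → ℂ := fun x v => ((phi v * (u + h * v)⁻¹ : ℝ) : ℂ) * ((Gc S (x / (u + h * v)) : ℂ) * ec (n * (u + h * v) ^ 2 / x)) * ec (-(m * x)) with hk
  have a1 : ∀ x : ℝ, Complex.exp (((-2 * Real.pi * x * m : ℝ) : ℂ) * Complex.I) • FF u h S n x =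
      ∫ v in Set.Ioc (-1:ℝ) 1, k x v := by
    intro x
    rw [FF, ← intervalIntegral.integral_smul, intervalIntegral.integral_of_le (by norm_num)]
    congr 1
    funext v
    simp only [hk, smul_eq_mul]
    rw [mul_comm]
    congr 1
    unfold ec; congr 1; push_cast; ring
  simp_rw [a1]
  have hIntg : Integrable (Function.uncurry k) (volume.prod (volume.restrict (Set.Ioc (-1:ℝ) 1))) := by
    have hb : Integrable (fun z : ℝ × ℝ => (Set.indicator (Set.Icc 0 (3 * (u + 1))) (fun _ => (2:ℝ)) z.1) * phi z.2)
        (volume.prod (volume.restrict (Set.Ioc (-1:ℝ) 1))) := by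
      apply Integrable.mul_prod (f := Set.indicator (Set.Icc 0 (3 * (u + 1))) (fun _ => (2:ℝ)))
      · rw [integrable_indicator_iff measurableSet_Icc]
        exact integrableOn_const measure_Icc_lt_top.ne
      · exact (phi_cont.intervalIntegrable (-1) 1).1
    refine hb.mono' ?_ ?_
    · apply Measurable.aestronglyMeasurable
      have := FF_integrand_meas (u := u) (h := h) (S := S) n
      have h3 := ec_cont.measurable
      exact this.mul (h3.comp (by fun_prop))
    · have hr : (volume : Measure ℝ).prod (volume.restrict (Set.Ioc (-1:ℝ) 1)) = ((volume : Measure ℝ).prod (volume : Measure ℝ)).restrict ((Set.univ : Set ℝ) ×ˢ Set.Ioc (-1:ℝ) 1) := by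
        rw [← Measure.prod_restrict, Measure.restrict_univ]
      rw [hr]
      refine (ae_restrict_iff' ((MeasurableSet.univ (α := ℝ)).prod (measurableSet_Ioc (a := (-1:ℝ)) (b := 1)))).2 (Filter.Eventually.of_forall fun z hz => ?_)
      obtain ⟨x, v⟩ := z
      have hv : v ∈ Set.Ioc (-1:ℝ) 1 := hz.2
      have hv' : v ∈ Set.Icc (-1:ℝ) 1 := ⟨hv.1.le, hv.2⟩
      have hU := (shift_pos hu h0 h1 hv').2
      simp only [Function.uncurry, hk]
      rw [norm_mul, ec_norm, mul_one]
      by_cases hx : x ∈ Set.Icc 0 (3 * (u + 1))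
      · rw [Set.indicator_of_mem hx, mul_comm 2]
        exact FF_integrand_bound n hu h0 h1 hv'
      · rw [Set.indicator_of_notMem hx]
        have : Gc S (x / (u + h * v)) = 0 := by
          rcases lt_or_ge x 0 with hx0 | hx0
          · exact Gc_small ((div_nonpos_of_nonpos_of_nonneg hx0.le (by linarith)).trans (Real.exp_pos _).le)
          · have hx2 : 3 * (u + 1) < x := by
              by_contra hc; exact hx ⟨hx0, not_lt.1 hc⟩
            apply Gc_large
            rw [le_div_iff₀ (by linarith)]
            have := Real.exp_one_lt_d9
            have : Real.exp 1 ≤ 3 := by linarith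
            have : 0 < Real.exp 1 := Real.exp_pos _
            nlinarith
        rw [this]; simp
  rw [integral_integral_swap hIntg, JJ, intervalIntegral.integral_of_le (by norm_num)]
  apply setIntegral_congr_fun measurableSet_Ioc
  intro v hv
  have hU := (shift_pos hu h0 h1 ⟨hv.1.le, hv.2⟩).2.1
  simp only
  rw [← FF_inner n (by linarith) hS, ← integral_const_mul]
  congr 1
  funext x
  simp only [hk]
  push_cast
  ring

lemma FF_poisson {u h S : ℝ} (n : ℕ) (hu : 2 ≤ u) (h0 : 0 < h) (h1 : h ≤ 1) (hS : 0 ≤ S) {N : ℕ}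
    (hN : 3 * (u + 1) ≤ N) (hs : Summable (fun m : ℤ => JJ u h S n m)) :
    ∑ a ∈ Finset.Icc 1 N, FF u h S n a = ∑' m : ℤ, JJ u h S n m := by
  have hp := Real.tsum_eq_tsum_fourier_of_rpow_decay_of_summable (f := FF u h S n) (b := 2) (FF_cont n hu h0 h1)
    (by norm_num) (by
      have hz : FF u h S n =ᶠ[Filter.cocompact ℝ] fun _ => (0:ℂ) := by
        filter_upwards [(isCompact_Icc (a := (0:ℝ)) (b := 3 * (u + 1))).compl_mem_cocompact] with x hx
        rcases lt_or_ge x 0 with hx0 | hx0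
        · exact FF_nonpos n hu h0 h1 hx0.le
        · refine FF_large n hu h0 h1 ?_
          by_contra hc; exact hx ⟨hx0, (not_le.1 hc).le⟩
      exact hz.trans_isBigO (Asymptotics.isBigO_zero _ _)) (by
      simp_rw [FF_fourier n hu h0 h1 hS]; exact hs) 0
  simp only [zero_add, FF_fourier n hu h0 h1 hS, QuotientAddGroup.mk_zero, fourier_eval_zero, mul_one] at hp
  rw [← hp]
  rw [tsum_eq_sum (s := (Finset.Icc 1 N).image (fun a : ℕ => (a : ℤ)))]
  · rw [Finset.sum_image (by intro a _ b _ h; simpa using h)]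
    simp
  · intro b hb
    rcases le_or_gt b 0 with hb0 | hb0
    · exact FF_nonpos n hu h0 h1 (by exact_mod_cast hb0)
    · apply FF_large n hu h0 h1
      obtain ⟨a, rfl⟩ := Int.eq_ofNat_of_zero_le hb0.le
      have : N < a := by
        by_contra hc
        apply hb
        rw [Finset.mem_image]
        refine ⟨a, Finset.mem_Icc.2 ⟨by exact_mod_cast hb0, not_lt.1 hc⟩, rfl⟩
      have : (N:ℝ) < a := by exact_mod_cast this
      push_cast; linarith

lemma FF_im {u h S : ℝ} (n : ℕ) (hu : 2 ≤ u) (h0 : 0 < h) (h1 : h ≤ 1) {a : ℝ} (ha : 0 < a) :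
    (FF u h S n a).im = ∫ v in (-1:ℝ)..1,
      phi v * ((u + h * v)⁻¹ * gc S (Real.log (a / (u + h * v)))) * Real.sin (2 * Real.pi * (n * (u + h * v) ^ 2 / a)) := by
  have hi : IntervalIntegrable (fun v => ((phi v * (u + h * v)⁻¹ : ℝ) : ℂ) * ((Gc S (a / (u + h * v)) : ℂ) * ec (n * (u + h * v) ^ 2 / a))) volume (-1) 1 := by
    rw [intervalIntegrable_iff, Set.uIoc_of_le (by norm_num)]
    refine Integrable.mono' (g := fun v => phi v * 2) ?_ ?_ ?_
    · exact ((phi_cont.mul continuous_const).intervalIntegrable (-1) 1).1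
    · apply Measurable.aestronglyMeasurable
      exact FF_integrand_meas1 n a
    · refine (ae_restrict_iff' measurableSet_Ioc).2 (Filter.Eventually.of_forall fun v hv => ?_)
      exact FF_integrand_bound n hu h0 h1 ⟨hv.1.le, hv.2⟩
  have := Complex.imCLM.intervalIntegral_comp_comm hi
  unfold FF
  rw [← Complex.imCLM_apply, ← this]
  apply intervalIntegral.integral_congr
  intro v hv
  rw [Set.uIcc_of_le (by norm_num)] at hv
  have hU := (shift_pos hu h0 h1 hv).2.1
  have hU0 : 0 < u + h * v := by linarith
  simp only [Complex.imCLM_apply]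
  rw [← mul_assoc, ← Complex.ofReal_mul, Complex.im_ofReal_mul, ec_im, Gc, if_pos (div_pos ha hU0)]
  ring

lemma delta_series2 (ε : ℝ) (hε : 0 < ε) : ∃ C : ℝ, 0 < C ∧ ∀ u h S : ℝ, 2 ≤ u → 0 < h → h ≤ 1 → 0 ≤ S →
    (∀ n : ℕ, 1 ≤ n → Summable (fun m : ℤ => JJ u h S n m)) →
    ∃ W : ℝ, |DirichletDelta (u ^ 2) / u - W| ≤ C * u ^ ε * (1 / u + h + Real.exp (-S)) ∧
    HasSum (fun n : ℕ => 1 / (Real.pi * n) * (∑' m : ℤ, JJ u h S n m).im) W := by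
  obtain ⟨C, hC, hp⟩ := delta_series ε hε
  refine ⟨C, hC, fun u h S hu h0 h1 hS hs => ?_⟩
  obtain ⟨W, hW1, hW2⟩ := hp u h S hu h0 h1 ⌈3 * (u + 1)⌉₊ (Nat.le_ceil _)
  refine ⟨W, hW1, ?_⟩
  convert! hW2 using 1
  funext n
  rcases Nat.eq_zero_or_pos n with hn | hn
  · subst hn; simp
  congr 1
  rw [← FF_poisson n hu h0 h1 hS (Nat.le_ceil _) (hs n hn), Complex.im_sum]
  apply Finset.sum_congr rfl
  intro a ha
  apply FF_im n hu h0 h1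
  exact_mod_cast (Finset.mem_Icc.1 ha).1

lemma bdd_of_const {f : ℝ → ℝ} (hf : ContDiff ℝ 2 f) {a b c d : ℝ} (ha : ∀ t, t < a → f t = c)
    (hb : ∀ t, b < t → f t = d) : ∃ C : ℝ, 0 < C ∧ ∀ t, |deriv f t| ≤ C ∧ |deriv (deriv f) t| ≤ C := by
  have hd1 : Continuous (deriv f) := hf.continuous_deriv (by norm_num)
  have hd2 : Continuous (deriv (deriv f)) := by
    have : ContDiff ℝ 1 (deriv f) := by
      have := (contDiff_succ_iff_deriv (n := 1) (f := f)).1 (by rw [one_add_one_eq_two]; exact hf)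
      exact this.2.2
    exact this.continuous_deriv le_rfl
  have z1 : ∀ t, t < a → deriv f t = 0 := by
    intro t ht
    have : f =ᶠ[nhds t] fun _ => c := by
      filter_upwards [Iio_mem_nhds ht] with y hy using ha y hy
    rw [this.deriv_eq]; simp
  have z2 : ∀ t, b < t → deriv f t = 0 := by
    intro t ht
    have : f =ᶠ[nhds t] fun _ => d := by
      filter_upwards [Ioi_mem_nhds ht] with y hy using hb y hy
    rw [this.deriv_eq]; simp
  have y1 : ∀ t, t < a → deriv (deriv f) t = 0 := by
    intro t ht
    have : deriv f =ᶠ[nhds t] fun _ => 0 := by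
      filter_upwards [Iio_mem_nhds ht] with y hy using z1 y hy
    rw [this.deriv_eq]; simp
  have y2 : ∀ t, b < t → deriv (deriv f) t = 0 := by
    intro t ht
    have : deriv f =ᶠ[nhds t] fun _ => 0 := by
      filter_upwards [Ioi_mem_nhds ht] with y hy using z2 y hy
    rw [this.deriv_eq]; simp
  obtain ⟨M1, h1⟩ := (isCompact_Icc (a := a) (b := b)).exists_bound_of_continuousOn hd1.continuousOn
  obtain ⟨M2, h2⟩ := (isCompact_Icc (a := a) (b := b)).exists_bound_of_continuousOn hd2.continuousOn
  refine ⟨|M1| + |M2| + 1, by positivity, fun t => ?_⟩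
  have a1 := abs_nonneg M1
  have a2 := abs_nonneg M2
  rcases lt_or_ge t a with h | h
  · rw [z1 t h, y1 t h]; simp; positivity
  rcases lt_or_ge b t with h' | h'
  · rw [z2 t h', y2 t h']; simp; positivity
  · have := h1 t ⟨h, h'⟩; have := h2 t ⟨h, h'⟩
    have := le_abs_self M1; have := le_abs_self M2
    rw [Real.norm_eq_abs] at *
    constructor <;> linarith

lemma deriv_deriv_of_contDiff {f : ℝ → ℝ} (hf : ContDiff ℝ 2 f) (t : ℝ) :
    HasDerivAt f (deriv f t) t ∧ HasDerivAt (deriv f) (deriv (deriv f) t) t ∧ Continuous (deriv f) ∧ Continuous (deriv (deriv f)) := by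
  have h1 : ContDiff ℝ 1 (deriv f) := ((contDiff_succ_iff_deriv (n := 1) (f := f)).1 (by rw [one_add_one_eq_two]; exact hf)).2.2
  exact ⟨(hf.differentiable (by norm_num) t).hasDerivAt, (h1.differentiable (by norm_num) t).hasDerivAt,
    h1.continuous, h1.continuous_deriv le_rfl⟩

lemma gc_derivs : ∃ C : ℝ, 0 < C ∧ ∀ S s : ℝ, |deriv (gc S) s| ≤ C ∧ |deriv (deriv (gc S)) s| ≤ C := by
  obtain ⟨C1, hC1, h1⟩ := bdd_of_const (gz_contDiff (n := 2)) (a := -1) (b := 1) (c := 2) (d := 0)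
    (fun t ht => gz_left ht.le) (fun t ht => gz_right ht.le)
  obtain ⟨C2, hC2, h2⟩ := bdd_of_const (Real.smoothTransition.contDiff (n := 2)) (a := 0) (b := 1) (c := 0) (d := 1)
    (fun t ht => Real.smoothTransition.zero_of_nonpos ht.le) (fun t ht => Real.smoothTransition.one_of_one_le ht.le)
  refine ⟨C1 + 2 * C2 + 2 * C1 * C2, by positivity, fun S s => ?_⟩
  have d1 : ∀ s, HasDerivAt (gc S) (deriv gz s * Real.smoothTransition (s + S) + gz s * deriv Real.smoothTransition (s + S)) s := by
    intro s
    have a := (deriv_deriv_of_contDiff (gz_contDiff (n := 2)) s).1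
    have b := ((deriv_deriv_of_contDiff (Real.smoothTransition.contDiff (n := 2)) (s + S)).1).comp_add_const s S
    exact a.mul b
  have d2 : HasDerivAt (deriv (gc S)) (deriv (deriv gz) s * Real.smoothTransition (s + S) + deriv gz s * deriv Real.smoothTransition (s + S)
    + (deriv gz s * deriv Real.smoothTransition (s + S) + gz s * deriv (deriv Real.smoothTransition) (s + S))) s := by
    have e : deriv (gc S) = fun s => deriv gz s * Real.smoothTransition (s + S) + gz s * deriv Real.smoothTransition (s + S) :=
      funext fun s => (d1 s).deriv
    rw [e]
    have a := (deriv_deriv_of_contDiff (gz_contDiff (n := 2)) s)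
    have b := (deriv_deriv_of_contDiff (Real.smoothTransition.contDiff (n := 2)) (s + S))
    exact (a.2.1.mul (b.1.comp_add_const s S)).add (a.1.mul (b.2.1.comp_add_const s S))
  have n1 : |Real.smoothTransition (s + S)| ≤ 1 := by
    rw [abs_of_nonneg (Real.smoothTransition.nonneg _)]; exact Real.smoothTransition.le_one _
  have n2 : |gz s| ≤ 2 := by rw [abs_of_nonneg (gz_nonneg s)]; exact gz_le s
  have m1 := h1 s
  have m2 := h2 (s + S)
  have f1 : |deriv gz s * Real.smoothTransition (s + S)| ≤ C1 * 1 := by rw [abs_mul]; exact mul_le_mul m1.1 n1 (abs_nonneg _) hC1.le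
  have f2 : |gz s * deriv Real.smoothTransition (s + S)| ≤ 2 * C2 := by rw [abs_mul]; exact mul_le_mul n2 m2.1 (abs_nonneg _) (by norm_num)
  have f3 : |deriv (deriv gz) s * Real.smoothTransition (s + S)| ≤ C1 * 1 := by rw [abs_mul]; exact mul_le_mul m1.2 n1 (abs_nonneg _) hC1.le
  have f4 : |deriv gz s * deriv Real.smoothTransition (s + S)| ≤ C1 * C2 := by rw [abs_mul]; exact mul_le_mul m1.1 m2.1 (abs_nonneg _) hC1.le
  have f5 : |gz s * deriv (deriv Real.smoothTransition) (s + S)| ≤ 2 * C2 := by rw [abs_mul]; exact mul_le_mul n2 m2.2 (abs_nonneg _) (by norm_num)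
  have pp : 0 ≤ C1 * C2 := by positivity
  constructor
  · rw [(d1 s).deriv]
    exact (abs_add_le _ _).trans (by linarith)
  · rw [d2.deriv]
    exact ((abs_add_le _ _).trans (add_le_add (abs_add_le _ _) (abs_add_le _ _))).trans (by linarith)

lemma gc_deriv_end {S s : ℝ} (h : gc S s = 0) : deriv (gc S) s = 0 := by
  apply IsLocalMin.deriv_eq_zero
  exact Filter.Eventually.of_forall fun y => by rw [h]; exact gc_nonneg S y

/-- one integration by parts against `ec (U κ)` -/
lemma ibp_step {a b U : ℝ} (hU : U ≠ 0) {P P' D κ : ℝ → ℝ} (hP : ∀ s, HasDerivAt P (P' s) s) (hP' : Continuous P')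
    (hκ : ∀ s, HasDerivAt κ (- D s) s) (hD : Continuous D) (ha : P a = 0) (hb : P b = 0) :
    ∫ s in a..b, ((P s * D s : ℝ) : ℂ) * ec (U * κ s) =
      (2 * Real.pi * Complex.I * U)⁻¹ * ∫ s in a..b, ((P' s : ℝ) : ℂ) * ec (U * κ s) := by
  have hκc : Continuous κ := continuous_iff_continuousAt.2 fun s => (hκ s).continuousAt
  have := intervalIntegral.integral_mul_deriv_eq_deriv_mul (a := a) (b := b) (u := fun s => (P s : ℂ)) (u' := fun s => (P' s : ℂ))
    (v := fun s => ec (U * κ s)) (v' := fun s => 2 * Real.pi * Complex.I * ((U * (- D s) : ℝ) : ℂ) * ec (U * κ s))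
    (fun s _ => (hP s).ofReal_comp) (fun s _ => ec_deriv ((hκ s).const_mul U))
    ((Complex.continuous_ofReal.comp hP').intervalIntegrable _ _)
    (by
      apply Continuous.intervalIntegrable
      have := ec_cont
      fun_prop)
  simp only [ha, hb, Complex.ofReal_zero, zero_mul, sub_zero, zero_sub] at this
  have e : ∫ s in a..b, (P s : ℂ) * (2 * Real.pi * Complex.I * ((U * (- D s) : ℝ) : ℂ) * ec (U * κ s)) =
     -(2 * Real.pi * Complex.I * U) * ∫ s in a..b, ((P s * D s : ℝ) : ℂ) * ec (U * κ s) := by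
    rw [← intervalIntegral.integral_const_mul]
    apply intervalIntegral.integral_congr
    intro s _
    simp only
    push_cast
    ring
  rw [e] at this
  have hne : (2 * Real.pi * Complex.I * U : ℂ) ≠ 0 := by
    have : (U:ℂ) ≠ 0 := by exact_mod_cast hU
    have := Real.pi_ne_zero
    have : (Real.pi:ℂ) ≠ 0 := by exact_mod_cast this
    simp_all
  rw [neg_mul, neg_inj] at this
  rw [← this, ← mul_assoc, inv_mul_cancel₀ hne, one_mul]

lemma nonstat : ∃ C : ℝ, 0 < C ∧ ∀ S U n m K : ℝ, 0 ≤ S → 1 ≤ U → 0 < n → 0 ≤ m →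
    (∀ s ∈ Set.Icc (-S) 1, Real.exp s / (n * Real.exp (-s) + m * Real.exp s) ^ 2 ≤ K) →
    ‖∫ s in (-S)..1, ((gc S s * Real.exp s : ℝ) : ℂ) * ec (U * (n * Real.exp (-s) - m * Real.exp s))‖ ≤ C * K * (S + 1) / U ^ 2 := by
  obtain ⟨C1, hC1, hd⟩ := gc_derivs
  refine ⟨16 + 6 * C1, by positivity, fun S U n m K hS hU hn hm hK => ?_⟩
  set κ : ℝ → ℝ := fun s => n * Real.exp (-s) - m * Real.exp s with hκ
  set D : ℝ → ℝ := fun s => n * Real.exp (-s) + m * Real.exp s with hD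
  have hDpos : ∀ s, 0 < D s := fun s => by
    have := Real.exp_pos s; have := Real.exp_pos (-s)
    simp only [hD]; positivity
  have hκD : ∀ s, |κ s| ≤ D s := fun s => by
    have := Real.exp_pos s; have := Real.exp_pos (-s)
    have : 0 ≤ n * Real.exp (-s) := by positivity
    have : 0 ≤ m * Real.exp s := by positivity
    simp only [hD, hκ]; rw [abs_le]; constructor <;> linarith
  have hen : ∀ s, HasDerivAt (fun s : ℝ => Real.exp (-s)) (- Real.exp (-s)) s := fun s => by
    have := (hasDerivAt_neg s).exp
    convert! this using 1; ring
  have dκ : ∀ s, HasDerivAt κ (- D s) s := fun s => by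
    have := ((hen s).const_mul n).sub ((Real.hasDerivAt_exp s).const_mul m)
    convert! this using 1; simp only [hD]; ring
  have dD : ∀ s, HasDerivAt D (- κ s) s := fun s => by
    have := ((hen s).const_mul n).add ((Real.hasDerivAt_exp s).const_mul m)
    convert! this using 1; simp only [hκ]; ring
  have hg := deriv_deriv_of_contDiff (gc_contDiff (S := S) (n := 2))
  set g1 := deriv (gc S) with hg1
  set g2 := deriv g1 with hg2
  set ψ : ℝ → ℝ := fun s => gc S s * Real.exp s with hψ
  set ψ1 : ℝ → ℝ := fun s => g1 s * Real.exp s + gc S s * Real.exp s with hψ1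
  set ψ2 : ℝ → ℝ := fun s => (g2 s * Real.exp s + g1 s * Real.exp s) + (g1 s * Real.exp s + gc S s * Real.exp s) with hψ2
  have dψ : ∀ s, HasDerivAt ψ (ψ1 s) s := fun s => (hg s).1.mul (Real.hasDerivAt_exp s)
  have dψ1 : ∀ s, HasDerivAt ψ1 (ψ2 s) s := fun s =>
    ((hg s).2.1.mul (Real.hasDerivAt_exp s)).add ((hg s).1.mul (Real.hasDerivAt_exp s))
  have hg1c : Continuous g1 := (hg 0).2.2.1
  have hg2c : Continuous g2 := (hg 0).2.2.2
  have hgcc : Continuous (gc S) := gc_cont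
  have hκc : Continuous κ := by simp only [hκ]; fun_prop
  have hDc : Continuous D := by simp only [hD]; fun_prop
  have cψ : Continuous ψ := by simp only [hψ]; fun_prop
  have cψ1 : Continuous ψ1 := by simp only [hψ1]; fun_prop
  have cψ2 : Continuous ψ2 := by simp only [hψ2]; fun_prop
  have dP : ∀ s, HasDerivAt (fun s => ψ s / D s) ((ψ1 s * D s + ψ s * κ s) / D s ^ 2) s := fun s => by
    have := (dψ s).div (dD s) (hDpos s).ne'
    convert! this using 1
    ring
  have dQ : ∀ s, HasDerivAt (fun s => (ψ1 s * D s + ψ s * κ s) / D s ^ 3)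
      ((ψ2 s - ψ s) / D s ^ 2 + 3 * κ s * (ψ1 s * D s + ψ s * κ s) / D s ^ 4) s := fun s => by
    have := (((dψ1 s).mul (dD s)).add ((dψ s).mul (dκ s))).div ((dD s).pow 3) (pow_pos (hDpos s) 3).ne'
    convert! this using 1
    have := (hDpos s).ne'
    simp only [Pi.add_apply, Pi.mul_apply, Pi.pow_apply]
    field_simp
    ring
  have hl : gc S (-S) = 0 := gc_left le_rfl
  have hr : gc S 1 = 0 := gc_right le_rfl
  have hl1 : g1 (-S) = 0 := gc_deriv_end hl
  have hr1 : g1 1 = 0 := gc_deriv_end hr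
  have c1 : Continuous (fun s => (ψ1 s * D s + ψ s * κ s) / D s ^ 2) :=
    ((cψ1.mul hDc).add (cψ.mul hκc)).div (hDc.pow 2) fun s => (pow_pos (hDpos s) 2).ne'
  have c2 : Continuous (fun s => (ψ2 s - ψ s) / D s ^ 2 + 3 * κ s * (ψ1 s * D s + ψ s * κ s) / D s ^ 4) :=
    ((cψ2.sub cψ).div (hDc.pow 2) fun s => (pow_pos (hDpos s) 2).ne').add
     (((continuous_const.mul hκc).mul ((cψ1.mul hDc).add (cψ.mul hκc))).div (hDc.pow 4) fun s => (pow_pos (hDpos s) 4).ne')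
  have hU0 : U ≠ 0 := by linarith
  have s1 := ibp_step (a := -S) (b := 1) hU0 dP c1 dκ hDc (by simp [hψ, hl]) (by simp [hψ, hr])
  have s2 := ibp_step (a := -S) (b := 1) hU0 dQ c2 dκ hDc (by simp [hψ, hψ1, hl, hl1]) (by simp [hψ, hψ1, hr, hr1])
  have e1 : ∀ s, ψ s / D s * D s = ψ s := fun s => by have := (hDpos s).ne'; field_simp
  have e2 : ∀ s, (ψ1 s * D s + ψ s * κ s) / D s ^ 3 * D s = (ψ1 s * D s + ψ s * κ s) / D s ^ 2 := fun s => by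
    have := (hDpos s).ne'; field_simp
  simp only [e1] at s1
  simp only [e2] at s2
  rw [s1, s2, ← mul_assoc, norm_mul]
  have hb : ‖∫ s in (-S)..1, (((ψ2 s - ψ s) / D s ^ 2 + 3 * κ s * (ψ1 s * D s + ψ s * κ s) / D s ^ 4 : ℝ) : ℂ) * ec (U * κ s)‖ ≤
      ((16 + 6 * C1) * K) * |1 - (-S)| := by
    apply intervalIntegral.norm_integral_le_of_norm_le_const
    intro s hs
    rw [Set.uIoc_of_le (by linarith)] at hs
    rw [norm_mul, ec_norm, mul_one, Complex.norm_real, Real.norm_eq_abs]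
    have hk := hK s ⟨hs.1.le, hs.2⟩
    have hDp := hDpos s
    have hkd := hκD s
    have he := Real.exp_pos s
    have q0 : |gc S s| ≤ 2 := by rw [abs_of_nonneg (gc_nonneg _ _)]; exact gc_le _ _
    have q1 : |g1 s| ≤ C1 := (hd S s).1
    have q2 : |g2 s| ≤ C1 := (hd S s).2
    have p0 : |ψ s| ≤ 2 * Real.exp s := by
      simp only [hψ]; rw [abs_mul, abs_of_pos he]; gcongr
    have p1 : |ψ1 s| ≤ (2 + C1) * Real.exp s := by
      simp only [hψ1]; rw [← add_mul, abs_mul, abs_of_pos he]; gcongr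
      exact (abs_add_le _ _).trans (by linarith)
    have p2 : |ψ2 s| ≤ (2 + 3 * C1) * Real.exp s := by
      simp only [hψ2]; rw [← add_mul, ← add_mul, ← add_mul, abs_mul, abs_of_pos he]; gcongr
      exact (abs_add_le _ _).trans (by linarith [abs_add_le (g2 s) (g1 s), abs_add_le (g1 s) (gc S s)])
    have r1 : |(ψ2 s - ψ s) / D s ^ 2| ≤ (4 + 3 * C1) * (Real.exp s / D s ^ 2) := by
      rw [abs_div, abs_of_pos (pow_pos hDp 2), ← mul_div_assoc]
      gcongr
      exact (abs_sub _ _).trans (by linarith)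
    have r2 : |3 * κ s * (ψ1 s * D s + ψ s * κ s) / D s ^ 4| ≤ (12 + 3 * C1) * (Real.exp s / D s ^ 2) := by
      rw [abs_div, abs_of_pos (pow_pos hDp 4), abs_mul, abs_mul, abs_of_pos (show (0:ℝ) < 3 by norm_num)]
      have : |ψ1 s * D s + ψ s * κ s| ≤ (4 + C1) * Real.exp s * D s := by
        calc _ ≤ |ψ1 s * D s| + |ψ s * κ s| := abs_add_le _ _
          _ ≤ (2 + C1) * Real.exp s * D s + 2 * Real.exp s * D s := by
            rw [abs_mul, abs_mul, abs_of_pos hDp]; gcongr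
          _ = _ := by ring
      calc _ ≤ 3 * D s * ((4 + C1) * Real.exp s * D s) / D s ^ 4 := by gcongr
        _ = _ := by field_simp; ring
    refine (abs_add_le _ _).trans ?_
    calc _ ≤ (16 + 6 * C1) * (Real.exp s / D s ^ 2) := by linarith
      _ ≤ _ := by gcongr
  have hc : ‖(2 * Real.pi * Complex.I * U : ℂ)⁻¹ * (2 * Real.pi * Complex.I * U : ℂ)⁻¹‖ ≤ 1 / U ^ 2 := by
    rw [norm_mul, norm_inv]
    have : ‖(2 * Real.pi * Complex.I * U : ℂ)‖ = 2 * Real.pi * U := by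
      simp [abs_of_pos Real.pi_pos, abs_of_pos (show 0 < U by linarith)]
    rw [this, ← mul_inv, one_div]
    apply inv_anti₀ (by positivity)
    have : 1 ≤ 2 * Real.pi := by linarith [Real.pi_gt_three]
    nlinarith [mul_le_mul this this (by norm_num) (by positivity), mul_pos (show 0 < U by linarith) (show 0 < U by linarith)]
  rw [show |1 - (-S)| = S + 1 by rw [abs_of_nonneg (by linarith)]; ring] at hb
  calc _ ≤ 1 / U ^ 2 * (((16 + 6 * C1) * K) * (S + 1)) := mul_le_mul hc hb (norm_nonneg _) (by positivity)
    _ = _ := by ring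

lemma JJ_nonstat : ∃ C : ℝ, 0 < C ∧ ∀ u h S K m : ℝ, ∀ n : ℕ, 2 ≤ u → 0 < h → h ≤ 1 → 0 ≤ S → 1 ≤ n → 0 ≤ m →
    (∀ s ∈ Set.Icc (-S) 1, Real.exp s / (n * Real.exp (-s) + m * Real.exp s) ^ 2 ≤ K) →
    ‖JJ u h S n m‖ ≤ C * K * (S + 1) / u ^ 2 := by
  obtain ⟨C, hC, hn⟩ := nonstat
  refine ⟨4 * C, by positivity, fun u h S K m n hu h0 h1 hS hn1 hm hK => ?_⟩
  have hK0 : 0 ≤ K := le_trans (by positivity) (hK 0 ⟨by linarith, by norm_num⟩)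
  have : ‖JJ u h S n m‖ ≤ ∫ v in (-1:ℝ)..1, phi v * (4 * C * K * (S + 1) / u ^ 2) := by
    unfold JJ
    apply intervalIntegral.norm_integral_le_of_norm_le (by norm_num)
    · refine Filter.Eventually.of_forall fun v hv => ?_
      rw [norm_mul, Complex.norm_real, Real.norm_of_nonneg (phi_nonneg v)]
      apply mul_le_mul_of_nonneg_left _ (phi_nonneg v)
      have hU := shift_pos hu h0 h1 ⟨hv.1.le, hv.2⟩
      refine (hn S (u + h * v) n m K hS hU.2.1 (by exact_mod_cast hn1) hm hK).trans ?_
      have : u ^ 2 / 4 ≤ (u + h * v) ^ 2 := by nlinarith [hU.1]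
      calc _ ≤ C * K * (S + 1) / (u ^ 2 / 4) := by gcongr
        _ = _ := by field_simp
    · exact (phi_cont.mul continuous_const).intervalIntegrable _ _
  rw [intervalIntegral.integral_mul_const, phi_int, one_mul] at this
  exact this

lemma JJ_pos_bound : ∃ C : ℝ, 0 < C ∧ ∀ u h S m : ℝ, ∀ n : ℕ, 2 ≤ u → 0 < h → h ≤ 1 → 0 ≤ S → 1 ≤ n → 1 ≤ m →
    ‖JJ u h S n m‖ ≤ C * (S + 1) / u ^ 2 * (1 / (m * Real.sqrt (n * m))) := by
  obtain ⟨C, hC, hb⟩ := JJ_nonstat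
  refine ⟨C, hC, fun u h S m n hu h0 h1 hS hn hm => ?_⟩
  have hn' : (1:ℝ) ≤ n := by exact_mod_cast hn
  refine (hb u h S (1 / (m * Real.sqrt (n * m))) m n hu h0 h1 hS hn (by linarith) ?_).trans (le_of_eq (by ring))
  intro s _
  have hE := Real.exp_pos s
  have hE' := Real.exp_pos (-s)
  have hEE : Real.exp (-s) * Real.exp s = 1 := by rw [← Real.exp_add]; simp
  set D := n * Real.exp (-s) + m * Real.exp s
  have hD1 : m * Real.exp s ≤ D := by
    have : 0 ≤ n * Real.exp (-s) := by positivity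
    simp only [D]; linarith
  have hD2 : Real.sqrt (n * m) ≤ D := by
    apply Real.sqrt_le_iff.2
    refine ⟨by positivity, ?_⟩
    have h4 : 4 * (n * m) ≤ D ^ 2 := by
      have : D ^ 2 = (n * Real.exp (-s) - m * Real.exp s) ^ 2 + 4 * (n * m) * (Real.exp (-s) * Real.exp s) := by
        simp only [D]; ring
      rw [this, hEE]; nlinarith [sq_nonneg (n * Real.exp (-s) - m * Real.exp s)]
    have : 0 ≤ (n:ℝ) * m := by positivity
    linarith
  have hs0 : 0 < Real.sqrt (n * m) := Real.sqrt_pos.2 (by positivity)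
  have hD0 : 0 < D := by linarith
  rw [div_le_div_iff₀ (by positivity) (by positivity), one_mul]
  calc Real.exp s * (m * Real.sqrt (n * m)) = (m * Real.exp s) * Real.sqrt (n * m) := by ring
    _ ≤ D * D := by gcongr
    _ = D ^ 2 := by ring

lemma JJ_zero_bound : ∃ C : ℝ, 0 < C ∧ ∀ u h S : ℝ, ∀ n : ℕ, 2 ≤ u → 0 < h → h ≤ 1 → 0 ≤ S → 1 ≤ n →
    ‖JJ u h S n 0‖ ≤ C * (S + 1) / u ^ 2 * (1 / (n:ℝ) ^ 2) := by
  obtain ⟨C, hC, hb⟩ := JJ_nonstat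
  refine ⟨C * Real.exp 3, by positivity, fun u h S n hu h0 h1 hS hn => ?_⟩
  have hn' : (1:ℝ) ≤ n := by exact_mod_cast hn
  refine (hb u h S (Real.exp 3 * (1 / (n:ℝ)^2)) 0 n hu h0 h1 hS hn le_rfl ?_).trans (le_of_eq (by ring))
  intro s hs
  have : Real.exp s / (n * Real.exp (-s) + 0 * Real.exp s) ^ 2 = Real.exp (3 * s) * (1 / (n:ℝ)^2) := by
    rw [Real.exp_neg, show 3 * s = s + s + s by ring, Real.exp_add, Real.exp_add]
    have := Real.exp_pos s
    field_simp
    ring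
  rw [this]
  gcongr
  linarith [hs.2]

lemma exp_min_int {t1 L : ℝ} (ht : 0 ≤ t1) (hL : 0 ≤ L) : ∫ t in (0:ℝ)..L, Real.exp (min t t1 - t) ≤ t1 + 1 := by
  have hc : Continuous (fun t => Real.exp (min t t1 - t)) := by fun_prop
  have h1 : ∀ K, 0 ≤ K → ∫ t in (0:ℝ)..K, Real.exp (min t t1 - t) ≤ K := by
    intro K hK
    calc _ ≤ ∫ t in (0:ℝ)..K, (1:ℝ) := by
          apply intervalIntegral.integral_mono_on hK (hc.intervalIntegrable _ _) (by simp)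
          intro t _
          rw [Real.exp_le_one_iff]; linarith [min_le_left t t1]
      _ = K := by simp
  rcases le_or_gt L t1 with h | h
  · linarith [h1 L hL]
  · rw [← intervalIntegral.integral_add_adjacent_intervals (hc.intervalIntegrable 0 t1) (hc.intervalIntegrable t1 L)]
    have h2 : ∫ t in t1..L, Real.exp (min t t1 - t) = ∫ t in t1..L, Real.exp (t1 - t) := by
      apply intervalIntegral.integral_congr
      intro t ht'
      rw [Set.uIcc_of_le h.le] at ht'
      simp only
      rw [min_eq_right ht'.1]
    have h3 : ∫ t in t1..L, Real.exp (t1 - t) = 1 - Real.exp (t1 - L) := by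
      rw [intervalIntegral.integral_comp_sub_left (fun x => Real.exp x)]; simp
    rw [h2, h3]
    linarith [h1 t1 ht, Real.exp_pos (t1 - L)]

lemma half_stat {q q1 q2 : ℝ → ℂ} {B t1 lam L : ℝ} (hq : ∀ t, HasDerivAt q (q1 t) t) (hq1 : ∀ t, HasDerivAt q1 (q2 t) t)
    (hq2 : Continuous q2) (q0 : q 0 = 0)
    (hB : ∀ t, 0 ≤ t → ‖q t‖ ≤ B * Real.exp (min t t1) ∧ ‖q1 t‖ ≤ B * Real.exp (min t t1) ∧ ‖q2 t‖ ≤ B * Real.exp (min t t1))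
    (ht1 : 0 ≤ t1) (hlam : 1 ≤ lam) (hL : 1 ≤ L) :
    ‖∫ t in (0:ℝ)..L, q t * ec (lam * Real.cosh t)‖ ≤ 20 * B * (t1 + 2) / lam := by
  have hqc : Continuous q := continuous_iff_continuousAt.2 fun t => (hq t).continuousAt
  have hq1c : Continuous q1 := continuous_iff_continuousAt.2 fun t => (hq1 t).continuousAt
  have hB0 : 0 ≤ B := by
    have := (hB 0 le_rfl).1
    rw [q0, norm_zero] at this
    by_contra hc
    have := mul_neg_of_neg_of_pos (not_le.1 hc) (Real.exp_pos (min 0 t1))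
    linarith
  have hec := ec_cont
  have hvc : Continuous (fun t => ec (lam * Real.cosh t)) := by
    apply ec_cont.comp; exact continuous_const.mul Real.continuous_cosh
  have he3 : Real.exp 1 ≤ 3 := by linarith [Real.exp_one_lt_d9]
  set δ := 1 / lam with hδ
  have hδ0 : 0 < δ := by positivity
  have hδ1 : δ ≤ 1 := by rw [hδ, div_le_one (by linarith)]; exact hlam
  have hsmall : ∀ t, 0 ≤ t → t ≤ 1 → B * Real.exp (min t t1) ≤ 3 * B := by
    intro t h0 h1
    have : Real.exp (min t t1) ≤ Real.exp 1 := Real.exp_le_exp.2 ((min_le_left _ _).trans h1)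
    nlinarith
  have hqv : Continuous (fun t => q t * ec (lam * Real.cosh t)) := hqc.mul hvc
  rw [← intervalIntegral.integral_add_adjacent_intervals (hqv.intervalIntegrable 0 δ) (hqv.intervalIntegrable δ L)]
  have p1 : ‖∫ t in (0:ℝ)..δ, q t * ec (lam * Real.cosh t)‖ ≤ 3 * B * δ := by
    have := intervalIntegral.norm_integral_le_of_norm_le_const (a := 0) (b := δ) (C := 3 * B) (f := fun t => q t * ec (lam * Real.cosh t)) (by
      intro t ht
      rw [Set.uIoc_of_le hδ0.le] at ht
      rw [norm_mul, ec_norm, mul_one]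
      exact (hB t ht.1.le).1.trans (hsmall t ht.1.le (ht.2.trans hδ1)))
    rwa [sub_zero, abs_of_pos hδ0] at this
  -- derivative of quotient
  set N : ℝ → ℂ := fun t => q1 t * (Real.sinh t : ℂ) - q t * (Real.cosh t : ℂ) with hN
  have dN : ∀ t, HasDerivAt N ((q2 t - q t) * (Real.sinh t : ℂ)) t := by
    intro t
    have := ((hq1 t).mul (Real.hasDerivAt_sinh t).ofReal_comp).sub ((hq t).mul (Real.hasDerivAt_cosh t).ofReal_comp)
    convert! this using 1
    ring
  have hNb : ∀ t, 0 ≤ t → ‖N t‖ ≤ 2 * B * Real.exp (min t t1) * (Real.cosh t - 1) := by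
    intro t ht
    have hf : ∫ x in (0:ℝ)..t, (q2 x - q x) * (Real.sinh x : ℂ) = N t := by
      rw [intervalIntegral.integral_eq_sub_of_hasDerivAt (fun x _ => dN x)]
      · simp [hN, q0]
      · apply Continuous.intervalIntegrable
        exact (hq2.sub hqc).mul (Complex.continuous_ofReal.comp Real.continuous_sinh)
    rw [← hf]
    have : ‖∫ x in (0:ℝ)..t, (q2 x - q x) * (Real.sinh x : ℂ)‖ ≤ ∫ x in (0:ℝ)..t, (2 * B * Real.exp (min t t1)) * Real.sinh x := by
      apply intervalIntegral.norm_integral_le_of_norm_le ht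
      · refine Filter.Eventually.of_forall fun x hx => ?_
        rw [norm_mul, Complex.norm_real, Real.norm_of_nonneg (Real.sinh_nonneg_iff.2 hx.1.le)]
        apply mul_le_mul_of_nonneg_right _ (Real.sinh_nonneg_iff.2 hx.1.le)
        have b := hB x hx.1.le
        have : Real.exp (min x t1) ≤ Real.exp (min t t1) := Real.exp_le_exp.2 (min_le_min_right _ hx.2)
        have := mul_le_mul_of_nonneg_left this hB0
        calc ‖q2 x - q x‖ ≤ ‖q2 x‖ + ‖q x‖ := norm_sub_le _ _
          _ ≤ _ := by linarith [b.1, b.2.2]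
      · exact (continuous_const.mul Real.continuous_sinh).intervalIntegrable _ _
    rw [intervalIntegral.integral_const_mul] at this
    have hs : ∫ x in (0:ℝ)..t, Real.sinh x = Real.cosh t - 1 := by
      rw [intervalIntegral.integral_eq_sub_of_hasDerivAt (fun x _ => Real.hasDerivAt_cosh x)
        (Real.continuous_sinh.intervalIntegrable _ _)]; simp
    rwa [hs] at this
  have hsp : ∀ t ∈ Set.uIcc δ L, 0 < Real.sinh t := by
    intro t ht
    rw [Set.uIcc_of_le (hδ1.trans hL)] at ht
    exact Real.sinh_pos_iff.2 (by linarith [ht.1])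
  have dG : ∀ t ∈ Set.uIcc δ L, HasDerivAt (fun t => q t / (Real.sinh t : ℂ)) (N t / (Real.sinh t : ℂ) ^ 2) t := by
    intro t ht
    have hne : (Real.sinh t : ℂ) ≠ 0 := by exact_mod_cast (hsp t ht).ne'
    exact (hq t).div (Real.hasDerivAt_sinh t).ofReal_comp hne
  have hNc : Continuous N := continuous_iff_continuousAt.2 fun t => (dN t).continuousAt
  have hG'c : ContinuousOn (fun t => N t / (Real.sinh t : ℂ) ^ 2) (Set.uIcc δ L) := by
    apply hNc.continuousOn.div
    · exact ((Complex.continuous_ofReal.comp Real.continuous_sinh).pow 2).continuousOn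
    · intro t ht
      have hne : (Real.sinh t : ℂ) ≠ 0 := by exact_mod_cast (hsp t ht).ne'
      exact pow_ne_zero 2 hne
  have ibp := intervalIntegral.integral_mul_deriv_eq_deriv_mul (a := δ) (b := L) (u := fun t => q t / (Real.sinh t : ℂ))
    (u' := fun t => N t / (Real.sinh t : ℂ) ^ 2) (v := fun t => ec (lam * Real.cosh t))
    (v' := fun t => 2 * Real.pi * Complex.I * ((lam * Real.sinh t : ℝ) : ℂ) * ec (lam * Real.cosh t))
    dG (fun t _ => ec_deriv ((Real.hasDerivAt_cosh t).const_mul lam)) hG'c.intervalIntegrable (by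
      apply Continuous.intervalIntegrable
      exact (continuous_const.mul (Complex.continuous_ofReal.comp (continuous_const.mul Real.continuous_sinh))).mul hvc)
  have e1 : ∫ t in δ..L, q t / (Real.sinh t : ℂ) * (2 * Real.pi * Complex.I * ((lam * Real.sinh t : ℝ) : ℂ) * ec (lam * Real.cosh t)) =
      (2 * Real.pi * Complex.I * lam) * ∫ t in δ..L, q t * ec (lam * Real.cosh t) := by
    rw [← intervalIntegral.integral_const_mul]
    apply intervalIntegral.integral_congr
    intro t ht
    have hne : (Real.sinh t : ℂ) ≠ 0 := by exact_mod_cast (hsp t ht).ne'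
    simp only
    rw [Complex.ofReal_mul]
    field_simp
  rw [e1] at ibp
  have gL : ‖q L / (Real.sinh L : ℂ) * ec (lam * Real.cosh L)‖ ≤ 3 * B := by
    have hs := hsp L Set.right_mem_uIcc
    rw [norm_mul, ec_norm, mul_one, norm_div, Complex.norm_real, Real.norm_of_nonneg hs.le, div_le_iff₀ hs]
    have h1 := (hB L (by linarith)).1
    have h2 : Real.exp (min L t1) ≤ Real.exp L := Real.exp_le_exp.2 (min_le_left _ _)
    have h3 : Real.exp L ≤ 3 * Real.sinh L := by
      rw [Real.sinh_eq]
      have a : Real.exp 1 ≤ Real.exp L := Real.exp_le_exp.2 hL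
      have b : (2:ℝ) ≤ Real.exp 1 := by linarith [Real.exp_one_gt_d9]
      have c : Real.exp (-L) * Real.exp L = 1 := by rw [← Real.exp_add]; simp
      have d : Real.exp (-L) ≤ 1/2 := by
        have := Real.exp_pos (-L)
        nlinarith
      linarith
    calc _ ≤ B * Real.exp (min L t1) := h1
      _ ≤ B * (3 * Real.sinh L) := by gcongr; linarith
      _ = _ := by ring
  have gδ : ‖q δ / (Real.sinh δ : ℂ) * ec (lam * Real.cosh δ)‖ ≤ 3 * B := by
    have hs := hsp δ Set.left_mem_uIcc
    rw [norm_mul, ec_norm, mul_one, norm_div, Complex.norm_real, Real.norm_of_nonneg hs.le, div_le_iff₀ hs]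
    have h1 : ‖q δ‖ ≤ 3 * B * δ := by
      have hf : ∫ x in (0:ℝ)..δ, q1 x = q δ := by
        rw [intervalIntegral.integral_eq_sub_of_hasDerivAt (fun x _ => hq x) (hq1c.intervalIntegrable _ _), q0, sub_zero]
      rw [← hf]
      have := intervalIntegral.norm_integral_le_of_norm_le_const (a := 0) (b := δ) (C := 3 * B) (f := q1) (by
        intro t ht
        rw [Set.uIoc_of_le hδ0.le] at ht
        exact (hB t ht.1.le).2.1.trans (hsmall t ht.1.le (ht.2.trans hδ1)))
      rwa [sub_zero, abs_of_pos hδ0] at this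
    have : δ ≤ Real.sinh δ := Real.self_le_sinh_iff.2 hδ0.le
    calc _ ≤ 3 * B * δ := h1
      _ ≤ _ := by gcongr
  have gI : ‖∫ t in δ..L, N t / (Real.sinh t : ℂ) ^ 2 * ec (lam * Real.cosh t)‖ ≤ 4 * B * (t1 + 1) := by
    have hc : Continuous (fun t => 4 * B * Real.exp (min t t1 - t)) := by fun_prop
    have h1 : ‖∫ t in δ..L, N t / (Real.sinh t : ℂ) ^ 2 * ec (lam * Real.cosh t)‖ ≤ ∫ t in δ..L, 4 * B * Real.exp (min t t1 - t) := by
      apply intervalIntegral.norm_integral_le_of_norm_le (hδ1.trans hL)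
      · refine Filter.Eventually.of_forall fun t ht => ?_
        have ht0 : 0 < t := hδ0.trans ht.1
        have hs := Real.sinh_pos_iff.2 ht0
        rw [norm_mul, ec_norm, mul_one, norm_div, norm_pow, Complex.norm_real, Real.norm_of_nonneg hs.le]
        have hcs := Real.cosh_sq t
        rw [div_le_iff₀ (by positivity), show Real.sinh t ^ 2 = (Real.cosh t - 1) * (Real.cosh t + 1) by linarith]
        refine (hNb t ht0.le).trans ?_
        have hch := Real.one_le_cosh t
        have hE : Real.exp t ≤ 2 * (Real.cosh t + 1) := by
          rw [Real.cosh_eq]; linarith [Real.exp_pos (-t)]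
        have hm : Real.exp (min t t1) = Real.exp (min t t1 - t) * Real.exp t := by rw [← Real.exp_add]; congr 1; ring
        have hE2 := Real.exp_pos (min t t1 - t)
        calc 2 * B * Real.exp (min t t1) * (Real.cosh t - 1)
            = 2 * B * Real.exp (min t t1 - t) * (Real.cosh t - 1) * Real.exp t := by rw [hm]; ring
          _ ≤ 2 * B * Real.exp (min t t1 - t) * (Real.cosh t - 1) * (2 * (Real.cosh t + 1)) := by
              apply mul_le_mul_of_nonneg_left hE
              apply mul_nonneg (by positivity); linarith
          _ = _ := by ring
      · exact hc.intervalIntegrable _ _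
    have h2 : ∫ t in δ..L, 4 * B * Real.exp (min t t1 - t) ≤ ∫ t in (0:ℝ)..L, 4 * B * Real.exp (min t t1 - t) := by
      rw [← intervalIntegral.integral_add_adjacent_intervals (hc.intervalIntegrable 0 δ) (hc.intervalIntegrable δ L)]
      have : 0 ≤ ∫ t in (0:ℝ)..δ, 4 * B * Real.exp (min t t1 - t) :=
        intervalIntegral.integral_nonneg hδ0.le fun t _ => by positivity
      linarith
    simp only [intervalIntegral.integral_const_mul] at h1 h2
    have h3 := mul_le_mul_of_nonneg_left (exp_min_int ht1 (show 0 ≤ L by linarith)) (show 0 ≤ 4 * B by positivity)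
    linarith
  have p2 : ‖∫ t in δ..L, q t * ec (lam * Real.cosh t)‖ ≤ (6 * B + 4 * B * (t1 + 1)) * δ := by
    have h1 : ‖(2 * Real.pi * Complex.I * lam : ℂ) * ∫ t in δ..L, q t * ec (lam * Real.cosh t)‖ ≤ 6 * B + 4 * B * (t1 + 1) := by
      rw [ibp]
      calc _ ≤ _ := norm_sub_le _ _
        _ ≤ (3 * B + 3 * B) + 4 * B * (t1 + 1) := add_le_add ((norm_sub_le _ _).trans (add_le_add gL gδ)) gI
        _ = _ := by ring
    rw [norm_mul] at h1
    have h2 : ‖(2 * Real.pi * Complex.I * lam : ℂ)‖ = 2 * Real.pi * lam := by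
      simp [abs_of_pos Real.pi_pos, abs_of_pos (show 0 < lam by linarith)]
    rw [h2] at h1
    have h3 : lam * ‖∫ t in δ..L, q t * ec (lam * Real.cosh t)‖ ≤ 2 * Real.pi * lam * ‖∫ t in δ..L, q t * ec (lam * Real.cosh t)‖ := by
      have : 1 ≤ 2 * Real.pi := by linarith [Real.pi_gt_three]
      have h0 : 0 ≤ lam * ‖∫ t in δ..L, q t * ec (lam * Real.cosh t)‖ := by positivity
      nlinarith
    rw [hδ, mul_one_div, le_div_iff₀ (by linarith), mul_comm]
    linarith
  calc _ ≤ _ := norm_add_le _ _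
    _ ≤ 3 * B * δ + (6 * B + 4 * B * (t1 + 1)) * δ := add_le_add p1 p2
    _ = (13 * B + 4 * B * t1) * δ := by ring
    _ ≤ (20 * B * (t1 + 2)) * δ := by
        apply mul_le_mul_of_nonneg_right _ hδ0.le
        nlinarith [mul_nonneg hB0 ht1]
    _ = _ := by rw [hδ]; ring

/-- model amplitude -/
noncomputable def chi (t : ℝ) : ℝ := Real.cosh (t/2) * Real.exp (-(4 * Real.pi * Real.sinh (t/2) ^ 2))
noncomputable def chi1 (t : ℝ) : ℝ := (Real.sinh (t/2) / 2 - 4 * Real.pi * Real.sinh (t/2) * Real.cosh (t/2) ^ 2) * Real.exp (-(4 * Real.pi * Real.sinh (t/2) ^ 2))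
noncomputable def chi2 (t : ℝ) : ℝ := (Real.cosh (t/2) / 4 - 4 * Real.pi * (Real.cosh (t/2) ^ 3 / 2 + Real.sinh (t/2) ^ 2 * Real.cosh (t/2))
   - (Real.sinh (t/2) / 2 - 4 * Real.pi * Real.sinh (t/2) * Real.cosh (t/2) ^ 2) * (4 * Real.pi * Real.sinh (t/2) * Real.cosh (t/2))) * Real.exp (-(4 * Real.pi * Real.sinh (t/2) ^ 2))

lemma chi_aux (t : ℝ) : HasDerivAt (fun t : ℝ => Real.cosh (t/2)) (Real.sinh (t/2) / 2) t ∧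
    HasDerivAt (fun t : ℝ => Real.sinh (t/2)) (Real.cosh (t/2) / 2) t ∧
    HasDerivAt (fun t : ℝ => Real.exp (-(4 * Real.pi * Real.sinh (t/2) ^ 2)))
      (-(4 * Real.pi * Real.sinh (t/2) * Real.cosh (t/2)) * Real.exp (-(4 * Real.pi * Real.sinh (t/2) ^ 2))) t := by
  have h := (hasDerivAt_id t).div_const 2
  have h1 : HasDerivAt (fun t : ℝ => Real.cosh (t/2)) (Real.sinh (t/2) / 2) t := by
    have := h.cosh; convert! this using 1; simp; ring
  have h2 : HasDerivAt (fun t : ℝ => Real.sinh (t/2)) (Real.cosh (t/2) / 2) t := by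
    have := h.sinh; convert! this using 1; simp; ring
  refine ⟨h1, h2, ?_⟩
  have := (((h2.pow 2).const_mul (4 * Real.pi)).neg).exp
  convert! this using 1
  simp
  ring

lemma chi_deriv (t : ℝ) : HasDerivAt chi (chi1 t) t := by
  obtain ⟨h1, h2, h3⟩ := chi_aux t
  have := h1.mul h3
  unfold chi chi1
  convert! this using 1
  ring

lemma chi1_deriv (t : ℝ) : HasDerivAt chi1 (chi2 t) t := by
  obtain ⟨h1, h2, h3⟩ := chi_aux t
  have := ((h2.div_const 2).sub ((h2.const_mul (4 * Real.pi)).mul (h1.pow 2))).mul h3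
  unfold chi2
  convert! this using 1
  simp only [Pi.mul_apply, Pi.pow_apply, Pi.sub_apply]
  push_cast
  ring

lemma chi2_cont : Continuous chi2 := by
  unfold chi2
  have := Real.continuous_cosh
  have := Real.continuous_sinh
  fun_prop

lemma chi_bound (t : ℝ) : |chi t| ≤ 10000 ∧ |chi1 t| ≤ 10000 ∧ |chi2 t| ≤ 10000 := by
  unfold chi chi1 chi2
  set c := Real.cosh (t/2)
  set s := Real.sinh (t/2)
  set E := Real.exp (-(4 * Real.pi * s ^ 2)) with hE
  have hc1 : 1 ≤ c := Real.one_le_cosh _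
  have hcs : c ^ 2 = s ^ 2 + 1 := Real.cosh_sq _
  have hsc : |s| ≤ c := abs_le_of_sq_le_sq (by linarith) (by linarith)
  have hE0 : 0 < E := Real.exp_pos _
  have hpi := Real.pi_gt_three
  have hpi4 := Real.pi_le_four
  have key : c ^ 5 * E ≤ 18 := by
    have a : c ^ 5 ≤ c ^ 6 := pow_le_pow_right₀ hc1 (by norm_num)
    have b : (1 + s ^ 2) ^ 3 / (Nat.factorial 3 : ℝ) ≤ Real.exp (1 + s ^ 2) := Real.pow_div_factorial_le_exp _ (by positivity) 3
    have b' : c ^ 6 ≤ 6 * Real.exp (1 + s ^ 2) := by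
      have : c ^ 6 = (1 + s ^ 2) ^ 3 := by rw [show c ^ 6 = (c ^ 2) ^ 3 by ring, hcs]; ring
      rw [this]
      have : (Nat.factorial 3 : ℝ) = 6 := by norm_num [Nat.factorial]
      rw [this] at b
      linarith
    have d : Real.exp (1 + s ^ 2) * E ≤ 3 := by
      rw [hE, ← Real.exp_add]
      calc _ ≤ Real.exp 1 := Real.exp_le_exp.2 (by nlinarith [sq_nonneg s])
        _ ≤ 3 := by linarith [Real.exp_one_lt_d9]
    calc c ^ 5 * E ≤ (6 * Real.exp (1 + s ^ 2)) * E := by gcongr; linarith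
      _ ≤ 18 := by linarith
  have hp : ∀ k, k ≤ 5 → c ^ k ≤ c ^ 5 := fun k hk => pow_le_pow_right₀ hc1 hk
  have gen : ∀ x : ℝ, |x| ≤ 500 * c ^ 5 → |x * E| ≤ 10000 := by
    intro x hx
    rw [abs_mul, abs_of_pos hE0]
    have := mul_le_mul_of_nonneg_right hx hE0.le
    linarith
  have hc0 : 0 < c := by linarith
  have t0 : |s * c ^ 2| ≤ c ^ 5 := by
    rw [abs_mul, abs_of_pos (pow_pos hc0 2)]
    calc _ ≤ c * c ^ 2 := by gcongr
      _ = c ^ 3 := by ring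
      _ ≤ _ := hp 3 (by norm_num)
  have t1 : |s| ≤ c ^ 5 := hsc.trans (by have := hp 1 (by norm_num); simpa using this)
  have t2 : |s ^ 2 * c| ≤ c ^ 5 := by
    rw [abs_mul, abs_of_pos hc0, abs_pow]
    calc _ ≤ c ^ 2 * c := by gcongr
      _ = c ^ 3 := by ring
      _ ≤ _ := hp 3 (by norm_num)
  have t3 : |s ^ 2 * c ^ 3| ≤ c ^ 5 := by
    rw [abs_mul, abs_of_pos (pow_pos hc0 3), abs_pow]
    calc _ ≤ c ^ 2 * c ^ 3 := by gcongr
      _ = _ := by ring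
  have c5 : 1 ≤ c ^ 5 := one_le_pow₀ hc1
  refine ⟨?_, ?_, ?_⟩
  · apply gen
    have := hp 1 (by norm_num)
    rw [abs_of_pos hc0]; linarith
  · apply gen
    have a := abs_le.1 t0
    have b := abs_le.1 t1
    rw [abs_le]
    constructor <;> nlinarith
  · apply gen
    have e : c / 4 - 4 * Real.pi * (c ^ 3 / 2 + s ^ 2 * c) - (s / 2 - 4 * Real.pi * s * c ^ 2) * (4 * Real.pi * s * c) =
      c / 4 - 2 * Real.pi * c ^ 3 - 6 * Real.pi * (s ^ 2 * c) + 16 * Real.pi ^ 2 * (s ^ 2 * c ^ 3) := by ring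
    rw [e]
    have h3 := hp 3 (by norm_num)
    have h1 := hp 1 (by norm_num)
    rw [pow_one] at h1
    have p3 : 0 < c ^ 3 := by positivity
    have x1 : |c / 4| ≤ c ^ 5 := by rw [abs_of_pos (by positivity)]; linarith
    have x2 : |2 * Real.pi * c ^ 3| ≤ 8 * c ^ 5 := by rw [abs_of_pos (by positivity)]; nlinarith
    have x3 : |6 * Real.pi * (s ^ 2 * c)| ≤ 24 * c ^ 5 := by
      rw [abs_mul, abs_of_pos (by positivity)]
      exact mul_le_mul (by linarith) t2 (abs_nonneg _) (by norm_num)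
    have x4 : |16 * Real.pi ^ 2 * (s ^ 2 * c ^ 3)| ≤ 256 * c ^ 5 := by
      rw [abs_mul, abs_of_pos (by positivity)]
      exact mul_le_mul (by nlinarith) t3 (abs_nonneg _) (by norm_num)
    calc _ ≤ |c / 4 - 2 * Real.pi * c ^ 3 - 6 * Real.pi * (s ^ 2 * c)| + |16 * Real.pi ^ 2 * (s ^ 2 * c ^ 3)| := abs_add_le _ _
      _ ≤ (|c / 4 - 2 * Real.pi * c ^ 3| + |6 * Real.pi * (s ^ 2 * c)|) + |16 * Real.pi ^ 2 * (s ^ 2 * c ^ 3)| := by gcongr; exact abs_sub _ _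
      _ ≤ ((|c / 4| + |2 * Real.pi * c ^ 3|) + |6 * Real.pi * (s ^ 2 * c)|) + |16 * Real.pi ^ 2 * (s ^ 2 * c ^ 3)| := by gcongr; exact abs_sub _ _
      _ ≤ _ := by linarith

lemma chi_tendsto {lam : ℝ} : Filter.Tendsto (fun L : ℝ => ∫ t in (-L)..L, (chi t : ℂ) * ec (lam * Real.cosh t)) Filter.atTop
    (nhds (ec lam * (Real.pi / (Real.pi * (1 - Complex.I * lam)) : ℂ) ^ (1/2 : ℂ))) := by
  set b : ℂ := Real.pi * (1 - Complex.I * lam) with hb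
  have hbre : 0 < b.re := by simp [hb, Real.pi_pos]
  have hIntg := integrable_cexp_neg_mul_sq hbre
  have hg := integral_gaussian_complex hbre
  rw [← hg]
  have h1 : Filter.Tendsto (fun L : ℝ => 2 * Real.sinh (L/2)) Filter.atTop Filter.atTop := by
    apply Filter.tendsto_atTop_mono' Filter.atTop (f₁ := fun L => L)
    · filter_upwards [Filter.eventually_ge_atTop 0] with L hL
      have := (Real.self_le_sinh_iff (x := L/2)).2 (by linarith)
      linarith
    · exact Filter.tendsto_id
  have h2 := intervalIntegral_tendsto_integral hIntg (Filter.tendsto_neg_atTop_atBot.comp h1) h1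
  have h3 := h2.const_mul (ec lam)
  refine h3.congr fun L => ?_
  simp only [Function.comp]
  have hc : Continuous (fun w : ℝ => ec lam * Complex.exp (-b * (w:ℂ) ^ 2)) := by fun_prop
  have hsub := intervalIntegral.integral_deriv_smul_comp (a := -L) (b := L) (f := fun t : ℝ => 2 * Real.sinh (t/2)) (f' := fun t => Real.cosh (t/2))
    (g := fun w : ℝ => ec lam * Complex.exp (-b * (w:ℂ) ^ 2)) (by
      intro t _
      have := (chi_aux t).2.1.const_mul 2
      convert! this using 1; ring) (by
      apply Continuous.continuousOn
      have := Real.continuous_cosh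
      fun_prop) hc
  rw [show 2 * Real.sinh (-L / 2) = -(2 * Real.sinh (L/2)) by rw [neg_div, Real.sinh_neg]; ring] at hsub
  rw [← intervalIntegral.integral_const_mul, ← hsub]
  apply intervalIntegral.integral_congr
  intro t _
  simp only [Function.comp, Complex.real_smul, chi, ec]
  have hch : Real.cosh t = 1 + 2 * Real.sinh (t/2) ^ 2 := by
    have := Real.cosh_two_mul (t/2)
    rw [show 2 * (t/2) = t by ring] at this
    rw [this, Real.cosh_sq]; ring
  rw [hch, Complex.ofReal_mul (Real.cosh (t/2)), Complex.ofReal_exp, mul_assoc ((Real.cosh (t/2) : ℝ) : ℂ), ← Complex.exp_add, ← Complex.exp_add]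
  congr 2
  rw [hb]
  push_cast
  ring_nf

lemma gauss_const {lam : ℝ} (hl : 1 ≤ lam) :
    ‖(Real.pi / (Real.pi * (1 - Complex.I * lam)) : ℂ) ^ (1/2 : ℂ) - ec (1/8) / Real.sqrt lam‖ ≤ 2 / lam := by
  have hpi : (Real.pi : ℂ) ≠ 0 := by exact_mod_cast Real.pi_ne_zero
  have hne : (1 - Complex.I * lam : ℂ) ≠ 0 := by
    intro h
    have := congrArg Complex.re h
    simp at this
  have e0 : (Real.pi / (Real.pi * (1 - Complex.I * lam)) : ℂ) = 1 / (1 - Complex.I * lam) := by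
    field_simp
  rw [e0]
  set x : ℂ := 1 / (1 - Complex.I * lam) with hx
  set z : ℂ := x ^ (1/2 : ℂ) with hz
  set w : ℂ := ec (1/8) / Real.sqrt lam with hw
  have hl0 : 0 < lam := by linarith
  have hsl : 0 < Real.sqrt lam := Real.sqrt_pos.2 hl0
  have hsq : Real.sqrt lam ^ 2 = lam := Real.sq_sqrt hl0.le
  have hxne : x ≠ 0 := by rw [hx]; exact one_div_ne_zero hne
  have z2 : z ^ 2 = x := by
    rw [hz, ← Complex.cpow_nat_mul]; simp
  have w2 : w ^ 2 = Complex.I / lam := by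
    rw [hw, div_pow, ← Complex.ofReal_pow, hsq]
    congr 1
    unfold ec
    rw [← Complex.exp_nat_mul, show ((2:ℕ):ℂ) * (2 * Real.pi * ((1/8 : ℝ) : ℂ) * Complex.I) = Real.pi / 2 * Complex.I by push_cast; ring]
    exact Complex.exp_pi_div_two_mul_I
  have zre : 0 ≤ z.re := by
    rw [hz, Complex.cpow_def_of_ne_zero hxne, Complex.exp_re]
    apply mul_nonneg (Real.exp_pos _).le
    have : (Complex.log x * (1/2 : ℂ)).im = Complex.arg x / 2 := by
      rw [show (1/2:ℂ) = ((1/2:ℝ):ℂ) by push_cast; rfl, Complex.im_mul_ofReal, Complex.log_im]; ring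
    rw [this]
    apply Real.cos_nonneg_of_neg_pi_div_two_le_of_le <;> linarith [Complex.neg_pi_lt_arg x, Complex.arg_le_pi x]
  have wre : 1 / (2 * Real.sqrt lam) ≤ w.re := by
    rw [hw, Complex.div_ofReal_re, ec_re, show 2 * Real.pi * (1/8) = Real.pi / 4 by ring, Real.cos_pi_div_four]
    rw [div_le_div_iff₀ (by positivity) hsl]
    have : 1 ≤ Real.sqrt 2 := by rw [Real.one_le_sqrt]; norm_num
    nlinarith
  have hsum : 1 / (2 * Real.sqrt lam) ≤ ‖z + w‖ := by
    refine le_trans ?_ (Complex.re_le_norm _)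
    rw [Complex.add_re]; linarith
  have hdiff : z ^ 2 - w ^ 2 = - Complex.I / (lam * (1 - Complex.I * lam)) := by
    rw [z2, w2, hx]
    have : (lam : ℂ) ≠ 0 := by exact_mod_cast hl0.ne'
    field_simp
    ring_nf
    simp
  have hnorm : ‖z ^ 2 - w ^ 2‖ ≤ 1 / lam ^ 2 := by
    rw [hdiff, norm_div, norm_neg, Complex.norm_I, norm_mul, Complex.norm_real, Real.norm_of_nonneg hl0.le]
    have : lam ≤ ‖(1 - Complex.I * lam : ℂ)‖ := by
      have := Complex.abs_im_le_norm (1 - Complex.I * lam : ℂ)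
      simp at this
      exact (le_abs_self _).trans this
    rw [pow_two]
    gcongr
  have hfac : ‖z - w‖ * ‖z + w‖ ≤ 1 / lam ^ 2 := by
    rw [← norm_mul, show (z - w) * (z + w) = z ^ 2 - w ^ 2 by ring]; exact hnorm
  have h1 : ‖z - w‖ * (1 / (2 * Real.sqrt lam)) ≤ 1 / lam ^ 2 := le_trans (by gcongr) hfac
  have h2 : ‖z - w‖ ≤ 2 * Real.sqrt lam / lam ^ 2 := by
    rw [le_div_iff₀ (by positivity)]
    rw [mul_one_div, div_le_div_iff₀ (by positivity) (by positivity)] at h1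
    linarith
  refine h2.trans ?_
  rw [div_le_div_iff₀ (by positivity) hl0]
  have : Real.sqrt lam ≤ lam := by
    rw [Real.sqrt_le_left (by linarith)]; nlinarith
  nlinarith

lemma stat_phase {f f1 f2 : ℝ → ℂ} {B t1 lam a b : ℝ} (hf : ∀ t, HasDerivAt f (f1 t) t) (hf1 : ∀ t, HasDerivAt f1 (f2 t) t)
    (hf2 : Continuous f2)
    (hB : ∀ t, ‖f t‖ ≤ B * Real.exp t ∧ ‖f1 t‖ ≤ B * Real.exp t ∧ ‖f2 t‖ ≤ B * Real.exp t)
    (ht1 : 0 ≤ t1) (hft : ∀ t, t1 < t → f t = 0) (hsupp : Function.support f ⊆ Set.Ioc a b) (hlam : 1 ≤ lam) :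
    ‖(∫ t in a..b, f t * ec (lam * Real.cosh t)) - f 0 * (ec lam * (ec (1/8) / Real.sqrt lam))‖ ≤ 1000000 * B * (t1 + 2) / lam := by
  have hfc : Continuous f := continuous_iff_continuousAt.2 fun t => (hf t).continuousAt
  have hB0 : 0 ≤ B := by
    have := (norm_nonneg _).trans (hB 0).1
    simpa using this
  have hf0 : ‖f 0‖ ≤ B := by have := (hB 0).1; simpa using this
  have z1 : ∀ t, t1 < t → f1 t = 0 := by
    intro t ht
    have : f =ᶠ[nhds t] fun _ => 0 := by
      filter_upwards [Ioi_mem_nhds ht] with y hy using hft y hy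
    rw [← (hf t).deriv, this.deriv_eq]; simp
  have z2 : ∀ t, t1 < t → f2 t = 0 := by
    intro t ht
    have : f1 =ᶠ[nhds t] fun _ => 0 := by
      filter_upwards [Ioi_mem_nhds ht] with y hy using z1 y hy
    rw [← (hf1 t).deriv, this.deriv_eq]; simp
  have hB' : ∀ t, 0 ≤ t → ‖f t‖ ≤ B * Real.exp (min t t1) ∧ ‖f1 t‖ ≤ B * Real.exp (min t t1) ∧ ‖f2 t‖ ≤ B * Real.exp (min t t1) := by
    intro t _
    rcases le_or_gt t t1 with h | h
    · rw [min_eq_left h]; exact hB t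
    · rw [hft t h, z1 t h, z2 t h, norm_zero]
      refine ⟨?_, ?_, ?_⟩ <;> positivity
  set q : ℝ → ℂ := fun t => f t - f 0 * (chi t : ℂ) with hq
  set q1 : ℝ → ℂ := fun t => f1 t - f 0 * (chi1 t : ℂ) with hq1
  set q2 : ℝ → ℂ := fun t => f2 t - f 0 * (chi2 t : ℂ) with hq2
  have dq : ∀ t, HasDerivAt q (q1 t) t := fun t => (hf t).sub ((chi_deriv t).ofReal_comp.const_mul _)
  have dq1 : ∀ t, HasDerivAt q1 (q2 t) t := fun t => (hf1 t).sub ((chi1_deriv t).ofReal_comp.const_mul _)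
  have cq2 : Continuous q2 := hf2.sub (continuous_const.mul (Complex.continuous_ofReal.comp chi2_cont))
  have hqc : Continuous q := continuous_iff_continuousAt.2 fun t => (dq t).continuousAt
  have q0 : q 0 = 0 := by simp [hq, chi]
  have gen : ∀ (x : ℂ) (y M : ℝ), 1 ≤ M → ‖x‖ ≤ B * M → |y| ≤ 10000 → ‖x - f 0 * (y : ℂ)‖ ≤ 10001 * B * M := by
    intro x y M hM hx hy
    calc _ ≤ ‖x‖ + ‖f 0 * (y:ℂ)‖ := norm_sub_le _ _
      _ ≤ B * M + B * 10000 := by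
        apply add_le_add hx
        rw [norm_mul, Complex.norm_real]
        exact mul_le_mul hf0 hy (norm_nonneg _) hB0
      _ ≤ _ := by nlinarith
  have right := fun L (hL : 1 ≤ L) => half_stat (B := 10001 * B) (t1 := t1) (lam := lam) (L := L) dq dq1 cq2 q0 (by
    intro t ht
    have hM : 1 ≤ Real.exp (min t t1) := Real.one_le_exp (le_min ht ht1)
    have hb := hB' t ht
    have hc := chi_bound t
    exact ⟨gen _ _ _ hM hb.1 hc.1, gen _ _ _ hM hb.2.1 hc.2.1, gen _ _ _ hM hb.2.2 hc.2.2⟩) ht1 hlam hL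
  have left := fun L (hL : 1 ≤ L) => half_stat (q := fun t => q (-t)) (q1 := fun t => - q1 (-t)) (q2 := fun t => q2 (-t))
    (B := 10001 * B) (t1 := 0) (lam := lam) (L := L) (by
      intro t
      have := (dq (-t)).scomp t (hasDerivAt_neg t)
      convert! this using 1
      simp) (by
      intro t
      have := ((dq1 (-t)).scomp t (hasDerivAt_neg t)).neg
      convert! this using 1
      simp) (cq2.comp continuous_neg) (by simpa using q0) (by
    intro t ht
    rw [min_eq_right ht, norm_neg]
    have hM : 1 ≤ Real.exp (0:ℝ) := by simp
    have hb := hB (-t)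
    have hE : B * Real.exp (-t) ≤ B * Real.exp 0 := by gcongr; linarith
    have hc := chi_bound (-t)
    exact ⟨gen _ _ _ hM (hb.1.trans hE) hc.1, gen _ _ _ hM (hb.2.1.trans hE) hc.2.1, gen _ _ _ hM (hb.2.2.trans hE) hc.2.2⟩) le_rfl hlam hL
  have hvc : Continuous (fun t => ec (lam * Real.cosh t)) := by
    apply ec_cont.comp; exact continuous_const.mul Real.continuous_cosh
  have hqv : Continuous (fun t => q t * ec (lam * Real.cosh t)) := hqc.mul hvc
  have both : ∀ L, 1 ≤ L → ‖∫ t in (-L)..L, q t * ec (lam * Real.cosh t)‖ ≤ 20 * (10001 * B) * (t1 + 4) / lam := by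
    intro L hL
    rw [← intervalIntegral.integral_add_adjacent_intervals (hqv.intervalIntegrable (-L) 0) (hqv.intervalIntegrable 0 L)]
    have e : ∫ t in (-L)..0, q t * ec (lam * Real.cosh t) = ∫ t in (0:ℝ)..L, q (-t) * ec (lam * Real.cosh t) := by
      have := intervalIntegral.integral_comp_neg (a := 0) (b := L) (fun t => q t * ec (lam * Real.cosh t))
      simp only [Real.cosh_neg, neg_zero] at this
      exact this.symm
    rw [e]
    calc _ ≤ _ := norm_add_le _ _
      _ ≤ _ := add_le_add (left L hL) (right L hL)
      _ = _ := by ring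
  set I := ∫ t in a..b, f t * ec (lam * Real.cosh t) with hI
  have hIL : ∀ L, |a| + |b| ≤ L → ∫ t in (-L)..L, f t * ec (lam * Real.cosh t) = I := by
    intro L hL
    have hs : Function.support (fun t => f t * ec (lam * Real.cosh t)) ⊆ Set.Ioc a b :=
      (Function.support_mul_subset_left _ _).trans hsupp
    rw [hI, intervalIntegral.integral_eq_integral_of_support_subset hs, intervalIntegral.integral_eq_integral_of_support_subset]
    refine hs.trans (Set.Ioc_subset_Ioc ?_ ?_)
    · linarith [neg_abs_le a, abs_nonneg b]
    · linarith [le_abs_self b, abs_nonneg a]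
  have hlim : ‖I - f 0 * (ec lam * (Real.pi / (Real.pi * (1 - Complex.I * lam)) : ℂ) ^ (1/2 : ℂ))‖ ≤ 20 * (10001 * B) * (t1 + 4) / lam := by
    have ht := ((chi_tendsto (lam := lam)).const_mul (f 0)).const_sub I
    refine le_of_tendsto ht.norm ?_
    filter_upwards [Filter.eventually_ge_atTop (|a| + |b| + 1)] with L hL
    have hL1 : 1 ≤ L := by linarith [abs_nonneg a, abs_nonneg b]
    have e : I - f 0 * ∫ t in (-L)..L, (chi t : ℂ) * ec (lam * Real.cosh t) = ∫ t in (-L)..L, q t * ec (lam * Real.cosh t) := by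
      rw [← hIL L (by linarith), ← intervalIntegral.integral_const_mul, ← intervalIntegral.integral_sub]
      · congr 1; funext t; simp only [hq]; ring
      · exact (hfc.mul hvc).intervalIntegrable _ _
      · apply Continuous.intervalIntegrable
        have : Continuous chi := continuous_iff_continuousAt.2 fun t => (chi_deriv t).continuousAt
        exact continuous_const.mul ((Complex.continuous_ofReal.comp this).mul hvc)
    rw [e]
    exact both L hL1
  have hg := gauss_const hlam
  set Z := (Real.pi / (Real.pi * (1 - Complex.I * lam)) : ℂ) ^ (1/2 : ℂ)
  have e : I - f 0 * (ec lam * (ec (1/8) / Real.sqrt lam)) = (I - f 0 * (ec lam * Z)) + f 0 * (ec lam * (Z - ec (1/8) / Real.sqrt lam)) := by ring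
  rw [e]
  have h2 : ‖f 0 * (ec lam * (Z - ec (1/8) / Real.sqrt lam))‖ ≤ B * (2 / lam) := by
    rw [norm_mul, norm_mul, ec_norm, one_mul]
    exact mul_le_mul hf0 hg (norm_nonneg _) hB0
  calc _ ≤ _ := norm_add_le _ _
    _ ≤ 20 * (10001 * B) * (t1 + 4) / lam + B * (2 / lam) := add_le_add hlim h2
    _ = (20 * (10001 * B) * (t1 + 4) + 2 * B) / lam := by ring
    _ ≤ _ := by
      gcongr
      nlinarith [mul_nonneg hB0 ht1]

noncomputable def Phi (ξ : ℝ) : ℂ := ∫ v in (-1:ℝ)..1, (phi v : ℂ) * ec (v * ξ)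

open SchwartzMap FourierTransform in
lemma schwartz_bound (f : SchwartzMap ℝ ℂ) : ∃ C : ℝ, 0 < C ∧ ∀ x, ‖f x‖ ≤ C / (1 + |x|) ^ 8 := by
  obtain ⟨C0, h0, b0⟩ := f.decay 0 0
  obtain ⟨C8, h8, b8⟩ := f.decay 8 0
  refine ⟨256 * (C0 + C8), by positivity, fun x => ?_⟩
  have e0 := b0 x
  have e8 := b8 x
  rw [norm_iteratedFDeriv_zero] at e0 e8
  rw [Real.norm_eq_abs] at e8
  rw [le_div_iff₀ (by positivity)]
  have hx : (1 + |x|) ^ 8 ≤ 256 * (1 + |x| ^ 8) := by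
    have := add_pow_le (zero_le_one' ℝ) (abs_nonneg x) 8
    norm_num at this ⊢
    have h2 : 0 ≤ 1 + |x| ^ 8 := by positivity
    linarith
  have : 0 ≤ ‖f x‖ := norm_nonneg _
  calc ‖f x‖ * (1 + |x|) ^ 8 ≤ ‖f x‖ * (256 * (1 + |x| ^ 8)) := by gcongr
    _ = 256 * (‖x‖^0 * ‖f x‖ + |x| ^ 8 * ‖f x‖) := by ring
    _ ≤ _ := by gcongr

open SchwartzMap FourierTransform in
lemma Phi_schwartz : ∃ f : SchwartzMap ℝ ℂ, ∀ ξ, f ξ = Phi ξ := by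
  have h₁ : HasCompactSupport (Complex.ofRealCLM ∘ phi) := phi_compact.comp_left rfl
  have h₂ : ContDiff ℝ ((⊤ : ℕ∞) : WithTop ℕ∞) (Complex.ofRealCLM ∘ phi) := Complex.ofRealCLM.contDiff.comp phi_contDiff
  refine ⟨𝓕⁻ (h₁.toSchwartzMap h₂), fun ξ => ?_⟩
  rw [SchwartzMap.fourierInv_coe, Real.fourierInv_eq', Phi, intervalIntegral.integral_eq_integral_of_support_subset]
  · congr 1
    funext v
    have : (h₁.toSchwartzMap h₂) v = (phi v : ℂ) := rfl
    rw [this, smul_eq_mul, mul_comm]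
    congr 1
    unfold ec
    simp
    ring_nf
  · intro v hv
    have : phi v ≠ 0 := by
      intro h; apply hv; simp [h]
    have : v ∈ Function.support phi := this
    rw [phi_support] at this
    exact ⟨this.1, this.2.le⟩

lemma Phi_bounds : ∃ (F1 F2 : ℝ → ℂ) (C : ℝ), 0 < C ∧ (∀ x, HasDerivAt Phi (F1 x) x) ∧ (∀ x, HasDerivAt F1 (F2 x) x) ∧
    Continuous F2 ∧ ∀ x, ‖Phi x‖ ≤ C / (1 + |x|) ^ 8 ∧ ‖F1 x‖ ≤ C / (1 + |x|) ^ 8 ∧ ‖F2 x‖ ≤ C / (1 + |x|) ^ 8 := by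
  obtain ⟨f, hf⟩ := Phi_schwartz
  have hf' : Phi = f := by funext x; rw [hf]
  set f1 := SchwartzMap.derivCLM ℝ ℂ f
  set f2 := SchwartzMap.derivCLM ℝ ℂ f1
  obtain ⟨C0, h0, b0⟩ := schwartz_bound f
  obtain ⟨C1, h1, b1⟩ := schwartz_bound f1
  obtain ⟨C2, h2, b2⟩ := schwartz_bound f2
  refine ⟨f1, f2, C0 + C1 + C2, by positivity, ?_, ?_, f2.continuous, ?_⟩
  · intro x
    rw [hf']
    exact (f.differentiable x).hasDerivAt
  · intro x
    exact (f1.differentiable x).hasDerivAt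
  · intro x
    have hp : 0 < (1 + |x|) ^ 8 := by positivity
    rw [hf']
    refine ⟨(b0 x).trans ?_, (b1 x).trans ?_, (b2 x).trans ?_⟩ <;> gcongr <;> linarith

lemma Phi_zero : Phi 0 = 1 := by
  unfold Phi
  have : ∀ v : ℝ, (phi v : ℂ) * ec (v * 0) = ((phi v : ℝ) : ℂ) := by intro v; simp [ec]
  simp_rw [this]
  rw [intervalIntegral.integral_ofReal, phi_int]; simp

lemma Phi_lip : ∃ C : ℝ, 0 < C ∧ ∀ x, ‖Phi x - 1‖ ≤ C * |x| := by
  obtain ⟨F1, F2, C, hC, d1, d2, _, hb⟩ := Phi_bounds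
  refine ⟨C, hC, fun x => ?_⟩
  have := (convex_univ (𝕜 := ℝ) (E := ℝ)).norm_image_sub_le_of_norm_hasDerivWithin_le (f := Phi) (f' := F1) (C := C) (x := 0) (y := x)
    (fun x _ => (d1 x).hasDerivWithinAt) (fun x _ => (hb x).2.1.trans (div_le_self hC.le (by
      apply one_le_pow₀; linarith [abs_nonneg x]))) trivial trivial
  rw [Phi_zero] at this
  simpa using this

lemma JJ_swap {u h S : ℝ} (n k : ℕ) : JJ u h S n (-(k:ℝ)) = 
    ∫ s in (-S)..1, ((gc S s * Real.exp s : ℝ) : ℂ) * Phi (h * (n * Real.exp (-s) + k * Real.exp s)) * ec (u * (n * Real.exp (-s) + k * Real.exp s)) := by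
  unfold JJ
  simp_rw [← intervalIntegral.integral_const_mul]
  rw [intervalIntegral_intervalIntegral_swap]
  · apply intervalIntegral.integral_congr
    intro s _
    simp only [Phi]
    rw [← intervalIntegral.integral_const_mul, ← intervalIntegral.integral_mul_const]
    apply intervalIntegral.integral_congr
    intro v _
    simp only
    rw [show (u + h * v) * (n * Real.exp (-s) - -(k:ℝ) * Real.exp s) = v * (h * (n * Real.exp (-s) + k * Real.exp s)) + u * (n * Real.exp (-s) + k * Real.exp s) by ring, ec_add]
    ring
  · have h1 := phi_cont
    have h2 := gc_cont (S := S)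
    have h3 := ec_cont
    refine IntegrableOn.mono_set (t := Set.uIcc (-1:ℝ) 1 ×ˢ Set.uIcc (-S) 1) ?_ (Set.prod_mono Set.uIoc_subset_uIcc Set.uIoc_subset_uIcc)
    apply ContinuousOn.integrableOn_compact (isCompact_uIcc.prod isCompact_uIcc)
    apply Continuous.continuousOn
    unfold Function.uncurry
    fun_prop

lemma prod_bounds {G G1 G2 : ℝ → ℝ} {P P1 P2 : ℝ → ℂ} {A q : ℝ} (hA : 0 ≤ A) (hq : 0 ≤ q)
    (dG : ∀ t, HasDerivAt G (G1 t) t) (dG1 : ∀ t, HasDerivAt G1 (G2 t) t) (cG2 : Continuous G2)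
    (dP : ∀ t, HasDerivAt P (P1 t) t) (dP1 : ∀ t, HasDerivAt P1 (P2 t) t) (cP2 : Continuous P2)
    (bG : ∀ t, |G t| ≤ A * Real.exp t ∧ |G1 t| ≤ A * Real.exp t ∧ |G2 t| ≤ A * Real.exp t)
    (bP : ∀ t, ‖P t‖ ≤ q ∧ ‖P1 t‖ ≤ q ∧ ‖P2 t‖ ≤ q) :
    ∃ f1 f2 : ℝ → ℂ, (∀ t, HasDerivAt (fun t => (G t : ℂ) * P t) (f1 t) t) ∧ (∀ t, HasDerivAt f1 (f2 t) t) ∧ Continuous f2 ∧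
    ∀ t, ‖(G t : ℂ) * P t‖ ≤ 4 * A * q * Real.exp t ∧ ‖f1 t‖ ≤ 4 * A * q * Real.exp t ∧ ‖f2 t‖ ≤ 4 * A * q * Real.exp t := by
  have cG : Continuous G := continuous_iff_continuousAt.2 fun t => (dG t).continuousAt
  have cG1 : Continuous G1 := continuous_iff_continuousAt.2 fun t => (dG1 t).continuousAt
  have cP : Continuous P := continuous_iff_continuousAt.2 fun t => (dP t).continuousAt
  have cP1 : Continuous P1 := continuous_iff_continuousAt.2 fun t => (dP1 t).continuousAt
  refine ⟨fun t => (G1 t : ℂ) * P t + (G t : ℂ) * P1 t,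
    fun t => ((G2 t : ℂ) * P t + (G1 t : ℂ) * P1 t) + ((G1 t : ℂ) * P1 t + (G t : ℂ) * P2 t), ?_, ?_, by fun_prop, ?_⟩
  · intro t; exact (dG t).ofReal_comp.mul (dP t)
  · intro t; exact ((dG1 t).ofReal_comp.mul (dP t)).add ((dG t).ofReal_comp.mul (dP1 t))
  · intro t
    have key : ∀ (g : ℝ) (p : ℂ), |g| ≤ A * Real.exp t → ‖p‖ ≤ q → ‖(g:ℂ) * p‖ ≤ A * q * Real.exp t := by
      intro g p hg hp
      rw [norm_mul, Complex.norm_real, Real.norm_eq_abs]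
      calc _ ≤ A * Real.exp t * q := by gcongr
        _ = _ := by ring
    obtain ⟨g0, g1, g2⟩ := bG t
    obtain ⟨p0, p1, p2⟩ := bP t
    have h0 : 0 ≤ A * q * Real.exp t := by positivity
    have k00 := key _ _ g0 p0
    have k10 := key _ _ g1 p0
    have k01 := key _ _ g0 p1
    have k11 := key _ _ g1 p1
    have k20 := key _ _ g2 p0
    have k02 := key _ _ g0 p2
    refine ⟨by linarith, (norm_add_le _ _).trans (by linarith), (norm_add_le _ _).trans ?_⟩
    have := norm_add_le ((G2 t : ℂ) * P t) ((G1 t : ℂ) * P1 t)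
    have := norm_add_le ((G1 t : ℂ) * P1 t) ((G t : ℂ) * P2 t)
    linarith

lemma gc_exp_bounds : ∃ A : ℝ, 0 < A ∧ ∀ S s0 : ℝ, ∃ G1 G2 : ℝ → ℝ, (∀ t, HasDerivAt (fun t => gc S (s0 + t) * Real.exp t) (G1 t) t) ∧
    (∀ t, HasDerivAt G1 (G2 t) t) ∧ Continuous G2 ∧
    ∀ t, |gc S (s0 + t) * Real.exp t| ≤ A * Real.exp t ∧ |G1 t| ≤ A * Real.exp t ∧ |G2 t| ≤ A * Real.exp t := by
  obtain ⟨C, hC, hb⟩ := gc_derivs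
  refine ⟨4 * (C + 2), by positivity, fun S s0 => ?_⟩
  have hd := deriv_deriv_of_contDiff (gc_contDiff (S := S) (n := 2))
  have c0 := gc_cont (S := S)
  have c1 := (hd 0).2.2.1
  have c2 := (hd 0).2.2.2
  refine ⟨fun t => deriv (gc S) (s0 + t) * Real.exp t + gc S (s0 + t) * Real.exp t,
    fun t => (deriv (deriv (gc S)) (s0 + t) * Real.exp t + deriv (gc S) (s0 + t) * Real.exp t) + (deriv (gc S) (s0 + t) * Real.exp t + gc S (s0 + t) * Real.exp t), ?_, ?_, by fun_prop, ?_⟩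
  · intro t
    exact ((hd (s0 + t)).1.comp_const_add s0 t).mul (Real.hasDerivAt_exp t)
  · intro t
    exact (((hd (s0 + t)).2.1.comp_const_add s0 t).mul (Real.hasDerivAt_exp t)).add (((hd (s0 + t)).1.comp_const_add s0 t).mul (Real.hasDerivAt_exp t))
  · intro t
    have hE := Real.exp_pos t
    have e0 : |gc S (s0 + t) * Real.exp t| ≤ (C + 2) * Real.exp t := by
      rw [abs_mul, abs_of_pos hE, abs_of_nonneg (gc_nonneg _ _)]
      gcongr
      linarith [gc_le S (s0 + t)]
    have e1 : |deriv (gc S) (s0 + t) * Real.exp t| ≤ (C + 2) * Real.exp t := by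
      rw [abs_mul, abs_of_pos hE]
      gcongr
      linarith [(hb S (s0 + t)).1]
    have e2 : |deriv (deriv (gc S)) (s0 + t) * Real.exp t| ≤ (C + 2) * Real.exp t := by
      rw [abs_mul, abs_of_pos hE]
      gcongr
      linarith [(hb S (s0 + t)).2]
    have h0 : 0 ≤ (C + 2) * Real.exp t := by positivity
    refine ⟨by linarith, (abs_add_le _ _).trans (by linarith), (abs_add_le _ _).trans ?_⟩
    have := abs_add_le (deriv (deriv (gc S)) (s0 + t) * Real.exp t) (deriv (gc S) (s0 + t) * Real.exp t)
    have := abs_add_le (deriv (gc S) (s0 + t) * Real.exp t) (gc S (s0 + t) * Real.exp t)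
    linarith

lemma Phi_cosh_bounds : ∃ A : ℝ, 0 < A ∧ ∀ r : ℝ, 0 ≤ r → ∃ P1 P2 : ℝ → ℂ, (∀ t, HasDerivAt (fun t => Phi (r * Real.cosh t)) (P1 t) t) ∧
    (∀ t, HasDerivAt P1 (P2 t) t) ∧ Continuous P2 ∧
    ∀ t, ‖Phi (r * Real.cosh t)‖ ≤ A / (1 + r) ^ 4 ∧ ‖P1 t‖ ≤ A / (1 + r) ^ 4 ∧ ‖P2 t‖ ≤ A / (1 + r) ^ 4 := by
  obtain ⟨F1, F2, C, hC, d1, d2, cF2, hb⟩ := Phi_bounds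
  refine ⟨2 * C, by positivity, fun r hr => ?_⟩
  have cF1 : Continuous F1 := continuous_iff_continuousAt.2 fun t => (d2 t).continuousAt
  have hch := Real.continuous_cosh
  have hsh := Real.continuous_sinh
  have e1 : ∀ t, HasDerivAt (fun t => r * Real.cosh t) (r * Real.sinh t) t := fun t => (Real.hasDerivAt_cosh t).const_mul r
  have e2 : ∀ t, HasDerivAt (fun t => r * Real.sinh t) (r * Real.cosh t) t := fun t => (Real.hasDerivAt_sinh t).const_mul r
  refine ⟨fun t => ((r * Real.sinh t : ℝ) : ℂ) * F1 (r * Real.cosh t),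
    fun t => ((r * Real.cosh t : ℝ) : ℂ) * F1 (r * Real.cosh t) + ((r * Real.sinh t : ℝ) : ℂ) * (((r * Real.sinh t : ℝ) : ℂ) * F2 (r * Real.cosh t)), ?_, ?_, by fun_prop, ?_⟩
  · intro t
    have := (d1 (r * Real.cosh t)).scomp t (e1 t)
    rw [Complex.real_smul] at this
    exact this
  · intro t
    have := (d2 (r * Real.cosh t)).scomp t (e1 t)
    rw [Complex.real_smul] at this
    exact (e2 t).ofReal_comp.mul this
  · intro t
    set c := r * Real.cosh t with hc
    have hrc : r ≤ c := by
      have := Real.one_le_cosh t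
      rw [hc]; nlinarith
    have hc0 : 0 ≤ c := hr.trans hrc
    have hs : |r * Real.sinh t| ≤ c := by
      rw [abs_mul, abs_of_nonneg hr, hc]
      gcongr
      rw [abs_le]
      have h1 := Real.cosh_add_sinh t
      have h2 := Real.cosh_sub_sinh t
      have := Real.exp_pos t
      have := Real.exp_pos (-t)
      constructor <;> linarith
    obtain ⟨b0, b1, b2⟩ := hb c
    rw [abs_of_nonneg hc0] at b0 b1 b2
    have hp : 0 < (1 + c) ^ 8 := by positivity
    have hq : ∀ X : ℝ, X ≤ 2 * (1 + c) ^ 4 → X * (C / (1 + c) ^ 8) ≤ 2 * C / (1 + r) ^ 4 := by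
      intro X hX
      calc X * (C / (1 + c) ^ 8) ≤ 2 * (1 + c) ^ 4 * (C / (1 + c) ^ 8) := by gcongr
        _ = 2 * C / (1 + c) ^ 4 := by field_simp
        _ ≤ _ := by gcongr
    have hN : ‖((r * Real.sinh t : ℝ) : ℂ)‖ ≤ c := by rw [Complex.norm_real, Real.norm_eq_abs]; exact hs
    have hN2 : ‖((c : ℝ) : ℂ)‖ ≤ c := by rw [Complex.norm_real, Real.norm_eq_abs, abs_of_nonneg hc0]
    have hY : 0 ≤ C / (1 + c) ^ 8 := by positivity
    have hpow : c ≤ (1 + c) ^ 4 ∧ c ^ 2 ≤ (1 + c) ^ 4 ∧ 1 ≤ (1 + c) ^ 4 := by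
      have : (1 + c) ^ 4 = 1 + 4 * c + 6 * c ^ 2 + 4 * c ^ 3 + c ^ 4 := by ring
      rw [this]
      have := pow_nonneg hc0 2
      have := pow_nonneg hc0 3
      have := pow_nonneg hc0 4
      refine ⟨?_, ?_, ?_⟩ <;> linarith
    refine ⟨?_, ?_, ?_⟩
    · have := hq 1 (by linarith)
      linarith
    · rw [norm_mul]
      exact (mul_le_mul hN b1 (norm_nonneg _) hc0).trans (hq c (by linarith))
    · refine (norm_add_le _ _).trans ?_
      rw [norm_mul, norm_mul, norm_mul]
      have a1 := mul_le_mul hN2 b1 (norm_nonneg _) hc0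
      have a2 := mul_le_mul hN (mul_le_mul hN b2 (norm_nonneg _) hc0) (by positivity) hc0
      have := hq (c + c ^ 2) (by linarith)
      calc _ ≤ c * (C / (1 + c) ^ 8) + c * (c * (C / (1 + c) ^ 8)) := add_le_add a1 a2
        _ = (c + c ^ 2) * (C / (1 + c) ^ 8) := by ring
        _ ≤ _ := this

noncomputable def mainterm (u h S : ℝ) (n k : ℕ) : ℂ :=
  (Real.sqrt (n / k) : ℂ) * ((gc S (Real.log (n / k) / 2) : ℂ) * Phi (2 * h * Real.sqrt (n * k))) *
    (ec (2 * u * Real.sqrt (n * k)) * (ec (1/8) / Real.sqrt (2 * u * Real.sqrt (n * k))))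

lemma JJ_neg : ∃ C : ℝ, 0 < C ∧ ∀ (u h S : ℝ) (n k : ℕ), 2 ≤ u → 0 < h → h ≤ 1 → 0 ≤ S → 1 ≤ n → 1 ≤ k →
    ‖JJ u h S n (-(k:ℝ)) - mainterm u h S n k‖ ≤
      C * (3 + |Real.log (n / k) / 2|) / (u * k) / (1 + 2 * h * Real.sqrt (n * k)) ^ 4 := by
  obtain ⟨A, hA, hG⟩ := gc_exp_bounds
  obtain ⟨A', hA', hP⟩ := Phi_cosh_bounds
  refine ⟨4000000 * A * A', by positivity, fun u h S n k hu h0 h1 hS hn hk => ?_⟩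
  have hn' : (1:ℝ) ≤ n := by exact_mod_cast hn
  have hk' : (1:ℝ) ≤ k := by exact_mod_cast hk
  have hn0 : (0:ℝ) < n := by linarith
  have hk0 : (0:ℝ) < k := by linarith
  set s0 := Real.log (n / k) / 2 with hs0
  set ρ := Real.sqrt (n * k) with hρ
  have hρ1 : 1 ≤ ρ := by
    rw [hρ, Real.one_le_sqrt]; nlinarith
  have hes : Real.exp s0 = Real.sqrt (n / k) := by
    rw [Real.sqrt_eq_rpow, Real.rpow_def_of_pos (by positivity)]; congr 1; rw [hs0]; ring
  have hek : k * Real.exp s0 = ρ := by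
    rw [hes, hρ, Real.sqrt_div hn0.le, Real.sqrt_mul hn0.le]
    have : Real.sqrt k * Real.sqrt k = k := Real.mul_self_sqrt hk0.le
    have hne : Real.sqrt k ≠ 0 := by positivity
    field_simp
    nlinarith
  have hen : n * Real.exp (-s0) = ρ := by
    rw [Real.exp_neg, hes, hρ, Real.sqrt_div hn0.le, Real.sqrt_mul hn0.le]
    have : Real.sqrt n * Real.sqrt n = n := Real.mul_self_sqrt hn0.le
    have hne : Real.sqrt k ≠ 0 := by positivity
    have hne : Real.sqrt n ≠ 0 := by positivity
    field_simp
    nlinarith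
  have hkap : ∀ t, n * Real.exp (-(s0 + t)) + k * Real.exp (s0 + t) = 2 * ρ * Real.cosh t := by
    intro t
    rw [neg_add, Real.exp_add, Real.exp_add, ← mul_assoc, ← mul_assoc, hek, hen, Real.cosh_eq]; ring
  obtain ⟨G1, G2, dG, dG1, cG2, bG⟩ := hG S s0
  obtain ⟨P1, P2, dP, dP1, cP2, bP⟩ := hP (2 * h * ρ) (by positivity)
  obtain ⟨f1, f2, df, df1, cf2, bf⟩ := prod_bounds hA.le (by positivity) dG dG1 cG2 dP dP1 cP2 bG bP
  have hsp := stat_phase (t1 := |s0| + 1) (lam := 2 * u * ρ) (a := -S - s0) (b := 1 - s0) df df1 cf2 bf (by positivity) (by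
    intro t ht
    have : gc S (s0 + t) = 0 := gc_right (by linarith [neg_abs_le s0])
    rw [this]; simp) (by
    intro t ht
    rw [Function.mem_support] at ht
    by_contra hc
    apply ht
    have : gc S (s0 + t) = 0 := by
      rcases le_or_gt t (-S - s0) with h | h
      · exact gc_left (by linarith)
      · apply gc_right
        by_contra h'
        exact hc ⟨h, by linarith⟩
    rw [this]; simp) (by nlinarith)
  have hJ : JJ u h S n (-(k:ℝ)) = (Real.exp s0 : ℂ) * ∫ t in (-S - s0)..(1 - s0), ((gc S (s0 + t) * Real.exp t : ℝ) : ℂ) * Phi (2 * h * ρ * Real.cosh t) * ec (2 * u * ρ * Real.cosh t) := by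
    rw [JJ_swap, ← intervalIntegral.integral_const_mul]
    have := intervalIntegral.integral_comp_add_left (a := -S - s0) (b := 1 - s0) (fun s : ℝ => ((gc S s * Real.exp s : ℝ) : ℂ) * Phi (h * (n * Real.exp (-s) + k * Real.exp s)) * ec (u * (n * Real.exp (-s) + k * Real.exp s))) s0
    rw [show s0 + (-S - s0) = -S by ring, show s0 + (1 - s0) = 1 by ring] at this
    rw [← this]
    apply intervalIntegral.integral_congr
    intro t _
    simp only
    rw [hkap, Real.exp_add, show h * (2 * ρ * Real.cosh t) = 2 * h * ρ * Real.cosh t by ring, show u * (2 * ρ * Real.cosh t) = 2 * u * ρ * Real.cosh t by ring]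
    push_cast
    ring
  have hM : mainterm u h S n k = (Real.exp s0 : ℂ) * (((gc S (s0 + 0) * Real.exp 0 : ℝ) : ℂ) * Phi (2 * h * ρ * Real.cosh 0) * (ec (2 * u * ρ) * (ec (1/8) / Real.sqrt (2 * u * ρ)))) := by
    unfold mainterm
    rw [hes, add_zero, Real.exp_zero, Real.cosh_zero, mul_one, mul_one]
    ring
  rw [hJ, hM, ← mul_sub, norm_mul, Complex.norm_real, Real.norm_eq_abs, abs_of_pos (Real.exp_pos _)]
  refine (mul_le_mul_of_nonneg_left hsp (Real.exp_pos _).le).trans ?_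
  rw [← hek]
  have hE := Real.exp_pos s0
  have hq : 0 < (1 + 2 * h * (k * Real.exp s0)) ^ 4 := by positivity
  have hE0 := hE.ne'
  have : Real.exp s0 * (1000000 * (4 * A * (A' / (1 + 2 * h * (k * Real.exp s0)) ^ 4)) * (|s0| + 1 + 2) / (2 * u * (k * Real.exp s0))) =
    (1/2) * (4000000 * A * A' * (3 + |s0|) / (u * k) / (1 + 2 * h * (k * Real.exp s0)) ^ 4) := by
    field_simp
    ring
  rw [this]
  have : 0 ≤ 4000000 * A * A' * (3 + |s0|) / (u * k) / (1 + 2 * h * (k * Real.exp s0)) ^ 4 := by positivity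
  linarith

noncomputable def ww (m : ℤ) : ℝ := if m = 0 then 1 else |(m:ℝ)| ^ (-(5/4) : ℝ)

lemma ww_nonneg (m : ℤ) : 0 ≤ ww m := by unfold ww; split_ifs <;> positivity

lemma ww_summable : Summable ww := by
  have h := Real.summable_abs_int_rpow (b := 5/4) (by norm_num)
  have h2 : Summable (fun m : ℤ => if m = 0 then (1:ℝ) else 0) := (hasSum_ite_eq 0 1).summable
  refine Summable.of_nonneg_of_le ww_nonneg ?_ (h.add h2)
  intro m
  unfold ww
  split_ifs with hm
  · have : 0 ≤ |(m:ℝ)| ^ (-(5/4) : ℝ) := by positivity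
    linarith
  · simp

open Classical in
noncomputable def DD (u h S : ℝ) (M : ℕ) (n : ℕ) (m : ℤ) : ℂ :=
  if m < 0 ∧ n * m.natAbs ≤ M then mainterm u h S n m.natAbs else 0

lemma nk_split {n k : ℝ} (hn : 1 ≤ n) (hk : 1 ≤ k) : n * (n * k) ^ (-(5/4):ℝ) = n ^ (-(1/4):ℝ) * k ^ (-(5/4):ℝ) := by
  rw [Real.mul_rpow (by linarith) (by linarith), ← mul_assoc]
  congr 1
  nth_rewrite 1 [← Real.rpow_one n]
  rw [← Real.rpow_add (by linarith)]
  norm_num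

lemma log_bound {n k : ℝ} (hn : 1 ≤ n) (hk : 1 ≤ k) : 3 + |Real.log (n / k) / 2| ≤ 7 * (n * k) ^ (1/8:ℝ) := by
  have hnk : 1 ≤ n * k := by nlinarith
  have h1 := Real.log_le_rpow_div (x := n * k) (ε := 1/8) (by linarith) (by norm_num)
  have h2 : 1 ≤ (n * k) ^ (1/8:ℝ) := Real.one_le_rpow hnk (by norm_num)
  have h3 : |Real.log (n / k)| ≤ Real.log (n * k) := by
    rw [Real.log_div (by linarith) (by linarith), Real.log_mul (by linarith) (by linarith), abs_le]
    have := Real.log_nonneg hn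
    have := Real.log_nonneg hk
    constructor <;> linarith
  rw [abs_div, abs_of_pos (by norm_num : (0:ℝ) < 2)]
  linarith

lemma asm_neg1 : ∃ C : ℝ, 0 < C ∧ ∀ (u h S : ℝ) (n k : ℕ), 2 ≤ u → 0 < h → h ≤ 1 → 0 ≤ S → 1 ≤ n → 1 ≤ k →
    ‖JJ u h S n (-(k:ℝ)) - mainterm u h S n k‖ ≤ C * (1 / (u * h ^ (3/4:ℝ))) * ((n:ℝ) ^ (-(1/4):ℝ) * (k:ℝ) ^ (-(5/4):ℝ)) := by
  obtain ⟨C, hC, hb⟩ := JJ_neg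
  refine ⟨7 * C, by positivity, fun u h S n k hu h0 h1 hS hn hk => (hb u h S n k hu h0 h1 hS hn hk).trans ?_⟩
  have hn' : (1:ℝ) ≤ n := by exact_mod_cast hn
  have hk' : (1:ℝ) ≤ k := by exact_mod_cast hk
  have hl := log_bound hn' hk'
  rw [← nk_split hn' hk']
  set ν : ℝ := n * k with hν
  have hν1 : 1 ≤ ν := by nlinarith
  have hν0 : 0 < ν := by linarith
  have hden : h ^ (3/4:ℝ) * ν ^ (3/8:ℝ) ≤ (1 + 2 * h * Real.sqrt ν) ^ 4 := by
    have e : h ^ (3/4:ℝ) * ν ^ (3/8:ℝ) = (h * Real.sqrt ν) ^ (3/4:ℝ) := by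
      rw [Real.sqrt_eq_rpow, Real.mul_rpow h0.le (by positivity), ← Real.rpow_mul hν0.le]; norm_num
    rw [e]
    have hx : 0 ≤ h * Real.sqrt ν := by positivity
    calc (h * Real.sqrt ν) ^ (3/4:ℝ) ≤ (1 + 2 * h * Real.sqrt ν) ^ (3/4:ℝ) := by
          apply Real.rpow_le_rpow hx _ (by norm_num); nlinarith
      _ ≤ (1 + 2 * h * Real.sqrt ν) ^ (4:ℝ) := by
          apply Real.rpow_le_rpow_of_exponent_le _ (by norm_num); nlinarith
      _ = _ := by norm_cast
  have hk0 : (0:ℝ) < k := by linarith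
  have hn0 : (0:ℝ) < n := by linarith
  have hh : 0 < h ^ (3/4:ℝ) := by positivity
  calc C * (3 + |Real.log (n / k) / 2|) / (u * k) / (1 + 2 * h * Real.sqrt ν) ^ 4
      ≤ C * (7 * ν ^ (1/8:ℝ)) / (u * k) / (h ^ (3/4:ℝ) * ν ^ (3/8:ℝ)) := by gcongr
    _ = 7 * C * (1 / (u * h ^ (3/4:ℝ))) * (n * (ν ^ (1/8:ℝ) / (ν ^ (3/8:ℝ) * ν))) := by
        have hν3 : 0 < ν ^ (3/8:ℝ) := by positivity
        rw [hν] at hν3 ⊢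
        field_simp
    _ = _ := by
        congr 2
        nth_rewrite 3 [← Real.rpow_one ν]
        rw [← Real.rpow_add hν0, ← Real.rpow_sub hν0]
        norm_num

lemma asm_neg2 : ∃ C : ℝ, 0 < C ∧ ∀ (u h S : ℝ) (n k M : ℕ), 2 ≤ u → 0 < h → h ≤ 1 → 0 ≤ S → 1 ≤ n → 1 ≤ k → 1 ≤ M → M ≤ n * k →
    ‖mainterm u h S n k‖ ≤ C * (1 / (Real.sqrt u * h ^ 8 * (M:ℝ) ^ (7/2:ℝ))) * ((n:ℝ) ^ (-(1/4):ℝ) * (k:ℝ) ^ (-(5/4):ℝ)) := by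
  obtain ⟨F1, F2, C, hC, d1, d2, cF2, hb⟩ := Phi_bounds
  refine ⟨2 * C, by positivity, fun u h S n k M hu h0 h1 hS hn hk hM hMn => ?_⟩
  have hn' : (1:ℝ) ≤ n := by exact_mod_cast hn
  have hk' : (1:ℝ) ≤ k := by exact_mod_cast hk
  have hM' : (1:ℝ) ≤ M := by exact_mod_cast hM
  have hMn' : (M:ℝ) ≤ n * k := by exact_mod_cast hMn
  rw [← nk_split hn' hk']
  unfold mainterm
  have hsq : Real.sqrt (n / k) = n / Real.sqrt (n * k) := by
    have : (n:ℝ) / k = n ^ 2 / (n * k) := by field_simp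
    rw [this, Real.sqrt_div (by positivity), Real.sqrt_sq (by linarith)]
  rw [hsq]
  set ν : ℝ := n * k with hν
  have hν1 : 1 ≤ ν := by nlinarith
  have hν0 : 0 < ν := by linarith
  rw [norm_mul, norm_mul, norm_mul, norm_mul, norm_div, ec_norm, ec_norm, one_mul, Complex.norm_real, Complex.norm_real, Complex.norm_real,
    Real.norm_eq_abs, Real.norm_eq_abs, Real.norm_eq_abs, abs_of_nonneg (gc_nonneg _ _), abs_of_nonneg (Real.sqrt_nonneg _), abs_of_nonneg (by positivity)]
  have hP : ‖Phi (2 * h * Real.sqrt ν)‖ ≤ C / (h ^ 8 * ν ^ 4) := by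
    refine (hb _).1.trans ?_
    have hp : 0 < h * Real.sqrt ν := by positivity
    rw [abs_of_nonneg (by positivity)]
    have : h ^ 8 * ν ^ 4 = (h * Real.sqrt ν) ^ 8 := by
      have h8 : Real.sqrt ν ^ 8 = ν ^ 4 := by
        calc Real.sqrt ν ^ 8 = (Real.sqrt ν ^ 2) ^ 4 := by ring
          _ = _ := by rw [Real.sq_sqrt hν0.le]
      rw [mul_pow h, h8]
    rw [this]
    gcongr
    nlinarith
  have hsu : 0 < Real.sqrt u := Real.sqrt_pos.2 (by linarith)
  have hsν : 0 < Real.sqrt (Real.sqrt ν) := by positivity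
  have hS3 : Real.sqrt u * Real.sqrt (Real.sqrt ν) ≤ Real.sqrt (2 * u * Real.sqrt ν) := by
    rw [← Real.sqrt_mul (by linarith)]
    apply Real.sqrt_le_sqrt
    have : 0 ≤ u * Real.sqrt ν := by positivity
    linarith
  have hfin : (M:ℝ) ^ (7/2:ℝ) ≤ ν ^ (7/2:ℝ) := by gcongr
  calc n / Real.sqrt ν * (gc S (Real.log (n / k) / 2) * ‖Phi (2 * h * Real.sqrt ν)‖) * (1 / Real.sqrt (2 * u * Real.sqrt ν))
      ≤ n / Real.sqrt ν * (2 * (C / (h ^ 8 * ν ^ 4))) * (1 / (Real.sqrt u * Real.sqrt (Real.sqrt ν))) := by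
        gcongr
        exact gc_le _ _
    _ = 2 * C * (1 / (Real.sqrt u * h ^ 8)) * (n * (1 / (ν ^ (1/2:ℝ) * ν ^ (4:ℝ) * ν ^ (1/4:ℝ)))) := by
        rw [show Real.sqrt (Real.sqrt ν) = ν ^ (1/4:ℝ) by
          rw [Real.sqrt_eq_rpow, Real.sqrt_eq_rpow, ← Real.rpow_mul hν0.le]; norm_num, Real.sqrt_eq_rpow ν,
          show ν ^ (4:ℝ) = ν ^ 4 by norm_cast]
        have : 0 < ν ^ (1/2:ℝ) := by positivity
        have : 0 < ν ^ (1/4:ℝ) := by positivity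
        field_simp
    _ = 2 * C * (1 / (Real.sqrt u * h ^ 8)) * (n * (ν ^ (-(5/4):ℝ) * (1 / ν ^ (7/2:ℝ)))) := by
        congr 2
        have e1 : ∀ a : ℝ, 1 / ν ^ a = ν ^ (-a) := fun a => by rw [Real.rpow_neg hν0.le, one_div]
        rw [← Real.rpow_add hν0, ← Real.rpow_add hν0, e1, e1, ← Real.rpow_add hν0]
        norm_num
    _ ≤ 2 * C * (1 / (Real.sqrt u * h ^ 8)) * (n * (ν ^ (-(5/4):ℝ) * (1 / (M:ℝ) ^ (7/2:ℝ)))) := by gcongr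
    _ = _ := by
        have : 0 < (M:ℝ) ^ (7/2:ℝ) := by positivity
        field_simp

noncomputable def betaE (u h S : ℝ) (M : ℕ) : ℝ := (S + 1) / u ^ 2 + 1 / (u * h ^ (3/4:ℝ)) + 1 / (Real.sqrt u * h ^ 8 * (M:ℝ) ^ (7/2:ℝ))

lemma asm_all : ∃ C : ℝ, 0 < C ∧ ∀ (u h S : ℝ) (n M : ℕ) (m : ℤ), 2 ≤ u → 0 < h → h ≤ 1 → 0 ≤ S → 1 ≤ n → 1 ≤ M → 
    ‖JJ u h S n m - DD u h S M n m‖ ≤ C * betaE u h S M * ((n:ℝ) ^ (-(1/4):ℝ) * ww m) := by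
  obtain ⟨C1, hC1, b1⟩ := JJ_pos_bound
  obtain ⟨C2, hC2, b2⟩ := JJ_zero_bound
  obtain ⟨C3, hC3, b3⟩ := asm_neg1
  obtain ⟨C4, hC4, b4⟩ := asm_neg2
  refine ⟨C1 + C2 + C3 + C4, by positivity, fun u h S n M m hu h0 h1 hS hn hM => ?_⟩
  have hn' : (1:ℝ) ≤ n := by exact_mod_cast hn
  have hM' : (1:ℝ) ≤ M := by exact_mod_cast hM
  set q1 := (S + 1) / u ^ 2 with hq1
  set q2 := 1 / (u * h ^ (3/4:ℝ)) with hq2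
  set q3 := 1 / (Real.sqrt u * h ^ 8 * (M:ℝ) ^ (7/2:ℝ)) with hq3
  have p1 : 0 ≤ q1 := by positivity
  have p2 : 0 ≤ q2 := by positivity
  have p3 : 0 ≤ q3 := by positivity
  have hbe : betaE u h S M = q1 + q2 + q3 := rfl
  rw [hbe]
  have hww := ww_nonneg m
  have hX : 0 ≤ (n:ℝ) ^ (-(1/4):ℝ) * ww m := by positivity
  rcases lt_trichotomy m 0 with hm | hm | hm
  · obtain ⟨k, rfl⟩ : ∃ k : ℕ, m = -(k:ℤ) := ⟨m.natAbs, by omega⟩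
    have hk : 1 ≤ k := by omega
    have hk' : (1:ℝ) ≤ k := by exact_mod_cast hk
    have hw : ww (-(k:ℤ)) = (k:ℝ) ^ (-(5/4):ℝ) := by
      unfold ww; rw [if_neg (by omega)]; push_cast; rw [abs_neg, abs_of_nonneg (by linarith)]
    have e3 := b3 u h S n k hu h0 h1 hS hn hk
    rw [hw] at hX ⊢
    have hna : (-(k:ℤ)).natAbs = k := by omega
    push_cast
    unfold DD
    rw [hna]
    split_ifs with hc
    · refine e3.trans ?_
      gcongr
      · linarith
      · linarith
    · have hlt : M ≤ n * k := by
        by_contra h'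
        exact hc ⟨by omega, by omega⟩
      have e4 := b4 u h S n k M hu h0 h1 hS hn hk hM hlt
      rw [sub_zero]
      have : ‖JJ u h S n (-(k:ℝ))‖ ≤ ‖JJ u h S n (-(k:ℝ)) - mainterm u h S n k‖ + ‖mainterm u h S n k‖ := by
        have := norm_add_le (JJ u h S n (-(k:ℝ)) - mainterm u h S n k) (mainterm u h S n k)
        rwa [sub_add_cancel] at this
      refine this.trans ((add_le_add e3 e4).trans ?_)
      rw [← add_mul]
      apply mul_le_mul_of_nonneg_right _ hX
      have : 0 ≤ C1 * (q1 + q2 + q3) := by positivity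
      have : 0 ≤ C2 * (q1 + q2 + q3) := by positivity
      have : 0 ≤ C3 * (q1 + q3) := by positivity
      have : 0 ≤ C4 * (q1 + q2) := by positivity
      linarith
  · subst hm
    have : DD u h S M n 0 = 0 := by unfold DD; rw [if_neg (by simp)]
    rw [this, sub_zero]
    have e := b2 u h S n hu h0 h1 hS hn
    push_cast
    refine e.trans ?_
    have hw : ww 0 = 1 := by unfold ww; simp
    rw [hw, mul_one]
    have h3 : 1 / (n:ℝ) ^ 2 ≤ (n:ℝ) ^ (-(1/4):ℝ) := by
      rw [Real.rpow_neg (by linarith), one_div]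
      apply inv_anti₀ (by positivity)
      calc (n:ℝ) ^ (1/4:ℝ) ≤ (n:ℝ) ^ (2:ℝ) := Real.rpow_le_rpow_of_exponent_le hn' (by norm_num)
        _ = _ := by norm_cast
    rw [mul_div_assoc, ← hq1]
    gcongr
    · linarith
    · linarith
  · obtain ⟨k, rfl⟩ : ∃ k : ℕ, m = (k:ℤ) := ⟨m.natAbs, by omega⟩
    have hk : 1 ≤ k := by omega
    have hk' : (1:ℝ) ≤ k := by exact_mod_cast hk
    have : DD u h S M n k = 0 := by unfold DD; rw [if_neg (by omega)]
    rw [this, sub_zero]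
    have hw : ww (k:ℤ) = (k:ℝ) ^ (-(5/4):ℝ) := by
      unfold ww; rw [if_neg (by omega)]; push_cast; rw [abs_of_nonneg (by linarith)]
    have e := b1 u h S k n hu h0 h1 hS hn hk'
    push_cast
    refine e.trans ?_
    rw [hw] at hX ⊢
    rw [← nk_split hn' hk']
    have h3 : 1 / ((k:ℝ) * Real.sqrt (n * k)) ≤ n * (n * k:ℝ) ^ (-(5/4):ℝ) := by
      have hν : (0:ℝ) < n * k := by positivity
      have hν1 : (1:ℝ) ≤ n * k := by nlinarith
      have : 1 / ((k:ℝ) * Real.sqrt (n * k)) = n * (n * k:ℝ) ^ (-(3/2):ℝ) := by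
        rw [show (-(3/2):ℝ) = -1 + -(1/2) by norm_num, Real.rpow_add hν, Real.rpow_neg hν.le (1/2), ← Real.sqrt_eq_rpow, Real.rpow_neg_one]
        field_simp
      rw [this]
      gcongr ?_ * ?_
      exact Real.rpow_le_rpow_of_exponent_le hν1 (by norm_num)
    rw [mul_div_assoc, ← hq1]
    gcongr
    · linarith
    · linarith

lemma DD_sum {u h S : ℝ} {M n : ℕ} (hn : 1 ≤ n) :
    HasSum (fun m : ℤ => DD u h S M n m) (∑ k ∈ Finset.Icc 1 M, if n * k ≤ M then mainterm u h S n k else 0) := by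
  have hinj : Set.InjOn (fun k : ℕ => -(k:ℤ)) (Finset.Icc 1 M) := by
    intro a _ b _ hab
    simpa using hab
  have h1 : ∑ k ∈ Finset.Icc 1 M, (if n * k ≤ M then mainterm u h S n k else 0) = ∑ m ∈ (Finset.Icc 1 M).image (fun k : ℕ => -(k:ℤ)), DD u h S M n m := by
    rw [Finset.sum_image hinj]
    apply Finset.sum_congr rfl
    intro k hk
    have := (Finset.mem_Icc.1 hk).1
    unfold DD
    have hna : (-(k:ℤ)).natAbs = k := by omega
    rw [hna]
    by_cases hc : n * k ≤ M
    · rw [if_pos hc, if_pos ⟨by omega, hc⟩]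
    · rw [if_neg hc, if_neg (by tauto)]
  rw [h1]
  apply hasSum_sum_of_ne_finset_zero
  intro m hm
  unfold DD
  rw [if_neg]
  rintro ⟨h1, h2⟩
  apply hm
  rw [Finset.mem_image]
  refine ⟨m.natAbs, Finset.mem_Icc.2 ⟨by omega, ?_⟩, by omega⟩
  nlinarith

lemma asm_delta (ε : ℝ) (hε : 0 < ε) : ∃ C : ℝ, 0 < C ∧ ∀ (u h S : ℝ) (M : ℕ), 2 ≤ u → 0 < h → h ≤ 1 → 0 ≤ S → 1 ≤ M →
    |DirichletDelta (u ^ 2) / u - ∑ n ∈ Finset.Icc 1 M, 1 / (Real.pi * n) * (∑ k ∈ Finset.Icc 1 M, if n * k ≤ M then mainterm u h S n k else 0).im|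
     ≤ C * (u ^ ε * (1 / u + h + Real.exp (-S)) + betaE u h S M) := by
  obtain ⟨C1, hC1, b1⟩ := delta_series2 ε hε
  obtain ⟨C2, hC2, b2⟩ := asm_all
  set Wc := ∑' m, ww m with hWc
  have hWc0 : 0 ≤ Wc := tsum_nonneg ww_nonneg
  have hNs : Summable (fun n : ℕ => (n:ℝ) ^ (-(5/4):ℝ)) := Real.summable_nat_rpow.2 (by norm_num)
  set Nc := ∑' n : ℕ, (n:ℝ) ^ (-(5/4):ℝ) with hNc
  have hNc0 : 0 ≤ Nc := tsum_nonneg fun n => by positivity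
  refine ⟨C1 + C2 * Wc * Nc, by positivity, fun u h S M hu h0 h1 hS hM => ?_⟩
  have hβ : 0 ≤ betaE u h S M := by unfold betaE; positivity
  have hEn : ∀ n : ℕ, 1 ≤ n → ∀ m : ℤ, ‖JJ u h S n m - DD u h S M n m‖ ≤ C2 * betaE u h S M * (n:ℝ) ^ (-(1/4):ℝ) * ww m := by
    intro n hn m
    have := b2 u h S n M m hu h0 h1 hS hn hM
    rwa [← mul_assoc] at this
  have hEs : ∀ n : ℕ, 1 ≤ n → Summable (fun m : ℤ => JJ u h S n m - DD u h S M n m) := fun n hn =>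
    Summable.of_norm_bounded (ww_summable.mul_left _) (hEn n hn)
  have hJs : ∀ n : ℕ, 1 ≤ n → Summable (fun m : ℤ => JJ u h S n m) := by
    intro n hn
    have := (hEs n hn).add (DD_sum (u := u) (h := h) (S := S) (M := M) hn).summable
    simpa using this
  obtain ⟨W, hW1, hW2⟩ := b1 u h S hu h0 h1 hS hJs
  set dn : ℕ → ℂ := fun n => ∑ k ∈ Finset.Icc 1 M, if n * k ≤ M then mainterm u h S n k else 0 with hdn
  have hd2 : HasSum (fun n : ℕ => 1 / (Real.pi * n) * (dn n).im) (∑ n ∈ Finset.Icc 1 M, 1 / (Real.pi * n) * (dn n).im) := by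
    apply hasSum_sum_of_ne_finset_zero
    intro n hn
    rcases Nat.eq_zero_or_pos n with h | h
    · subst h; simp
    · have : dn n = 0 := by
        rw [hdn]
        apply Finset.sum_eq_zero
        intro k hk
        have := (Finset.mem_Icc.1 hk).1
        rw [if_neg]
        intro hc
        exact hn (Finset.mem_Icc.2 ⟨h, by nlinarith⟩)
      rw [this]; simp
  have hdiff := hW2.sub hd2
  have hterm : ∀ n : ℕ, ‖1 / (Real.pi * n) * (∑' m : ℤ, JJ u h S n m).im - 1 / (Real.pi * n) * (dn n).im‖ ≤ C2 * betaE u h S M * Wc * (n:ℝ) ^ (-(5/4):ℝ) := by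
    intro n
    rcases Nat.eq_zero_or_pos n with h | hn
    · subst h; simp
    · have hn' : (1:ℝ) ≤ n := by exact_mod_cast hn
      rw [← mul_sub, ← Complex.sub_im]
      have hE : (∑' m : ℤ, JJ u h S n m) - dn n = ∑' m : ℤ, (JJ u h S n m - DD u h S M n m) := by
        rw [(hJs n hn).tsum_sub (DD_sum hn).summable, (DD_sum hn).tsum_eq]
      have hnb : ‖∑' m : ℤ, (JJ u h S n m - DD u h S M n m)‖ ≤ C2 * betaE u h S M * (n:ℝ) ^ (-(1/4):ℝ) * Wc := by
        apply tsum_of_norm_bounded _ (hEn n hn)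
        exact ww_summable.hasSum.mul_left _
      rw [hE, norm_mul, Real.norm_eq_abs, Real.norm_eq_abs]
      have h2 := (Complex.abs_im_le_norm _).trans hnb
      have h3 : |1 / (Real.pi * n)| ≤ (n:ℝ)⁻¹ := by
        rw [abs_of_nonneg (by positivity), one_div]
        apply inv_anti₀ (by linarith)
        have := Real.pi_gt_three
        nlinarith
      calc _ ≤ (n:ℝ)⁻¹ * (C2 * betaE u h S M * (n:ℝ) ^ (-(1/4):ℝ) * Wc) := by gcongr
        _ = C2 * betaE u h S M * Wc * ((n:ℝ) ^ (-1:ℝ) * (n:ℝ) ^ (-(1/4):ℝ)) := by rw [Real.rpow_neg_one]; ring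
        _ = _ := by
          rw [← Real.rpow_add (by linarith)]; norm_num
  have hfin : ‖W - ∑ n ∈ Finset.Icc 1 M, 1 / (Real.pi * n) * (dn n).im‖ ≤ C2 * betaE u h S M * Wc * Nc := by
    rw [← hdiff.tsum_eq]
    exact tsum_of_norm_bounded (hNs.hasSum.mul_left _) hterm
  rw [Real.norm_eq_abs] at hfin
  have := abs_add_le (DirichletDelta (u ^ 2) / u - W) (W - ∑ n ∈ Finset.Icc 1 M, 1 / (Real.pi * n) * (dn n).im)
  rw [sub_add_sub_cancel] at this
  refine this.trans ((add_le_add hW1 hfin).trans ?_)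
  have q1 : 0 ≤ u ^ ε * (1 / u + h + Real.exp (-S)) := by positivity
  have q2 : 0 ≤ C1 * betaE u h S M := by positivity
  have q3 : 0 ≤ C2 * Wc * Nc * (u ^ ε * (1 / u + h + Real.exp (-S))) := by positivity
  nlinarith

noncomputable def dt (S : ℝ) (ν : ℕ) : ℝ := ∑ p ∈ ν.divisorsAntidiagonal, gc S (Real.log ((p.1:ℝ) / p.2) / 2)

lemma card_anti (ν : ℕ) : ν.divisorsAntidiagonal.card = divfun ν := by
  unfold divfun
  rw [← Nat.map_div_right_divisors, Finset.card_map]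

lemma dt_abs (S : ℝ) (ν : ℕ) : |dt S ν| ≤ 2 * divfun ν := by
  unfold dt
  rw [abs_of_nonneg (Finset.sum_nonneg fun p _ => gc_nonneg _ _), ← card_anti, mul_comm, ← nsmul_eq_mul]
  apply Finset.sum_le_card_nsmul
  intro p _; exact gc_le _ _

lemma dt_eq {S : ℝ} {ν : ℕ} (h : Real.log ν / 2 + 1 ≤ S) : dt S ν = divfun ν := by
  have h1 : dt S ν = ∑ p ∈ ν.divisorsAntidiagonal, gz (Real.log ((p.1:ℝ) / p.2) / 2) := by
    unfold dt
    apply Finset.sum_congr rfl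
    intro p hp
    obtain ⟨hpν, hν⟩ := Nat.mem_divisorsAntidiagonal.1 hp
    have p1 : 1 ≤ p.1 := Nat.one_le_iff_ne_zero.2 fun h => hν (by rw [← hpν, h, zero_mul])
    have p2 : 1 ≤ p.2 := Nat.one_le_iff_ne_zero.2 fun h => hν (by rw [← hpν, h, mul_zero])
    have p1' : (1:ℝ) ≤ p.1 := by exact_mod_cast p1
    have p2' : (1:ℝ) ≤ p.2 := by exact_mod_cast p2
    unfold gc
    rw [Real.smoothTransition.one_of_one_le, mul_one]
    rw [Real.log_div (by linarith) (by linarith)]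
    rw [← hpν] at h
    push_cast at h
    rw [Real.log_mul (by linarith) (by linarith)] at h
    have := Real.log_nonneg p1'
    linarith
  have h2 : dt S ν = ∑ p ∈ ν.divisorsAntidiagonal, gz (-(Real.log ((p.1:ℝ) / p.2) / 2)) := by
    rw [h1, ← Nat.map_swap_divisorsAntidiagonal, Finset.sum_map]
    rw [Nat.map_swap_divisorsAntidiagonal]
    apply Finset.sum_congr rfl
    intro p hp
    simp only [Equiv.coe_toEmbedding, Equiv.prodComm_apply, Prod.fst_swap, Prod.snd_swap]
    congr 1
    rw [← inv_div (p.1:ℝ) p.2, Real.log_inv]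
    ring
  have h3 : dt S ν + dt S ν = 2 * divfun ν := by
    nth_rewrite 1 [h1]
    rw [h2, ← Finset.sum_add_distrib]
    simp_rw [gz_add]
    rw [Finset.sum_const, card_anti]; simp; ring
  linarith

lemma regroup (M : ℕ) (f : ℕ → ℕ → ℝ) : ∑ n ∈ Finset.Icc 1 M, ∑ k ∈ Finset.Icc 1 M, (if n * k ≤ M then f n k else 0) =
    ∑ ν ∈ Finset.Icc 1 M, ∑ p ∈ ν.divisorsAntidiagonal, f p.1 p.2 := by
  rw [← Finset.sum_product', ← Finset.sum_filter]
  rw [← Finset.sum_fiberwise_of_maps_to (s := (Finset.Icc 1 M ×ˢ Finset.Icc 1 M).filter (fun x => x.1 * x.2 ≤ M)) (t := Finset.Icc 1 M) (g := fun x => x.1 * x.2)]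
  · apply Finset.sum_congr rfl
    intro ν hν
    apply Finset.sum_congr _ (fun _ _ => rfl)
    ext ⟨a, b⟩
    simp only [Finset.mem_filter, Finset.mem_product, Finset.mem_Icc, Nat.mem_divisorsAntidiagonal] at hν ⊢
    constructor
    · rintro ⟨_, h⟩; exact ⟨h, by omega⟩
    · rintro ⟨h, _⟩
      have ha : 1 ≤ a := Nat.one_le_iff_ne_zero.2 fun h' => by subst h'; omega
      have hb : 1 ≤ b := Nat.one_le_iff_ne_zero.2 fun h' => by subst h'; omega
      refine ⟨⟨⟨⟨ha, by nlinarith⟩, ⟨hb, by nlinarith⟩⟩, by omega⟩, h⟩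
  · rintro ⟨a, b⟩ hx
    simp only [Finset.mem_filter, Finset.mem_product, Finset.mem_Icc] at hx ⊢
    exact ⟨Nat.one_le_iff_ne_zero.2 (by simp; omega), hx.2⟩

lemma main_im {u h S : ℝ} {n k ν : ℕ} (hn : 1 ≤ n) (hk : 1 ≤ k) (hν : n * k = ν) (hu : 0 < u) :
    1 / (Real.pi * n) * (mainterm u h S n k).im = gc S (Real.log ((n:ℝ) / k) / 2) *
      (1 / (Real.sqrt 2 * Real.pi) * (1 / Real.sqrt u) * (ν:ℝ) ^ (-(3/4):ℝ) * (Phi (2 * h * Real.sqrt ν) * ec (2 * u * Real.sqrt ν + 1/8)).im) := by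
  have hn' : (1:ℝ) ≤ n := by exact_mod_cast hn
  have hk' : (1:ℝ) ≤ k := by exact_mod_cast hk
  have hsq : Real.sqrt (n / k) = n / Real.sqrt (n * k) := by
    have : (n:ℝ) / k = n ^ 2 / (n * k) := by field_simp
    rw [this, Real.sqrt_div (by positivity), Real.sqrt_sq (by linarith)]
  have hν' : (n:ℝ) * k = ν := by exact_mod_cast hν
  unfold mainterm
  rw [hsq, hν']
  have hν1 : (1:ℝ) ≤ ν := by rw [← hν']; nlinarith
  have hν0 : (0:ℝ) < ν := by linarith
  have e : ((n / Real.sqrt ν : ℝ) : ℂ) * ((gc S (Real.log (n / k) / 2) : ℂ) * Phi (2 * h * Real.sqrt ν)) *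
    (ec (2 * u * Real.sqrt ν) * (ec (1/8) / Real.sqrt (2 * u * Real.sqrt ν))) = 
    ((n / Real.sqrt ν * gc S (Real.log (n / k) / 2) / Real.sqrt (2 * u * Real.sqrt ν) : ℝ) : ℂ) * (Phi (2 * h * Real.sqrt ν) * ec (2 * u * Real.sqrt ν + 1/8)) := by
    rw [ec_add]; push_cast; ring
  rw [e, Complex.im_ofReal_mul]
  have hsq2 : Real.sqrt (2 * u * Real.sqrt ν) = Real.sqrt 2 * Real.sqrt u * ν ^ (1/4:ℝ) := by
    rw [Real.sqrt_mul (by positivity), Real.sqrt_mul (by positivity)]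
    congr 1
    rw [Real.sqrt_eq_rpow, Real.sqrt_eq_rpow, ← Real.rpow_mul hν0.le]; norm_num
  have h34 : (ν:ℝ) ^ (-(3/4):ℝ) = 1 / (Real.sqrt ν * (ν:ℝ) ^ (1/4:ℝ)) := by
    rw [Real.sqrt_eq_rpow, ← Real.rpow_add hν0, Real.rpow_neg hν0.le, one_div]; norm_num
  rw [hsq2, h34]
  have : 0 < Real.sqrt u := by positivity
  have : 0 < (ν:ℝ) ^ (1/4:ℝ) := by positivity
  have : 0 < Real.sqrt ν := by positivity
  have := Real.pi_pos
  field_simp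

noncomputable def vterm (u h S : ℝ) (ν : ℕ) : ℝ := dt S ν * (1 / (Real.sqrt 2 * Real.pi) * (1 / Real.sqrt u) * (ν:ℝ) ^ (-(3/4):ℝ) * (Phi (2 * h * Real.sqrt ν) * ec (2 * u * Real.sqrt ν + 1/8)).im)

lemma main_sum {u h S : ℝ} {M : ℕ} (hu : 0 < u) :
    ∑ n ∈ Finset.Icc 1 M, 1 / (Real.pi * n) * (∑ k ∈ Finset.Icc 1 M, if n * k ≤ M then mainterm u h S n k else 0).im =
    ∑ ν ∈ Finset.Icc 1 M, vterm u h S ν := by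
  have h1 : ∀ n ∈ Finset.Icc 1 M, 1 / (Real.pi * n) * (∑ k ∈ Finset.Icc 1 M, if n * k ≤ M then mainterm u h S n k else 0).im = 
      ∑ k ∈ Finset.Icc 1 M, (if n * k ≤ M then 1 / (Real.pi * n) * (mainterm u h S n k).im else 0) := by
    intro n _
    rw [Complex.im_sum, Finset.mul_sum]
    apply Finset.sum_congr rfl
    intro k _
    split_ifs <;> simp
  rw [Finset.sum_congr rfl h1, regroup M (fun n k => 1 / (Real.pi * n) * (mainterm u h S n k).im)]
  apply Finset.sum_congr rfl
  intro ν _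
  unfold vterm dt
  rw [Finset.sum_mul]
  apply Finset.sum_congr rfl
  intro p hp
  obtain ⟨hpν, hν⟩ := Nat.mem_divisorsAntidiagonal.1 hp
  have p1 : 1 ≤ p.1 := Nat.one_le_iff_ne_zero.2 fun h => hν (by rw [← hpν, h, zero_mul])
  have p2 : 1 ≤ p.2 := Nat.one_le_iff_ne_zero.2 fun h => hν (by rw [← hpν, h, mul_zero])
  exact main_im p1 p2 hpν hu

lemma R1_form {u y : ℝ} (hu : 0 < u) : R1 y (u ^ 2) / u = ∑ ν ∈ Finset.Icc 1 ⌊y⌋₊,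
    (divfun ν : ℝ) * (1 / (Real.sqrt 2 * Real.pi) * (1 / Real.sqrt u) * (ν:ℝ) ^ (-(3/4):ℝ) * (ec (2 * u * Real.sqrt ν + 1/8)).im) := by
  unfold R1
  rw [Finset.mul_sum, Finset.sum_div]
  apply Finset.sum_congr rfl
  intro ν _
  have h1 : (u ^ 2) ^ ((1:ℝ)/4) = Real.sqrt u := by
    rw [Real.sqrt_eq_rpow, ← Real.rpow_natCast, ← Real.rpow_mul hu.le]; norm_num
  have h2 : Real.cos (4 * Real.pi * Real.sqrt (ν * u ^ 2) - Real.pi / 4) = (ec (2 * u * Real.sqrt ν + 1/8)).im := by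
    rw [ec_im, Real.sqrt_mul (by positivity), Real.sqrt_sq hu.le, ← Real.cos_sub_pi_div_two]
    congr 1; ring
  rw [h1, h2, Real.rpow_neg (by positivity)]
  have h3 : Real.sqrt u / u = 1 / Real.sqrt u := by
    rw [div_eq_div_iff hu.ne' (by positivity), one_mul, Real.mul_self_sqrt hu.le]
  rw [← h3]
  ring

lemma err_numeric : ∃ C : ℝ, 0 < C ∧ ∀ T u h S : ℝ, ∀ M : ℕ, 10 ≤ T → Real.sqrt T ≤ u → u ≤ Real.sqrt (2 * T) → 
    h = T ^ (-(26/100):ℝ) → S = Real.log 10 - Real.log h → M = ⌊T ^ (3/4:ℝ)⌋₊ →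
    Real.sqrt u * (u ^ (1/100:ℝ) * (1 / u + h + Real.exp (-S)) + betaE u h S M) ≤ C * T ^ (-(1/200):ℝ) := by
  refine ⟨1000, by norm_num, fun T u h S M hT hu1 hu2 hh hS hM => ?_⟩
  have hT0 : 0 < T := by linarith
  have hT1 : 1 ≤ T := by linarith
  have hp : ∀ a : ℝ, 0 < T ^ a := fun a => Real.rpow_pos_of_pos hT0 a
  have hmono : ∀ a : ℝ, a ≤ -(1/200) → T ^ a ≤ T ^ (-(1/200):ℝ) := fun a ha => Real.rpow_le_rpow_of_exponent_le hT1 ha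
  have h0 : 0 < h := by rw [hh]; exact hp _
  have hsT : 0 < Real.sqrt T := Real.sqrt_pos.2 hT0
  have hu0 : 0 < u := by linarith
  have hsq : Real.sqrt T = T ^ (1/2:ℝ) := Real.sqrt_eq_rpow T
  have hu2' : u ≤ 2 * T ^ (1/2:ℝ) := by
    rw [← hsq]
    refine hu2.trans ?_
    rw [Real.sqrt_le_left (by positivity), mul_pow, Real.sq_sqrt hT0.le]
    linarith
  have hupow : ∀ a : ℝ, 0 ≤ a → a ≤ 1 → u ^ a ≤ 2 * T ^ (a/2) := by
    intro a ha ha1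
    calc u ^ a ≤ (2 * T ^ (1/2:ℝ)) ^ a := Real.rpow_le_rpow hu0.le hu2' ha
      _ = 2 ^ a * T ^ (a/2) := by
        rw [Real.mul_rpow (by norm_num) (hp _).le, ← Real.rpow_mul hT0.le]; congr 2; ring
      _ ≤ 2 * T ^ (a/2) := by
        gcongr
        calc (2:ℝ) ^ a ≤ 2 ^ (1:ℝ) := Real.rpow_le_rpow_of_exponent_le (by norm_num) ha1
          _ = 2 := by norm_num
  have hsu : Real.sqrt u ≤ 2 * T ^ (1/4:ℝ) := by
    rw [Real.sqrt_eq_rpow]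
    have := hupow (1/2) (by norm_num) (by norm_num)
    norm_num at this ⊢
    exact this
  have hui : 1 / u ≤ T ^ (-(1/2):ℝ) := by
    rw [Real.rpow_neg hT0.le, ← hsq, one_div]
    exact inv_anti₀ hsT hu1
  have hexp : Real.exp (-S) ≤ h := by
    rw [hS, neg_sub, Real.exp_sub, Real.exp_log h0, Real.exp_log (by norm_num)]
    linarith
  have hS1 : S + 1 ≤ 11 * T ^ (1/2:ℝ) := by
    have e1 := Real.log_le_sub_one_of_pos (show (0:ℝ) < 10 by norm_num)
    have e2 := Real.log_le_rpow_div hT0.le (show (0:ℝ) < 1/2 by norm_num)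
    rw [hS, hh, Real.log_rpow hT0]
    have : 1 ≤ T ^ (1/2:ℝ) := Real.one_le_rpow hT1 (by norm_num)
    have := Real.log_nonneg hT1
    linarith
  have E1 : Real.sqrt u * (u ^ (1/100:ℝ) * (1 / u + h + Real.exp (-S))) ≤ 12 * T ^ (-(1/200):ℝ) := by
    have e3 : 1 / u + h + Real.exp (-S) ≤ 3 * T ^ (-(26/100):ℝ) := by
      have : T ^ (-(1/2):ℝ) ≤ T ^ (-(26/100):ℝ) := Real.rpow_le_rpow_of_exponent_le hT1 (by norm_num)
      rw [hh] at hexp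
      rw [hh]
      linarith
    have e4 := hupow (1/100) (by norm_num) (by norm_num)
    calc _ ≤ 2 * T ^ (1/4:ℝ) * (2 * T ^ (1/100/2:ℝ) * (3 * T ^ (-(26/100):ℝ))) := by gcongr
      _ = 12 * (T ^ (1/4:ℝ) * T ^ (1/100/2:ℝ) * T ^ (-(26/100):ℝ)) := by ring
      _ = 12 * T ^ (-(1/200):ℝ) := by rw [← Real.rpow_add hT0, ← Real.rpow_add hT0]; norm_num
  have E2 : Real.sqrt u * ((S + 1) / u ^ 2) ≤ 22 * T ^ (-(1/200):ℝ) := by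
    have hu3 : T ≤ u ^ 2 := by
      have := Real.sq_sqrt hT0.le
      nlinarith
    calc _ ≤ 2 * T ^ (1/4:ℝ) * (11 * T ^ (1/2:ℝ) / T) := by
          have hSp : 0 ≤ S + 1 := by
            have := Real.log_nonneg hT1
            have := Real.log_nonneg (show (1:ℝ) ≤ 10 by norm_num)
            rw [hS, hh, Real.log_rpow hT0]; linarith
          have := hp (1/4)
          exact mul_le_mul hsu (div_le_div₀ (by positivity) hS1 hT0 hu3) (by positivity) (by positivity)
      _ = 22 * (T ^ (1/4:ℝ) * T ^ (1/2:ℝ) * T ^ (-1:ℝ)) := by rw [Real.rpow_neg_one]; ring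
      _ = 22 * T ^ (-(1/4):ℝ) := by rw [← Real.rpow_add hT0, ← Real.rpow_add hT0]; norm_num
      _ ≤ _ := by have := hmono (-(1/4)) (by norm_num); linarith
  have E3 : Real.sqrt u * (1 / (u * h ^ (3/4:ℝ))) ≤ 2 * T ^ (-(1/200):ℝ) := by
    have : 1 / (u * h ^ (3/4:ℝ)) = 1 / u * T ^ (195/1000:ℝ) := by
      rw [hh, ← Real.rpow_mul hT0.le, one_div, mul_inv, ← Real.rpow_neg hT0.le]
      norm_num
    rw [this]
    calc _ ≤ 2 * T ^ (1/4:ℝ) * (T ^ (-(1/2):ℝ) * T ^ (195/1000:ℝ)) := by gcongr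
      _ = 2 * (T ^ (1/4:ℝ) * T ^ (-(1/2):ℝ) * T ^ (195/1000:ℝ)) := by ring
      _ = 2 * T ^ (-(55/1000):ℝ) := by rw [← Real.rpow_add hT0, ← Real.rpow_add hT0]; norm_num
      _ ≤ _ := by have := hmono (-(55/1000)) (by norm_num); linarith
  have E4 : Real.sqrt u * (1 / (Real.sqrt u * h ^ 8 * (M:ℝ) ^ (7/2:ℝ))) ≤ 16 * T ^ (-(1/200):ℝ) := by
    have hM2 : T ^ (3/4:ℝ) / 2 ≤ M := by
      have h1 : 1 ≤ T ^ (3/4:ℝ) := Real.one_le_rpow hT1 (by norm_num)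
      have h2 : (1:ℝ) ≤ M := by rw [hM]; exact_mod_cast Nat.le_floor (by simpa using h1)
      have h3 := Nat.lt_floor_add_one (T ^ (3/4:ℝ))
      rw [← hM] at h3
      linarith
    have hM3 : T ^ (21/8:ℝ) / 16 ≤ (M:ℝ) ^ (7/2:ℝ) := by
      calc T ^ (21/8:ℝ) / 16 ≤ T ^ (21/8:ℝ) / 2 ^ (7/2:ℝ) := by
            gcongr
            calc (2:ℝ) ^ (7/2:ℝ) ≤ 2 ^ (4:ℝ) := Real.rpow_le_rpow_of_exponent_le (by norm_num) (by norm_num)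
              _ = 16 := by norm_num
        _ = (T ^ (3/4:ℝ) / 2) ^ (7/2:ℝ) := by
            rw [Real.div_rpow (hp _).le (by norm_num), ← Real.rpow_mul hT0.le]; norm_num
        _ ≤ _ := Real.rpow_le_rpow (by positivity) hM2 (by norm_num)
    have hsu0 : 0 < Real.sqrt u := Real.sqrt_pos.2 hu0
    have h8 : h ^ 8 = T ^ (-(208/100):ℝ) := by
      rw [hh, ← Real.rpow_natCast, ← Real.rpow_mul hT0.le]; norm_num
    rw [h8]
    calc _ ≤ Real.sqrt u * (1 / (Real.sqrt u * T ^ (-(208/100):ℝ) * (T ^ (21/8:ℝ) / 16))) := by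
            have := hp (21/8)
            have := hp (-(208/100))
            gcongr
      _ = 16 * (1 / (T ^ (-(208/100):ℝ) * T ^ (21/8:ℝ))) := by
            have := hp (21/8)
            have := hp (-(208/100))
            field_simp
      _ = 16 * T ^ (-(545/1000):ℝ) := by
            rw [← Real.rpow_add hT0, one_div, ← Real.rpow_neg hT0.le]; norm_num
      _ ≤ _ := by have := hmono (-(545/1000)) (by norm_num); linarith
  have := hp (-(1/200))
  unfold betaE
  calc _ = Real.sqrt u * (u ^ (1/100:ℝ) * (1 / u + h + Real.exp (-S))) + Real.sqrt u * ((S + 1) / u ^ 2) + Real.sqrt u * (1 / (u * h ^ (3/4:ℝ))) + Real.sqrt u * (1 / (Real.sqrt u * h ^ 8 * (M:ℝ) ^ (7/2:ℝ))) := by ring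
    _ ≤ _ := by linarith

theorem trunc_voronoi : ∃ C : ℝ, 0 < C ∧ ∀ T : ℝ, 10 ≤ T → ∃ c : ℕ → ℂ, (∀ n, ‖c n‖ ≤ C * divfun n * (n:ℝ) ^ (-(3/4):ℝ)) ∧
    ∀ u : ℝ, Real.sqrt T ≤ u → u ≤ Real.sqrt (2 * T) → |R2 (T ^ ((1:ℝ)/4)) (u ^ 2)| / Real.sqrt u ≤ 
      ‖∑ n ∈ Finset.Ioc ⌊T ^ ((1:ℝ)/4)⌋₊ ⌊T ^ (3/4:ℝ)⌋₊, c n * ec (2 * u * Real.sqrt n)‖ + C * T ^ (-(1/200):ℝ) := by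
  obtain ⟨C1, hC1, b1⟩ := asm_delta (1/100) (by norm_num)
  obtain ⟨C2, hC2, b2⟩ := err_numeric
  obtain ⟨C3, hC3, b3⟩ := Phi_lip
  obtain ⟨Cd, hCd, bd⟩ := divisor_bound (1/4) (by norm_num)
  obtain ⟨F1, F2, C4, hC4, d1, d2, cF2, b4⟩ := Phi_bounds
  refine ⟨2 * C4 + C1 * C2 + 2 * Cd * C3, by positivity, fun T hT => ?_⟩
  have hT0 : 0 < T := by linarith
  have hT1 : 1 ≤ T := by linarith
  set h := T ^ (-(26/100):ℝ) with hh
  set S := Real.log 10 - Real.log h with hS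
  set M := ⌊T ^ (3/4:ℝ)⌋₊ with hM
  set Y := ⌊T ^ ((1:ℝ)/4)⌋₊ with hY
  have hh0 : 0 < h := Real.rpow_pos_of_pos hT0 _
  have hh1 : h ≤ 1 := Real.rpow_le_one_of_one_le_of_nonpos hT1 (by norm_num)
  have hlog10 : 1 ≤ Real.log 10 := by
    rw [Real.le_log_iff_exp_le (by norm_num)]
    linarith [Real.exp_one_lt_d9]
  have hS0 : 0 ≤ S := by
    have := Real.log_nonpos hh0.le hh1
    rw [hS]; linarith
  have hM1 : 1 ≤ M := Nat.le_floor (by simpa using Real.one_le_rpow hT1 (by norm_num : (0:ℝ) ≤ 3/4))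
  have hYM : Y ≤ M := Nat.floor_mono (Real.rpow_le_rpow_of_exponent_le hT1 (by norm_num))
  set K : ℝ := 1 / (Real.sqrt 2 * Real.pi) with hK
  have hK0 : 0 ≤ K := by positivity
  have hK1 : K ≤ 1 := by
    rw [hK, div_le_one (by positivity)]
    have := Real.pi_gt_three
    have : 1 ≤ Real.sqrt 2 := by rw [Real.one_le_sqrt]; norm_num
    nlinarith
  set c : ℕ → ℂ := fun ν => ((dt S ν * K * (ν:ℝ) ^ (-(3/4):ℝ) : ℝ) : ℂ) * (Phi (2 * h * Real.sqrt ν) * ec (1/8)) with hc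
  refine ⟨c, ?_, ?_⟩
  · intro n
    have hP : ‖Phi (2 * h * Real.sqrt n)‖ ≤ C4 := (b4 _).1.trans (div_le_self hC4.le (by
      apply one_le_pow₀; linarith [abs_nonneg (2 * h * Real.sqrt n)]))
    rw [hc]
    simp only
    rw [norm_mul, norm_mul, ec_norm, mul_one, Complex.norm_real, Real.norm_eq_abs, abs_mul, abs_mul, abs_of_nonneg hK0, abs_of_nonneg (by positivity : 0 ≤ (n:ℝ) ^ (-(3/4):ℝ))]
    have := dt_abs S n
    calc _ ≤ (2 * (divfun n:ℝ)) * 1 * (n:ℝ) ^ (-(3/4):ℝ) * C4 := by gcongr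
      _ = (2 * C4) * (divfun n:ℝ) * (n:ℝ) ^ (-(3/4):ℝ) := by ring
      _ ≤ _ := by
        gcongr
        have : 0 ≤ C1 * C2 + 2 * Cd * C3 := by positivity
        linarith
  · intro u hu1 hu2
    have hu : 2 ≤ u := by
      refine le_trans ?_ hu1
      apply Real.le_sqrt_of_sq_le; linarith
    have hu0 : 0 < u := by linarith
    have hsu : 0 < Real.sqrt u := Real.sqrt_pos.2 hu0
    have e1 := b1 u h S M hu hh0 hh1 hS0 hM1
    have e2 := b2 T u h S M hT hu1 hu2 hh hS hM
    rw [main_sum hu0] at e1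
    have hI : ∀ N : ℕ, Finset.Icc 1 N = Finset.Ioc 0 N := fun N => by ext x; simp [Nat.succ_le_iff]
    have hsplit : ∑ ν ∈ Finset.Icc 1 M, vterm u h S ν = ∑ ν ∈ Finset.Icc 1 Y, vterm u h S ν + ∑ ν ∈ Finset.Ioc Y M, vterm u h S ν := by
      rw [hI, hI, Finset.sum_Ioc_consecutive _ (Nat.zero_le _) hYM]
    have hmain : Real.sqrt u * ∑ ν ∈ Finset.Ioc Y M, vterm u h S ν = (∑ n ∈ Finset.Ioc Y M, c n * ec (2 * u * Real.sqrt n)).im := by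
      rw [Complex.im_sum, Finset.mul_sum]
      apply Finset.sum_congr rfl
      intro ν _
      rw [hc]
      simp only
      rw [show ((dt S ν * K * (ν:ℝ) ^ (-(3/4):ℝ) : ℝ) : ℂ) * (Phi (2 * h * Real.sqrt ν) * ec (1/8)) * ec (2 * u * Real.sqrt ν) = 
        ((dt S ν * K * (ν:ℝ) ^ (-(3/4):ℝ) : ℝ) : ℂ) * (Phi (2 * h * Real.sqrt ν) * ec (2 * u * Real.sqrt ν + 1/8)) by rw [ec_add]; ring, Complex.im_ofReal_mul]
      unfold vterm
      rw [← hK]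
      field_simp
    have hlow : Real.sqrt u * |∑ ν ∈ Finset.Icc 1 Y, vterm u h S ν - R1 (T ^ ((1:ℝ)/4)) (u ^ 2) / u| ≤ 2 * Cd * C3 * T ^ (-(1/200):ℝ) := by
      rw [R1_form hu0, ← Finset.sum_sub_distrib, ← abs_of_pos hsu, ← abs_mul, abs_of_pos hsu, Finset.mul_sum]
      refine (Finset.abs_sum_le_sum_abs _ _).trans ?_
      have hYT : (Y:ℝ) ≤ T ^ ((1:ℝ)/4) := Nat.floor_le (by positivity)
      have hterm : ∀ ν ∈ Finset.Icc 1 Y, |Real.sqrt u * (vterm u h S ν - (divfun ν : ℝ) * (1 / (Real.sqrt 2 * Real.pi) * (1 / Real.sqrt u) * (ν:ℝ) ^ (-(3/4):ℝ) * (ec (2 * u * Real.sqrt ν + 1/8)).im))| ≤ 2 * Cd * C3 * h := by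
        intro ν hν
        obtain ⟨hν1, hν2⟩ := Finset.mem_Icc.1 hν
        have hν1' : (1:ℝ) ≤ ν := by exact_mod_cast hν1
        have hν2' : (ν:ℝ) ≤ T ^ ((1:ℝ)/4) := le_trans (by exact_mod_cast hν2) hYT
        have hdt : dt S ν = divfun ν := by
          apply dt_eq
          have : Real.log ν ≤ (1/4) * Real.log T := by
            rw [← Real.log_rpow hT0]
            exact Real.log_le_log (by linarith) hν2'
          rw [hS, hh, Real.log_rpow hT0]
          have := Real.log_nonneg hT1
          linarith
        unfold vterm
        rw [hdt, ← hK]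
        have : Real.sqrt u * ((divfun ν : ℝ) * (K * (1 / Real.sqrt u) * (ν:ℝ) ^ (-(3/4):ℝ) * (Phi (2 * h * Real.sqrt ν) * ec (2 * u * Real.sqrt ν + 1/8)).im) - 
          (divfun ν : ℝ) * (K * (1 / Real.sqrt u) * (ν:ℝ) ^ (-(3/4):ℝ) * (ec (2 * u * Real.sqrt ν + 1/8)).im)) = 
          (divfun ν : ℝ) * (ν:ℝ) ^ (-(3/4):ℝ) * K * ((Phi (2 * h * Real.sqrt ν) - 1) * ec (2 * u * Real.sqrt ν + 1/8)).im := by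
          rw [sub_mul, one_mul, Complex.sub_im]
          field_simp
        rw [this, abs_mul]
        have e5 : |((Phi (2 * h * Real.sqrt ν) - 1) * ec (2 * u * Real.sqrt ν + 1/8)).im| ≤ C3 * (2 * h * Real.sqrt ν) := by
          refine (Complex.abs_im_le_norm _).trans ?_
          rw [norm_mul, ec_norm, mul_one]
          have := b3 (2 * h * Real.sqrt ν)
          rwa [abs_of_nonneg (by positivity : 0 ≤ 2 * h * Real.sqrt ν)] at this
        rw [abs_of_nonneg (by positivity)]
        calc _ ≤ (Cd * (ν:ℝ) ^ (1/4:ℝ)) * (ν:ℝ) ^ (-(3/4):ℝ) * 1 * (C3 * (2 * h * Real.sqrt ν)) := by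
              gcongr
              exact bd ν hν1
          _ = 2 * Cd * C3 * h * ((ν:ℝ) ^ (1/4:ℝ) * (ν:ℝ) ^ (-(3/4):ℝ) * (ν:ℝ) ^ (1/2:ℝ)) := by rw [Real.sqrt_eq_rpow]; ring
          _ = 2 * Cd * C3 * h := by
              rw [← Real.rpow_add (by linarith), ← Real.rpow_add (by linarith)]; norm_num
      refine (Finset.sum_le_card_nsmul _ _ _ hterm).trans ?_
      rw [nsmul_eq_mul, Nat.card_Icc, Nat.add_sub_cancel]
      calc (Y:ℝ) * (2 * Cd * C3 * h) ≤ T ^ ((1:ℝ)/4) * (2 * Cd * C3 * h) := by gcongr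
        _ = 2 * Cd * C3 * (T ^ ((1:ℝ)/4) * T ^ (-(26/100):ℝ)) := by rw [hh]; ring
        _ = 2 * Cd * C3 * T ^ (-(1/100):ℝ) := by rw [← Real.rpow_add hT0]; norm_num
        _ ≤ _ := mul_le_mul_of_nonneg_left (Real.rpow_le_rpow_of_exponent_le hT1 (by norm_num)) (by positivity)
    have hR : |R2 (T ^ ((1:ℝ)/4)) (u ^ 2)| / Real.sqrt u = Real.sqrt u * |DirichletDelta (u ^ 2) / u - R1 (T ^ ((1:ℝ)/4)) (u ^ 2) / u| := by
      unfold R2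
      rw [← sub_div, abs_div, abs_of_pos hu0]
      have hss := Real.mul_self_sqrt hu0.le
      rw [div_eq_iff hsu.ne', mul_comm (Real.sqrt u), mul_assoc, hss, div_mul_cancel₀ _ hu0.ne']
    rw [hR]
    set D := DirichletDelta (u ^ 2) / u
    set A := ∑ ν ∈ Finset.Icc 1 M, vterm u h S ν
    set A1 := ∑ ν ∈ Finset.Icc 1 Y, vterm u h S ν
    set A2 := ∑ ν ∈ Finset.Ioc Y M, vterm u h S ν
    set R := R1 (T ^ ((1:ℝ)/4)) (u ^ 2) / u
    have t1 : |D - R| ≤ |D - A| + |A1 - R| + |A2| := by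
      have : D - R = (D - A) + (A1 - R) + A2 := by rw [hsplit]; ring
      rw [this]
      exact (abs_add_le _ _).trans (by linarith [abs_add_le (D - A) (A1 - R)])
    have t2 : Real.sqrt u * |A2| ≤ ‖∑ n ∈ Finset.Ioc Y M, c n * ec (2 * u * Real.sqrt n)‖ := by
      have hq : Real.sqrt u * |A2| = |Real.sqrt u * A2| := by rw [abs_mul, abs_of_pos hsu]
      rw [hq, hmain]
      exact Complex.abs_im_le_norm _
    have t3 : Real.sqrt u * |D - A| ≤ C1 * C2 * T ^ (-(1/200):ℝ) := by
      calc _ ≤ Real.sqrt u * (C1 * (u ^ (1/100:ℝ) * (1 / u + h + Real.exp (-S)) + betaE u h S M)) := by gcongr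
        _ = C1 * (Real.sqrt u * (u ^ (1/100:ℝ) * (1 / u + h + Real.exp (-S)) + betaE u h S M)) := by ring
        _ ≤ C1 * (C2 * T ^ (-(1/200):ℝ)) := by gcongr
        _ = _ := by ring
    have hTp : 0 < T ^ (-(1/200):ℝ) := Real.rpow_pos_of_pos hT0 _
    calc Real.sqrt u * |D - R| ≤ Real.sqrt u * (|D - A| + |A1 - R| + |A2|) := by gcongr
      _ = Real.sqrt u * |D - A| + Real.sqrt u * |A1 - R| + Real.sqrt u * |A2| := by ring
      _ ≤ _ := by
        have : 0 ≤ 2 * C4 * T ^ (-(1/200):ℝ) := by positivity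
        nlinarith

/-! Kuzmin-Landau and the discrete second derivative test. -/

noncomputable def kc (x : ℝ) : ℂ := 1 / (1 - ec x)

noncomputable def kcot (x : ℝ) : ℝ := Real.cos (Real.pi * x) / Real.sin (Real.pi * x)

lemma kl_sin_pos {x : ℝ} (h0 : 0 < x) (h1 : x < 1) : 0 < Real.sin (Real.pi * x) := by
  apply Real.sin_pos_of_pos_of_lt_pi
  · have := Real.pi_pos; positivity
  · have := Real.pi_pos; nlinarith

lemma kl_sin_lb {x θ : ℝ} (hθ : 0 < θ) (h0 : θ ≤ x) (h1 : x ≤ 1 - θ) : 2 * θ ≤ Real.sin (Real.pi * x) := by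
  have hpi := Real.pi_pos
  rcases le_total x (1/2) with h | h
  · have := Real.mul_le_sin (x := Real.pi * x) (mul_nonneg hpi.le (by linarith)) (by nlinarith)
    have e : 2 / Real.pi * (Real.pi * x) = 2 * x := by field_simp
    linarith
  · have h2 : Real.sin (Real.pi * x) = Real.sin (Real.pi * (1 - x)) := by
      rw [show Real.pi * (1 - x) = Real.pi - Real.pi * x by ring, Real.sin_pi_sub]
    have := Real.mul_le_sin (x := Real.pi * (1 - x)) (by apply mul_nonneg hpi.le; linarith) (by nlinarith)
    have e : 2 / Real.pi * (Real.pi * (1 - x)) = 2 * (1 - x) := by field_simp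
    linarith

lemma kl_form {x : ℝ} (h0 : 0 < x) (h1 : x < 1) : kc x = 1 / 2 + (kcot x / 2 : ℝ) * Complex.I ∧ kc x * (1 - ec x) = 1 := by
  have hs := kl_sin_pos h0 h1
  have key : (1 / 2 + ((kcot x / 2 : ℝ) : ℂ) * Complex.I) * (1 - ec x) = 1 := by
    apply Complex.ext
    · simp only [Complex.mul_re, Complex.add_re, Complex.sub_re, Complex.sub_im, Complex.add_im, Complex.mul_im, Complex.one_re, Complex.one_im, Complex.ofReal_re, Complex.ofReal_im, Complex.I_re, Complex.I_im, ec_re, ec_im]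
      norm_num
      unfold kcot
      rw [show 2 * Real.pi * x = 2 * (Real.pi * x) by ring, Real.sin_two_mul, Real.cos_two_mul]
      field_simp
      ring
    · simp only [Complex.mul_re, Complex.add_re, Complex.sub_re, Complex.sub_im, Complex.add_im, Complex.mul_im, Complex.one_re, Complex.one_im, Complex.ofReal_re, Complex.ofReal_im, Complex.I_re, Complex.I_im, ec_re, ec_im]
      norm_num
      unfold kcot
      rw [show 2 * Real.pi * x = 2 * (Real.pi * x) by ring, Real.sin_two_mul, Real.cos_two_mul]
      field_simp
      have := Real.sin_sq_add_cos_sq (Real.pi * x)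
      ring_nf
      rw [Real.sin_sq]
      ring
  have hne : (1 - ec x) ≠ 0 := by
    intro h; rw [h, mul_zero] at key; exact zero_ne_one key
  have h3 : kc x = 1 / 2 + ((kcot x / 2 : ℝ) : ℂ) * Complex.I := by
    unfold kc; rw [div_eq_iff hne, key]
  exact ⟨h3, by rw [h3, key]⟩

lemma kcot_anti {x y : ℝ} (h0 : 0 < x) (hxy : x ≤ y) (h1 : y < 1) : kcot y ≤ kcot x := by
  unfold kcot
  have hs1 := kl_sin_pos h0 (by linarith)
  have hs2 := kl_sin_pos (show 0 < y by linarith) h1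
  rw [div_le_div_iff₀ hs2 hs1]
  have : 0 ≤ Real.sin (Real.pi * y - Real.pi * x) := by
    apply Real.sin_nonneg_of_nonneg_of_le_pi
    · have := Real.pi_pos; nlinarith
    · have := Real.pi_pos; nlinarith
  rw [Real.sin_sub] at this
  linarith

lemma kcot_bd {x θ : ℝ} (hθ : 0 < θ) (h0 : θ ≤ x) (h1 : x ≤ 1 - θ) : |kcot x| ≤ 1 / θ := by
  have h := kl_sin_lb hθ h0 h1
  unfold kcot
  rw [abs_div, abs_of_pos (by linarith : 0 < Real.sin (Real.pi * x))]
  exact div_le_div₀ zero_le_one (Real.abs_cos_le_one _) hθ (by linarith)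

lemma kc_bd {x θ : ℝ} (hθ : 0 < θ) (h0 : θ ≤ x) (h1 : x ≤ 1 - θ) : ‖kc x‖ ≤ 1 / θ := by
  rw [(kl_form (by linarith) (by linarith)).1]
  have := kcot_bd hθ h0 h1
  have h2 : 1 ≤ 1 / θ := by rw [le_div_iff₀ hθ]; linarith
  refine (norm_add_le _ _).trans ?_
  rw [norm_mul, Complex.norm_real, Complex.norm_I, Real.norm_eq_abs, abs_div]
  norm_num at *
  linarith

lemma kuzmin_landau_aux (f : ℕ → ℝ) (L : ℕ) (θ : ℝ) (hθ : 0 < θ)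
    (hg : ∀ j ≤ L, θ ≤ f (j+1) - f j ∧ f (j+1) - f j ≤ 1 - θ)
    (hm : ∀ j < L, f (j+2) - f (j+1) ≤ f (j+1) - f j) :
    ‖∑ j ∈ Finset.range (L+1), ec (f j) + ec (f (L+1)) * kc (f (L+1) - f L)‖ ≤ 1 / θ + (kcot (f (L+1) - f L) - kcot (f 1 - f 0)) / 2 := by
  have step : ∀ j ≤ L, ec (f j) + ec (f (j+1)) * kc (f (j+1) - f j) = kc (f (j+1) - f j) * ec (f j) := by
    intro j hj
    have h := hg j hj
    have := (kl_form (x := f (j+1) - f j) (by linarith) (by linarith)).2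
    have e : ec (f (j+1)) = ec (f j) * ec (f (j+1) - f j) := by rw [← ec_add]; congr 1; ring
    rw [e]
    linear_combination (-ec (f j)) * this
  induction L with
  | zero =>
    have h := hg 0 le_rfl
    have hs := step 0 le_rfl
    simp only [zero_add, Finset.range_one, Finset.sum_singleton] at *
    rw [hs, norm_mul, ec_norm, mul_one, sub_self, zero_div, add_zero]
    exact kc_bd hθ h.1 h.2
  | succ L ih =>
    have ih' := ih (fun j hj => hg j (by omega)) (fun j hj => hm j (by omega)) (fun j hj => step j (by omega))
    have hs := step (L+1) le_rfl
    rw [Finset.sum_range_succ]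
    have e : ∑ j ∈ Finset.range (L+1), ec (f j) + ec (f (L+1)) + ec (f (L+1+1)) * kc (f (L+1+1) - f (L+1)) =
      (∑ j ∈ Finset.range (L+1), ec (f j) + ec (f (L+1)) * kc (f (L+1) - f L)) + ec (f (L+1)) * (kc (f (L+1+1) - f (L+1)) - kc (f (L+1) - f L)) := by
      linear_combination hs
    rw [e]
    have h1 := hg L (by omega)
    have h2 := hg (L+1) le_rfl
    have h3 := hm L (by omega)
    have e2 : ‖ec (f (L+1)) * (kc (f (L+1+1) - f (L+1)) - kc (f (L+1) - f L))‖ = (kcot (f (L+1+1) - f (L+1)) - kcot (f (L+1) - f L)) / 2 := by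
      rw [norm_mul, ec_norm, one_mul, (kl_form (by linarith) (by linarith)).1, (kl_form (x := f (L+1) - f L) (by linarith) (by linarith)).1]
      rw [add_sub_add_left_eq_sub, ← sub_mul, norm_mul, Complex.norm_I, mul_one, ← Complex.ofReal_sub, Complex.norm_real, Real.norm_eq_abs, abs_of_nonneg]
      · ring
      · have := kcot_anti (x := f (L+1+1) - f (L+1)) (y := f (L+1) - f L) (by linarith) h3 (by linarith)
        linarith
    refine (norm_add_le _ _).trans ?_
    rw [e2]
    linarith

lemma ec_sub_int (x : ℝ) (k : ℤ) : ec (x - k) = ec x := by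
  unfold ec
  rw [show (2 * Real.pi * ((x - k : ℝ) : ℂ) * Complex.I : ℂ) = 2 * Real.pi * x * Complex.I - k * (2 * Real.pi * Complex.I) by push_cast; ring]
  rw [Complex.exp_sub, Complex.exp_int_mul_two_pi_mul_I, div_one]

lemma kuzmin_landau (f : ℕ → ℝ) (a b : ℕ) (k : ℤ) (θ : ℝ) (hθ : 0 < θ)
    (hg : ∀ n, a ≤ n → n < b → θ ≤ f (n+1) - f n - k ∧ f (n+1) - f n - k ≤ 1 - θ)
    (hm : ∀ n, a ≤ n → n + 1 < b → f (n+2) - f (n+1) ≤ f (n+1) - f n) :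
    ‖∑ n ∈ Finset.Ico a b, ec (f n)‖ ≤ 3 / θ := by
  rcases Nat.lt_or_ge a b with hab | hab
  swap
  · rw [Finset.Ico_eq_empty (by omega)]; simp; positivity
  obtain ⟨L, rfl⟩ : ∃ L, b = a + (L + 1) := ⟨b - a - 1, by omega⟩
  rw [Finset.sum_Ico_eq_sum_range, show a + (L+1) - a = L + 1 by omega]
  set F : ℕ → ℝ := fun j => f (a + j) - ((k * j : ℤ) : ℝ) with hF
  have hd : ∀ j, F (j+1) - F j = f (a + j + 1) - f (a + j) - k := by
    intro j; rw [hF]; simp only; push_cast; rw [← add_assoc]; ring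
  have e : ∀ j, ec (f (a + j)) = ec (F j) := by
    intro j; rw [hF]; simp only; rw [ec_sub_int]
  simp_rw [e]
  have hg' : ∀ j ≤ L, θ ≤ F (j+1) - F j ∧ F (j+1) - F j ≤ 1 - θ := by
    intro j hj; rw [hd]; exact hg _ (by omega) (by omega)
  have := kuzmin_landau_aux F L θ hθ hg' (by
    intro j hj
    have h1 := hd j
    have h2 := hd (j+1)
    rw [h1, show F (j+2) - F (j+1) = _ from h2]
    have := hm (a + j) (by omega) (by omega)
    rw [show a + (j+1) + 1 = a + j + 2 by ring, show a + (j+1) = a + j + 1 by ring]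
    linarith)
  have h0 := hg' 0 (by omega)
  have hL := hg' L le_rfl
  have b1 := kcot_bd hθ h0.1 h0.2
  have b2 := kcot_bd hθ hL.1 hL.2
  have b3 := kc_bd hθ hL.1 hL.2
  rw [zero_add] at b1
  have t := norm_sub_le (∑ j ∈ Finset.range (L+1), ec (F j) + ec (F (L+1)) * kc (F (L+1) - F L)) (ec (F (L+1)) * kc (F (L+1) - F L))
  rw [add_sub_cancel_right, norm_mul (ec _), ec_norm, one_mul] at t
  have : (3:ℝ) / θ = 3 * (1 / θ) := by ring
  rw [this]
  linarith [abs_le.1 b1, abs_le.1 b2]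

lemma ico_of_convex (P : Finset ℕ) (h : ∀ x ∈ P, ∀ y ∈ P, ∀ z, x ≤ z → z ≤ y → z ∈ P) : ∃ a b, P = Finset.Ico a b := by
  rcases P.eq_empty_or_nonempty with rfl | hne
  · exact ⟨0, 0, by simp⟩
  · refine ⟨P.min' hne, P.max' hne + 1, ?_⟩
    ext z
    rw [Finset.mem_Ico]
    constructor
    · intro hz; exact ⟨P.min'_le z hz, Nat.lt_succ_of_le (P.le_max' z hz)⟩
    · rintro ⟨h1, h2⟩
      exact h _ (P.min'_mem hne) _ (P.max'_mem hne) z h1 (by omega)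

lemma rnd_mono {x y : ℝ} (h : x ≤ y) : round x ≤ round y := by
  rw [round_eq, round_eq]; exact Int.floor_mono (by linarith)

/-- discrete second derivative test -/
lemma second_deriv (f : ℕ → ℝ) (a b : ℕ) (l G : ℝ) (hl : 0 < l) (hl1 : l ≤ 1/4) (hG0 : 0 ≤ G)
    (hg : ∀ n, a ≤ n → n < b → 0 ≤ f (n+1) - f n ∧ f (n+1) - f n ≤ G)
    (hm : ∀ n, a ≤ n → n + 1 < b → l ≤ (f (n+1) - f n) - (f (n+2) - f (n+1))) :
    ‖∑ n ∈ Finset.Ico a b, ec (f n)‖ ≤ (G + 3) * (9 / Real.sqrt l) := by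
  set g : ℕ → ℝ := fun n => f (n+1) - f n with hgd
  set t := Real.sqrt l with ht
  have ht0 : 0 < t := Real.sqrt_pos.2 hl
  have htt : t * t = l := Real.mul_self_sqrt hl.le
  have ht1 : t ≤ 1/2 := by nlinarith
  have hdec : ∀ d n, a ≤ n → n + d < b → l * d ≤ g n - g (n + d) := by
    intro d
    induction d with
    | zero => intro n _ _; simp
    | succ d ih =>
      intro n h1 h2
      have e1 := ih n h1 (by omega)
      have e2 := hm (n + d) (by omega) (by omega)
      rw [hgd] at e1 ⊢
      simp only at e1 ⊢
      push_cast
      rw [show n + (d+1) + 1 = n + d + 2 by ring, show n + (d + 1) = n + d + 1 by ring]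
      linarith
  have hanti : ∀ m n, a ≤ m → m ≤ n → n < b → g n ≤ g m := by
    intro m n h1 h2 h3
    have := hdec (n - m) m h1 (by omega)
    rw [show m + (n - m) = n by omega] at this
    have : 0 ≤ l * ((n - m : ℕ) : ℝ) := by positivity
    linarith
  have hfib : ∀ k : ℤ, ‖∑ n ∈ Finset.Ico a b with round (g n) = k, ec (f n)‖ ≤ 9 / t := by
    intro k
    have hr : ∀ n, round (g n) = k → |g n - k| ≤ 1/2 := by
      intro n hn; rw [← hn]; exact abs_sub_round _
    set P := {n ∈ Finset.Ico a b | round (g n) = k} with hP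
    have hPm : ∀ n, n ∈ P ↔ (a ≤ n ∧ n < b) ∧ round (g n) = k := by intro n; rw [hP]; simp
    have hconv : ∀ x ∈ P, ∀ y ∈ P, ∀ z, x ≤ z → z ≤ y → z ∈ P := by
      intro x hx y hy z h1 h2
      rw [hPm] at hx hy ⊢
      refine ⟨⟨by omega, by omega⟩, le_antisymm ?_ ?_⟩
      · rw [← hx.2]; exact rnd_mono (hanti x z hx.1.1 h1 (by omega))
      · rw [← hy.2]; exact rnd_mono (hanti z y (by omega) h2 hy.1.2)
    have hsplit : ∑ n ∈ P, ec (f n) = ∑ n ∈ P with t ≤ g n - k, ec (f n) + (∑ n ∈ P.filter (fun n => ¬ t ≤ g n - k) with g n - k ≤ -t, ec (f n) + ∑ n ∈ P.filter (fun n => ¬ t ≤ g n - k) with ¬ g n - k ≤ -t, ec (f n)) := by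
      rw [Finset.sum_filter_add_sum_filter_not, Finset.sum_filter_add_sum_filter_not]
    have p1 : ‖∑ n ∈ P with t ≤ g n - k, ec (f n)‖ ≤ 3 / t := by
      obtain ⟨a', b', hab⟩ := ico_of_convex (P.filter (fun n => t ≤ g n - k)) (by
        intro x hx y hy z h1 h2
        rw [Finset.mem_filter] at hx hy ⊢
        have hy' := (hPm y).1 hy.1
        have hx' := (hPm x).1 hx.1
        exact ⟨hconv x hx.1 y hy.1 z h1 h2, hy.2.trans (by have := hanti z y (by omega) h2 hy'.1.2; linarith)⟩)
      rw [hab]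
      have hmem : ∀ n, a' ≤ n → n < b' → n ∈ P ∧ t ≤ g n - k := by
        intro n h1 h2
        have : n ∈ Finset.Ico a' b' := by simp [h1, h2]
        rw [← hab, Finset.mem_filter] at this
        exact this
      apply kuzmin_landau f a' b' k t ht0
      · intro n h1 h2
        have h := hmem n h1 h2
        have := abs_le.1 (hr n ((hPm n).1 h.1).2)
        exact ⟨h.2, by have : g n - k ≤ 1 - t := by linarith
                       exact this⟩
      · intro n h1 h2
        have h := (hPm n).1 (hmem n h1 (by omega)).1
        have h' := (hPm (n+1)).1 (hmem (n+1) (by omega) (by omega)).1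
        have := hm n h.1.1 h'.1.2
        linarith
    have p2 : ‖∑ n ∈ P.filter (fun n => ¬ t ≤ g n - k) with g n - k ≤ -t, ec (f n)‖ ≤ 3 / t := by
      rw [Finset.filter_filter]
      obtain ⟨a', b', hab⟩ := ico_of_convex (P.filter (fun n => ¬ t ≤ g n - k ∧ g n - k ≤ -t)) (by
        intro x hx y hy z h1 h2
        rw [Finset.mem_filter] at hx hy ⊢
        have hy' := (hPm y).1 hy.1
        have hx' := (hPm x).1 hx.1
        have := hanti x z hx'.1.1 h1 (by omega)
        exact ⟨hconv x hx.1 y hy.1 z h1 h2, by linarith [hx.2.2], by linarith [hx.2.2]⟩)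
      rw [hab]
      have hmem : ∀ n, a' ≤ n → n < b' → n ∈ P ∧ ¬ t ≤ g n - k ∧ g n - k ≤ -t := by
        intro n h1 h2
        have : n ∈ Finset.Ico a' b' := by simp [h1, h2]
        rw [← hab, Finset.mem_filter] at this
        exact this
      apply kuzmin_landau f a' b' (k - 1) t ht0
      · intro n h1 h2
        have h := hmem n h1 h2
        have := abs_le.1 (hr n ((hPm n).1 h.1).2)
        have h3 : t ≤ g n - k + 1 := by linarith
        have h4 : g n - k + 1 ≤ 1 - t := by linarith [h.2.2]
        rw [hgd] at h3 h4
        simp only at h3 h4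
        push_cast
        constructor <;> linarith
      · intro n h1 h2
        have h := (hPm n).1 (hmem n h1 (by omega)).1
        have h' := (hPm (n+1)).1 (hmem (n+1) (by omega) (by omega)).1
        have := hm n h.1.1 h'.1.2
        linarith
    have p3 : ‖∑ n ∈ P.filter (fun n => ¬ t ≤ g n - k) with ¬ g n - k ≤ -t, ec (f n)‖ ≤ 3 / t := by
      rw [Finset.filter_filter]
      obtain ⟨a', b', hab⟩ := ico_of_convex (P.filter (fun n => ¬ t ≤ g n - k ∧ ¬ g n - k ≤ -t)) (by
        intro x hx y hy z h1 h2
        rw [Finset.mem_filter] at hx hy ⊢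
        have hy' := (hPm y).1 hy.1
        have hx' := (hPm x).1 hx.1
        have e1 := hanti x z hx'.1.1 h1 (by omega)
        have e2 := hanti z y (by omega) h2 hy'.1.2
        exact ⟨hconv x hx.1 y hy.1 z h1 h2, by have := not_le.1 hx.2.1; apply not_le.2; linarith, by have := not_le.1 hy.2.2; apply not_le.2; linarith⟩)
      rw [hab]
      have hmem : ∀ n, a' ≤ n → n < b' → n ∈ P ∧ ¬ t ≤ g n - k ∧ ¬ g n - k ≤ -t := by
        intro n h1 h2
        have : n ∈ Finset.Ico a' b' := by simp [h1, h2]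
        rw [← hab, Finset.mem_filter] at this
        exact this
      refine (norm_sum_le _ _).trans ?_
      simp only [ec_norm, Finset.sum_const, Nat.card_Ico, nsmul_eq_mul, mul_one]
      rcases Nat.lt_or_ge a' b' with h | h
      swap
      · rw [Nat.sub_eq_zero_of_le h]; push_cast; positivity
      obtain ⟨d, rfl⟩ : ∃ d, b' = a' + d + 1 := ⟨b' - a' - 1, by omega⟩
      have m1 := hmem a' le_rfl (by omega)
      have m2 := hmem (a' + d) (by omega) (by omega)
      have q1 := (hPm _).1 m1.1
      have q2 := (hPm _).1 m2.1
      have e := hdec d a' q1.1.1 q2.1.2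
      have r1 := not_le.1 m1.2.1
      have r2 := not_le.1 m2.2.2
      have : t * (t * d) < t * 2 := by nlinarith
      have := lt_of_mul_lt_mul_left this ht0.le
      rw [show a' + d + 1 - a' = d + 1 by omega, le_div_iff₀ ht0]
      push_cast
      linarith
    rw [hsplit]
    have : 9 / t = 3 / t + (3 / t + 3 / t) := by ring
    rw [this]
    exact (norm_add_le _ _).trans (add_le_add p1 ((norm_add_le _ _).trans (add_le_add p2 p3)))
  rcases Nat.lt_or_ge a b with hab | hab
  swap
  · rw [Finset.Ico_eq_empty (by omega), Finset.sum_empty, norm_zero]; positivity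
  have hG : 0 ≤ G := (hg a le_rfl hab).1.trans (hg a le_rfl hab).2
  have hmaps : ∀ n ∈ Finset.Ico a b, round (g n) ∈ Finset.Icc (0:ℤ) (⌊G⌋ + 1) := by
    intro n hn
    obtain ⟨h1, h2⟩ := Finset.mem_Ico.1 hn
    have h3 := hg n h1 h2
    rw [Finset.mem_Icc]
    constructor
    · have := rnd_mono h3.1
      rwa [round_zero] at this
    · rw [round_eq]
      have h4 : ⌊g n + 1/2⌋ ≤ ⌊G + 1⌋ := Int.floor_mono (by
        have : g n ≤ G := h3.2
        linarith)
      rwa [Int.floor_add_one] at h4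
  rw [← Finset.sum_fiberwise_of_maps_to hmaps]
  refine (norm_sum_le _ _).trans ?_
  refine (Finset.sum_le_card_nsmul _ _ _ (fun k _ => hfib k)).trans ?_
  rw [nsmul_eq_mul, Int.card_Icc]
  gcongr
  have h5 : 0 ≤ ⌊G⌋ := Int.floor_nonneg.2 hG
  have h6 : ((⌊G⌋ + 1 + 1 - 0).toNat : ℤ) = ⌊G⌋ + 2 := by omega
  have h7 : ((⌊G⌋ + 1 + 1 - 0).toNat : ℝ) = ((⌊G⌋ + 2 : ℤ) : ℝ) := by
    have := congrArg (Int.cast (R := ℝ)) h6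
    rwa [Int.cast_natCast] at this
  rw [h7]
  push_cast
  linarith [Int.floor_le G]

/-- The kernel bound. -/
lemma kernel_bound (N M : ℕ) (hN : 1 ≤ N) (hM : M ≤ 2 * N) (v : ℝ) (hv : 0 < v) :
    ‖∑ n ∈ Finset.Ico N M, ec (2 * v * Real.sqrt n)‖ ≤ 500 * ((N:ℝ) / (1 + v * Real.sqrt N) + Real.sqrt v * (N:ℝ) ^ (1/4:ℝ)) := by
  have hN' : (1:ℝ) ≤ N := by exact_mod_cast hN
  set s := Real.sqrt N with hs
  have hs1 : 1 ≤ s := by rw [hs, Real.one_le_sqrt]; exact hN'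
  have hss : s * s = N := Real.mul_self_sqrt (by linarith)
  set q := (N:ℝ) ^ (1/4:ℝ) with hq
  have hq0 : 0 < q := Real.rpow_pos_of_pos (by linarith) _
  have hqq : q * q = s := by
    rw [hq, hs, Real.sqrt_eq_rpow, ← Real.rpow_add (by linarith)]; norm_num
  set w := Real.sqrt v with hw
  have hw0 : 0 < w := Real.sqrt_pos.2 hv
  have hww : w * w = v := Real.mul_self_sqrt hv.le
  have htriv : ‖∑ n ∈ Finset.Ico N M, ec (2 * v * Real.sqrt n)‖ ≤ N := by
    refine (norm_sum_le _ _).trans ?_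
    simp only [ec_norm, Finset.sum_const, Nat.card_Ico, nsmul_eq_mul, mul_one]
    exact_mod_cast (by omega : M - N ≤ N)
  have hA0 : 0 ≤ (N:ℝ) / (1 + v * s) := by positivity
  have hB0 : 0 ≤ w * q := by positivity
  -- difference facts
  have hsq : ∀ n : ℕ, Real.sqrt n * Real.sqrt n = n := fun n => Real.mul_self_sqrt (Nat.cast_nonneg n)
  have hlow : ∀ n : ℕ, N ≤ n → s ≤ Real.sqrt n := fun n hn => Real.sqrt_le_sqrt (by exact_mod_cast hn)
  have hup : ∀ n : ℕ, n ≤ 4 * N → Real.sqrt n ≤ 2 * s := by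
    intro n hn
    have h4 : (n:ℝ) ≤ 4 * N := by exact_mod_cast hn
    rw [Real.sqrt_le_left (by positivity)]
    nlinarith
  have hdiff : ∀ n : ℕ, N ≤ n → 2 * v * Real.sqrt ((n+1:ℕ):ℝ) - 2 * v * Real.sqrt n = 2 * v / (Real.sqrt ((n+1:ℕ):ℝ) + Real.sqrt n) := by
    intro n hn
    have h1 := hsq n
    have h2 := hsq (n+1)
    have h3 := hlow n hn
    have h4 := hlow (n+1) (by omega)
    push_cast at *
    rw [eq_div_iff (by linarith)]
    linear_combination (2 * v) * (h2 - h1)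
  have hm : ∀ n, N ≤ n → n + 1 < M → v / (16 * (N * s)) ≤ (2 * v * Real.sqrt ((n+1:ℕ):ℝ) - 2 * v * Real.sqrt n) - (2 * v * Real.sqrt ((n+2:ℕ):ℝ) - 2 * v * Real.sqrt ((n+1:ℕ):ℝ)) := by
    intro n hn hn2
    rw [hdiff n hn, show n + 2 = n + 1 + 1 by ring, hdiff (n+1) (by omega)]
    have a1 := hlow n hn
    have a2 := hlow (n+1) (by omega)
    have a3 := hlow (n+1+1) (by omega)
    have b1 := hup n (by omega)
    have b2 := hup (n+1) (by omega)
    have b3 := hup (n+1+1) (by omega)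
    have c1 := hsq n
    have c3 := hsq (n+1+1)
    have c3' : Real.sqrt ((n+1+1:ℕ):ℝ) * Real.sqrt ((n+1+1:ℕ):ℝ) = n + 2 := by rw [c3]; push_cast; ring
    generalize Real.sqrt ((n+1+1:ℕ):ℝ) = z at *
    generalize Real.sqrt ((n+1:ℕ):ℝ) = y at *
    generalize Real.sqrt (n:ℝ) = x at *
    have hzx : 1 / (2 * s) ≤ z - x := by
      rw [div_le_iff₀ (by positivity)]
      have : (z - x) * (z + x) = 2 := by linear_combination c3' - c1
      have h0 : 0 ≤ z - x := by
        by_contra hneg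
        have := not_le.1 hneg
        nlinarith
      nlinarith
    have e : 2 * v / (y + x) - 2 * v / (z + y) = 2 * v * (z - x) / ((y + x) * (z + y)) := by
      have : y + x ≠ 0 := by linarith
      have : z + y ≠ 0 := by linarith
      field_simp
      ring
    rw [e]
    calc v / (16 * (N * s)) = 2 * v * (1 / (2 * s)) / ((2 * s + 2 * s) * (2 * s + 2 * s)) := by
          rw [← hss]; field_simp; ring
      _ ≤ _ := by
          apply div_le_div₀
          · apply mul_nonneg (by linarith); exact le_trans (by positivity) hzx
          · gcongr
          · apply mul_pos <;> linarith
          · apply mul_le_mul <;> linarith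
  have hg : ∀ n, N ≤ n → n < M → v / (2 * s) ≤ 2 * v * Real.sqrt ((n+1:ℕ):ℝ) - 2 * v * Real.sqrt n ∧ 2 * v * Real.sqrt ((n+1:ℕ):ℝ) - 2 * v * Real.sqrt n ≤ v / s := by
    intro n hn hn2
    rw [hdiff n hn]
    have a1 := hlow n hn
    have a2 := hlow (n+1) (by omega)
    have b1 := hup n (by omega)
    have b2 := hup (n+1) (by omega)
    constructor
    · rw [div_le_div_iff₀ (by positivity) (by linarith)]
      nlinarith
    · rw [div_le_div_iff₀ (by linarith) (by positivity)]
      nlinarith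
  have hvs : 0 < v / s := by positivity
  rcases le_total v (s / 2) with hc | hc
  · -- Kuzmin-Landau
    have hvs2 : v / s ≤ 1/2 := by rw [div_le_iff₀ (by linarith)]; linarith
    have hv2 : v / (2 * s) = (v / s) / 2 := by field_simp
    have := kuzmin_landau (fun n => 2 * v * Real.sqrt n) N M 0 (v / (2 * s)) (by positivity) (by
      intro n h1 h2
      have := hg n h1 h2
      simp only [Int.cast_zero, sub_zero]
      exact ⟨this.1, by linarith [this.2]⟩) (by
      intro n h1 h2
      have := hm n h1 h2
      have : 0 ≤ v / (16 * (N * s)) := by positivity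
      linarith)
    have h6 : 3 / (v / (2 * s)) = 6 * s / v := by field_simp; ring
    rw [h6] at this
    have key : ‖∑ n ∈ Finset.Ico N M, ec (2 * v * Real.sqrt n)‖ ≤ 12 * ((N:ℝ) / (1 + v * s)) := by
      rw [← mul_div_assoc, le_div_iff₀ (by positivity)]
      rw [le_div_iff₀ hv] at this
      nlinarith [norm_nonneg (∑ n ∈ Finset.Ico N M, ec (2 * v * Real.sqrt n))]
    linarith
  · rcases le_total (4 * (N * s)) v with hc2 | hc2
    · have : (N:ℝ) ≤ w * q := by
        apply le_of_sq_le_sq _ hB0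
        have e : (w * q) ^ 2 = v * s := by rw [← hww, ← hqq]; ring
        rw [e]
        nlinarith
      linarith
    · have hl0 : 0 < v / (16 * (N * s)) := by positivity
      have hvs2 : 1/2 ≤ v / s := by rw [le_div_iff₀ (by linarith)]; linarith
      have := second_deriv (fun n => 2 * v * Real.sqrt n) N M (v / (16 * (N * s))) (v / s) hl0 (by
        rw [div_le_iff₀ (by positivity)]; linarith) hvs.le (by
        intro n h1 h2
        have := hg n h1 h2
        exact ⟨le_trans (by positivity) this.1, this.2⟩) (fun n h1 h2 => hm n h1 h2)
      have hsl : Real.sqrt (v / (16 * (N * s))) = w / (4 * (s * q)) := by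
        rw [Real.sqrt_eq_iff_mul_self_eq hl0.le (by positivity)]
        rw [← hww, ← hss, ← hqq]
        field_simp
        ring
      rw [hsl] at this
      have e : (v / s + 3) * (9 / (w / (4 * (s * q)))) ≤ 7 * (v / s) * (9 / (w / (4 * (s * q)))) := by
        gcongr; linarith
      have e2 : 7 * (v / s) * (9 / (w / (4 * (s * q)))) = 252 * (w * q) := by
        rw [← hww]; field_simp; ring
      linarith

lemma duality (S : Finset ℕ) (a : ℕ → ℂ) (E : Set ℝ) (hE : MeasurableSet E) (hEf : volume E < ⊤)
    (κ : ℝ → ℝ) (hκc : Continuous κ) (hκ0 : ∀ v, 0 ≤ κ v) (B : ℝ) (hκb : ∀ v, κ v ≤ B) (heven : ∀ v, κ (-v) = κ v)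
    (hK : ∀ u ∈ E, ∀ u' ∈ E, ‖∑ n ∈ S, ec (2 * (u - u') * Real.sqrt n)‖ ≤ κ (u - u'))
    (M : ℝ) (hM0 : 0 ≤ M) (hM : ∀ u' ∈ E, ∫ u in E, κ (u - u') ≤ M) :
    ∫ u in E, ‖∑ n ∈ S, a n * ec (2 * u * Real.sqrt n)‖ ^ 2 ≤ (∑ n ∈ S, ‖a n‖ ^ 2) * M := by
  have : IsFiniteMeasure (volume.restrict E) := ⟨by simpa using hEf⟩
  set μ := volume.restrict E with hμ
  set F : ℝ → ℂ := fun u => ∑ n ∈ S, a n * ec (2 * u * Real.sqrt n) with hF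
  have hec : ∀ n : ℕ, Continuous fun u : ℝ => ec (2 * u * Real.sqrt n) := fun n => ec_cont.comp (by fun_prop)
  have hFc : Continuous F := by
    apply continuous_finsetSum
    intro n _
    exact continuous_const.mul (hec n)
  set B0 := ∑ n ∈ S, ‖a n‖ with hB0
  have hFb : ∀ u, ‖F u‖ ≤ B0 := by
    intro u
    refine (norm_sum_le _ _).trans (le_of_eq ?_)
    apply Finset.sum_congr rfl
    intro n _
    rw [norm_mul, ec_norm, mul_one]
  have hB00 : 0 ≤ B0 := (norm_nonneg _).trans (hFb 0)
  have hB : 0 ≤ B := (hκ0 0).trans (hκb 0)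
  set cF : ℝ → ℂ := fun u => (starRingEnd ℂ) (F u) with hcF
  have hcFc : Continuous cF := Complex.continuous_conj.comp hFc
  have hcFn : ∀ u, ‖cF u‖ = ‖F u‖ := fun u => RCLike.norm_conj _
  set w : ℕ → ℂ := fun n => ∫ u, cF u * ec (2 * u * Real.sqrt n) ∂μ with hw
  have hi1 : ∀ n : ℕ, Integrable (fun u => cF u * ec (2 * u * Real.sqrt n)) μ := by
    intro n
    refine Integrable.of_bound (hcFc.mul (hec n)).aestronglyMeasurable B0 (Filter.Eventually.of_forall fun u => ?_)
    rw [norm_mul, ec_norm, mul_one, hcFn]; exact hFb u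
  set I := ∫ u, ‖F u‖ ^ 2 ∂μ with hI
  have hI0 : 0 ≤ I := integral_nonneg fun u => by positivity
  have lin : ∀ b : ℕ → ℂ, ∑ n ∈ S, b n * w n = ∫ u, cF u * ∑ n ∈ S, b n * ec (2 * u * Real.sqrt n) ∂μ := by
    intro b
    simp_rw [hw, ← integral_const_mul]
    rw [← integral_finsetSum]
    · congr 1
      ext u
      rw [Finset.mul_sum]
      apply Finset.sum_congr rfl
      intro n _
      ring
    · intro n _
      exact (hi1 n).const_mul _
  have s1 : (I : ℂ) = ∑ n ∈ S, a n * w n := by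
    rw [lin a, hI, ← integral_complex_ofReal]
    congr 1
    ext u
    rw [hcF]
    simp only
    rw [Complex.conj_mul']
    simp [hF]
  set W := ∑ n ∈ S, ‖w n‖ ^ 2 with hW
  have s2 : I ^ 2 ≤ (∑ n ∈ S, ‖a n‖ ^ 2) * W := by
    have h1 : I ≤ ∑ n ∈ S, ‖a n‖ * ‖w n‖ := by
      have : I = ‖(I : ℂ)‖ := by rw [Complex.norm_real, Real.norm_of_nonneg hI0]
      rw [this, s1]
      refine (norm_sum_le _ _).trans (le_of_eq ?_)
      simp only [norm_mul]
    exact (pow_le_pow_left₀ hI0 h1 2).trans (Finset.sum_mul_sq_le_sq_mul_sq _ _ _)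
  set G : ℝ → ℂ := fun u => ∑ n ∈ S, (starRingEnd ℂ) (w n) * ec (2 * u * Real.sqrt n) with hG
  have s3 : (W : ℂ) = ∫ u, cF u * G u ∂μ := by
    rw [hG, ← lin, hW]
    push_cast
    apply Finset.sum_congr rfl
    intro n _
    rw [Complex.conj_mul']
  have hGf : ∀ u, G u = ∫ u', F u' * ∑ n ∈ S, ec (2 * (u - u') * Real.sqrt n) ∂μ := by
    intro u
    have : ∀ n ∈ S, (starRingEnd ℂ) (w n) * ec (2 * u * Real.sqrt n) = ∫ u', F u' * ec (2 * (u - u') * Real.sqrt n) ∂μ := by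
      intro n _
      rw [hw]
      simp only
      rw [← integral_conj, ← integral_mul_const]
      congr 1
      ext u'
      rw [map_mul, hcF]
      simp only
      rw [Complex.conj_conj, mul_assoc]
      congr 1
      have h1 : (starRingEnd ℂ) (ec (2 * u' * Real.sqrt n)) = ec (-(2 * u' * Real.sqrt n)) := by
        unfold ec
        rw [← Complex.exp_conj]
        congr 1
        simp [map_ofNat]
      rw [h1, ← ec_add]
      congr 1; ring
    rw [hG]
    simp only
    rw [Finset.sum_congr rfl this, ← integral_finsetSum]
    · congr 1
      ext u'
      rw [Finset.mul_sum]
    · intro n _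
      refine Integrable.of_bound (hFc.mul (ec_cont.comp (by fun_prop))).aestronglyMeasurable B0 (Filter.Eventually.of_forall fun u' => ?_)
      rw [norm_mul, ec_norm, mul_one]; exact hFb u'
  have hmem : ∀ᵐ u ∂μ, u ∈ E := ae_restrict_mem hE
  have hκi : ∀ (g : ℝ → ℝ) (C : ℝ), Continuous g → (∀ u, ‖g u‖ ≤ C) → Integrable g μ := fun g C hg hb =>
    Integrable.of_bound hg.aestronglyMeasurable C (Filter.Eventually.of_forall hb)
  have hFκ : ∀ u (p : ℕ), Integrable (fun u' => ‖F u'‖ ^ p * κ (u - u')) μ := by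
    intro u p
    refine hκi _ (B0 ^ p * B) (by fun_prop) fun u' => ?_
    rw [Real.norm_of_nonneg (mul_nonneg (by positivity) (hκ0 _))]
    exact mul_le_mul (pow_le_pow_left₀ (norm_nonneg _) (hFb u') p) (hκb _) (hκ0 _) (by positivity)
  have hκ1 : ∀ u, Integrable (fun u' => κ (u - u')) μ := by
    intro u; simpa using hFκ u 0
  have s4 : ∀ u ∈ E, ‖G u‖ ≤ ∫ u', ‖F u'‖ ^ 1 * κ (u - u') ∂μ := by
    intro u hu
    rw [hGf u]
    refine norm_integral_le_of_norm_le (hFκ u 1) ?_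
    filter_upwards [hmem] with u' hu'
    rw [norm_mul, pow_one]
    exact mul_le_mul_of_nonneg_left (hK u hu u' hu') (norm_nonneg _)
  have hP1 : Integrable (fun p : ℝ × ℝ => ‖F p.1‖ ^ 2 * κ (p.1 - p.2)) (μ.prod μ) := by
    refine Integrable.of_bound (by apply Continuous.aestronglyMeasurable; fun_prop) (B0 ^ 2 * B) (Filter.Eventually.of_forall fun p => ?_)
    rw [Real.norm_of_nonneg (mul_nonneg (by positivity) (hκ0 _))]
    exact mul_le_mul (pow_le_pow_left₀ (norm_nonneg _) (hFb _) 2) (hκb _) (hκ0 _) (by positivity)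
  have hP2 : Integrable (fun p : ℝ × ℝ => ‖F p.2‖ ^ 2 * κ (p.1 - p.2)) (μ.prod μ) := by
    refine Integrable.of_bound (by apply Continuous.aestronglyMeasurable; fun_prop) (B0 ^ 2 * B) (Filter.Eventually.of_forall fun p => ?_)
    rw [Real.norm_of_nonneg (mul_nonneg (by positivity) (hκ0 _))]
    exact mul_le_mul (pow_le_pow_left₀ (norm_nonneg _) (hFb _) 2) (hκb _) (hκ0 _) (by positivity)
  have hF2i : Integrable (fun u => ‖F u‖ ^ 2) μ := by
    refine hκi _ (B0 ^ 2) (by fun_prop) fun u => ?_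
    rw [Real.norm_of_nonneg (by positivity)]
    exact pow_le_pow_left₀ (norm_nonneg _) (hFb u) 2
  have q1 : ∫ u, ∫ u', ‖F u‖ ^ 2 * κ (u - u') ∂μ ∂μ ≤ M * I := by
    rw [hI, ← integral_const_mul]
    refine integral_mono_ae hP1.integral_prod_left (hF2i.const_mul M) ?_
    filter_upwards [hmem] with u hu
    rw [integral_const_mul, mul_comm]
    refine mul_le_mul_of_nonneg_right ?_ (by positivity)
    have : ∀ u', κ (u - u') = κ (u' - u) := fun u' => by rw [← heven]; congr 1; ring
    simp_rw [this]
    exact hM u hu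
  have q2 : ∫ u, ∫ u', ‖F u'‖ ^ 2 * κ (u - u') ∂μ ∂μ ≤ M * I := by
    rw [integral_integral_swap hP2, hI, ← integral_const_mul]
    refine integral_mono_ae hP2.integral_prod_right (hF2i.const_mul M) ?_
    filter_upwards [hmem] with u hu
    rw [integral_const_mul, mul_comm]
    exact mul_le_mul_of_nonneg_right (hM u hu) (by positivity)
  have s5 : W ≤ M * I := by
    have hW0 : 0 ≤ W := Finset.sum_nonneg fun n _ => by positivity
    have h1 : W ≤ ∫ u, (1/2) * (∫ u', ‖F u‖ ^ 2 * κ (u - u') ∂μ) + (1/2) * (∫ u', ‖F u'‖ ^ 2 * κ (u - u') ∂μ) ∂μ := by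
      have : W = ‖(W : ℂ)‖ := by rw [Complex.norm_real, Real.norm_of_nonneg hW0]
      rw [this, s3]
      refine norm_integral_le_of_norm_le ((hP1.integral_prod_left.const_mul _).add (hP2.integral_prod_left.const_mul _)) ?_
      filter_upwards [hmem] with u hu
      rw [norm_mul, hcFn]
      refine (mul_le_mul_of_nonneg_left (s4 u hu) (norm_nonneg _)).trans ?_
      rw [← integral_const_mul, ← integral_const_mul, ← integral_const_mul, ← integral_add]
      · refine integral_mono ((hFκ u 1).const_mul _) ?_ ?_
        · apply Integrable.add
          · apply Integrable.const_mul
            apply Integrable.const_mul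
            exact hκ1 u
          · exact (hFκ u 2).const_mul _
        · intro u'
          simp only
          have := hκ0 (u - u')
          have := sq_nonneg (‖F u‖ - ‖F u'‖)
          nlinarith
      · apply Integrable.const_mul
        apply Integrable.const_mul
        exact hκ1 u
      · exact (hFκ u 2).const_mul _
    rw [integral_add (hP1.integral_prod_left.const_mul _) (hP2.integral_prod_left.const_mul _), integral_const_mul, integral_const_mul] at h1
    linarith
  have hA : 0 ≤ ∑ n ∈ S, ‖a n‖ ^ 2 := Finset.sum_nonneg fun n _ => by positivity
  have s6 : I * I ≤ ((∑ n ∈ S, ‖a n‖ ^ 2) * M) * I := by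
    calc I * I = I ^ 2 := by ring
      _ ≤ _ := s2
      _ ≤ (∑ n ∈ S, ‖a n‖ ^ 2) * (M * I) := by gcongr
      _ = _ := by ring
  change I ≤ _
  rcases hI0.lt_or_eq with h | h
  · exact le_of_mul_le_mul_right s6 h
  · rw [← h]
    exact mul_nonneg hA hM0

lemma kernel_all (N M : ℕ) (hN : 1 ≤ N) (hM : M ≤ 2 * N) (v : ℝ) :
    ‖∑ n ∈ Finset.Ico N M, ec (2 * v * Real.sqrt n)‖ ≤ 500 * ((N:ℝ) / (1 + |v| * Real.sqrt N) + Real.sqrt |v| * (N:ℝ) ^ (1/4:ℝ)) := by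
  rcases lt_trichotomy v 0 with h | h | h
  · have := kernel_bound N M hN hM (-v) (by linarith)
    rw [abs_of_neg h]
    convert this using 1
    have e : ∑ n ∈ Finset.Ico N M, ec (2 * -v * Real.sqrt n) = (starRingEnd ℂ) (∑ n ∈ Finset.Ico N M, ec (2 * v * Real.sqrt n)) := by
      rw [map_sum]
      apply Finset.sum_congr rfl
      intro n _
      unfold ec
      rw [← Complex.exp_conj]
      congr 1
      simp [map_ofNat]
    rw [e, RCLike.norm_conj]
  · subst h
    refine (norm_sum_le _ _).trans ?_
    simp only [ec_norm, Finset.sum_const, Nat.card_Ico, nsmul_eq_mul, mul_one, abs_zero, zero_mul, add_zero, Real.sqrt_zero, div_one]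
    have : ((M - N : ℕ) : ℝ) ≤ N := by exact_mod_cast (by omega : M - N ≤ N)
    have : (0:ℝ) ≤ N := Nat.cast_nonneg _
    linarith
  · rw [abs_of_pos h]; exact kernel_bound N M hN hM v h

lemma kint_half (s r U : ℝ) (hs : 0 < s) (hr : 0 ≤ r) (hrU : r ≤ U) :
    ∫ v in (0:ℝ)..r, s * s / (1 + |v| * s) ≤ s * Real.log (1 + U * s) := by
  have h : ∫ v in (0:ℝ)..r, s * s / (1 + |v| * s) = s * Real.log (1 + r * s) - s * Real.log (1 + 0 * s) := by
    rw [← intervalIntegral.integral_eq_sub_of_hasDerivAt (f := fun v => s * Real.log (1 + v * s)) (f' := fun v => s * s / (1 + |v| * s))]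
    · intro v hv
      rw [Set.uIcc_of_le hr] at hv
      have h0 : 0 < 1 + v * s := by have := mul_nonneg hv.1 hs.le; linarith
      have h1 : HasDerivAt (fun v : ℝ => 1 + v * s) s v := by
        simpa using ((hasDerivAt_id v).mul_const s).const_add 1
      have := (h1.log h0.ne').const_mul s
      rw [abs_of_nonneg hv.1]
      convert! this using 1
      ring
    · apply Continuous.intervalIntegrable
      apply Continuous.div (by fun_prop) (by fun_prop)
      intro v; positivity
  rw [h, zero_mul, add_zero, Real.log_one, mul_zero, sub_zero]
  gcongr

lemma kint (s U α u' : ℝ) (E : Set ℝ) (hs : 0 < s) (hE : E ⊆ Set.Icc α (α + U)) (hu : u' ∈ E) :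
    ∫ u in E, s * s / (1 + |u - u'| * s) ≤ 2 * (s * Real.log (1 + U * s)) := by
  have hc : Continuous fun v : ℝ => s * s / (1 + |v| * s) := by
    apply Continuous.div (by fun_prop) (by fun_prop)
    intro v; positivity
  have hu' := hE hu
  have hU : α ≤ α + U := hu'.1.trans hu'.2
  have h1 : ∫ u in E, s * s / (1 + |u - u'| * s) ≤ ∫ u in Set.Icc α (α + U), s * s / (1 + |u - u'| * s) := by
    apply setIntegral_mono_set
    · exact (hc.comp (continuous_id.sub continuous_const)).continuousOn.integrableOn_Icc
    · exact Filter.Eventually.of_forall fun u => by simp only [Pi.zero_apply]; positivity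
    · exact LE.le.eventuallyLE hE
  refine h1.trans ?_
  rw [integral_Icc_eq_integral_Ioc, ← intervalIntegral.integral_of_le hU]
  rw [intervalIntegral.integral_comp_sub_right (fun v => s * s / (1 + |v| * s)) u']
  rw [← intervalIntegral.integral_add_adjacent_intervals (b := 0) (hc.intervalIntegrable _ _) (hc.intervalIntegrable _ _)]
  have h2 := kint_half s (α + U - u') U hs (by linarith [hu'.2]) (by linarith [hu'.1])
  have h3 := kint_half s (u' - α) U hs (by linarith [hu'.1]) (by linarith [hu'.2])
  have h4 : ∫ v in (α - u')..0, s * s / (1 + |v| * s) = ∫ v in (0:ℝ)..(u' - α), s * s / (1 + |v| * s) := by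
    have := intervalIntegral.integral_comp_neg (fun v => s * s / (1 + |v| * s)) (a := 0) (b := u' - α)
    simp only [abs_neg, neg_zero, neg_sub] at this
    exact this.symm
  rw [h4]
  linarith

lemma F_cont (S : Finset ℕ) (a : ℕ → ℂ) : Continuous fun u : ℝ => ∑ n ∈ S, a n * ec (2 * u * Real.sqrt n) := by
  apply continuous_finsetSum
  intro n _
  exact continuous_const.mul (ec_cont.comp (by fun_prop))

lemma large_short (N M : ℕ) (hN : 1 ≤ N) (hM : M ≤ 2 * N) (a : ℕ → ℂ)
    (ha : ∀ n ∈ Finset.Ico N M, ‖a n‖ ≤ (N:ℝ) ^ (-(3/4):ℝ)) (V U α : ℝ) (hV : 0 < V) (hU : 0 < U) :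
    V ^ 2 * volume.real {u ∈ Set.Icc α (α + U) | V < ‖∑ n ∈ Finset.Ico N M, a n * ec (2 * u * Real.sqrt n)‖} ≤
      1000 * Real.log (1 + U * Real.sqrt N) + 500 * volume.real {u ∈ Set.Icc α (α + U) | V < ‖∑ n ∈ Finset.Ico N M, a n * ec (2 * u * Real.sqrt n)‖} * (Real.sqrt U / (N:ℝ) ^ (1/4:ℝ)) := by
  set F : ℝ → ℂ := fun u => ∑ n ∈ Finset.Ico N M, a n * ec (2 * u * Real.sqrt n) with hF
  have hFc : Continuous F := F_cont _ _
  set E := {u ∈ Set.Icc α (α + U) | V < ‖F u‖} with hEd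
  have hE : MeasurableSet E := measurableSet_Icc.inter (measurableSet_lt measurable_const hFc.norm.measurable)
  have hsub : E ⊆ Set.Icc α (α + U) := fun u hu => hu.1
  have hEf : volume E < ⊤ := (measure_mono hsub).trans_lt (by simp)
  have hN' : (1:ℝ) ≤ N := by exact_mod_cast hN
  set s := Real.sqrt N with hs
  have hs1 : 1 ≤ s := by rw [hs, Real.one_le_sqrt]; exact hN'
  have hss : s * s = N := Real.mul_self_sqrt (by linarith)
  set q := (N:ℝ) ^ (1/4:ℝ) with hq
  have hq0 : 0 < q := Real.rpow_pos_of_pos (by linarith) _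
  have hqq : q * q = s := by
    rw [hq, hs, Real.sqrt_eq_rpow, ← Real.rpow_add (by linarith)]; norm_num
  set κ : ℝ → ℝ := fun v => 500 * (s * s / (1 + |v| * s) + Real.sqrt U * q) with hκ
  have hc1 : Continuous fun v : ℝ => s * s / (1 + |v| * s) := by
    apply Continuous.div (by fun_prop) (by fun_prop)
    intro v; positivity
  set m := volume.real E with hm
  have hm0 : 0 ≤ m := measureReal_nonneg
  have : IsFiniteMeasure (volume.restrict E) := ⟨by simpa using hEf⟩
  have hle : ∀ v : ℝ, s * s / (1 + |v| * s) ≤ s * s := by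
    intro v
    apply div_le_self (by positivity)
    have : 0 ≤ |v| * s := by positivity
    linarith
  have hD := duality (Finset.Ico N M) a E hE hEf κ (by fun_prop) (fun v => by positivity) (500 * (s * s + Real.sqrt U * q))
    (fun v => by have := hle v; rw [hκ]; simp only; linarith) (fun v => by rw [hκ]; simp)
    (by
      intro u hu u' hu'
      have k := kernel_all N M hN hM (u - u')
      refine k.trans ?_
      rw [hκ]
      simp only
      rw [hss]
      have h1 := hsub hu
      have h2 := hsub hu'
      have : |u - u'| ≤ U := by rw [abs_le]; constructor <;> linarith [h1.1, h1.2, h2.1, h2.2]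
      gcongr)
    (500 * (2 * (s * Real.log (1 + U * s)) + m * (Real.sqrt U * q)))
    (by
      have : 0 ≤ Real.log (1 + U * s) := Real.log_nonneg (by have : 0 ≤ U * s := by positivity
                                                             linarith)
      positivity)
    (by
      intro u' hu'
      have hi : Integrable (fun u => s * s / (1 + |u - u'| * s)) (volume.restrict E) := by
        refine Integrable.of_bound (hc1.comp (continuous_id.sub continuous_const)).aestronglyMeasurable (s * s) (Filter.Eventually.of_forall fun u => ?_)
        rw [Real.norm_of_nonneg (by positivity)]
        exact hle _
      rw [hκ]
      simp only
      rw [integral_const_mul, integral_add hi (integrable_const _), setIntegral_const, smul_eq_mul]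
      have := kint s U α u' E (by linarith) hsub hu'
      linarith)
  have hsum : ∑ n ∈ Finset.Ico N M, ‖a n‖ ^ 2 ≤ 1 / s := by
    have hterm : ∀ n ∈ Finset.Ico N M, ‖a n‖ ^ 2 ≤ ((N:ℝ) ^ (-(3/4):ℝ)) ^ 2 := fun n hn => pow_le_pow_left₀ (norm_nonneg _) (ha n hn) 2
    refine (Finset.sum_le_card_nsmul _ _ _ hterm).trans ?_
    rw [nsmul_eq_mul, Nat.card_Ico]
    have h1 : ((M - N : ℕ) : ℝ) ≤ N := by exact_mod_cast (by omega : M - N ≤ N)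
    calc _ ≤ (N:ℝ) * ((N:ℝ) ^ (-(3/4):ℝ)) ^ 2 := by gcongr
      _ = (N:ℝ) ^ (1:ℝ) * (N:ℝ) ^ (-(3/2):ℝ) := by
          rw [Real.rpow_one, ← Real.rpow_natCast, ← Real.rpow_mul (by linarith)]; norm_num
      _ = 1 / s := by
          rw [← Real.rpow_add (by linarith), hs, Real.sqrt_eq_rpow, one_div, ← Real.rpow_neg (by linarith)]; norm_num
  have hlow : V ^ 2 * m ≤ ∫ u in E, ‖F u‖ ^ 2 := by
    have : V ^ 2 * m = ∫ u in E, V ^ 2 := by rw [setIntegral_const, smul_eq_mul, mul_comm]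
    rw [this]
    apply setIntegral_mono_on (integrable_const _) _ hE
    · intro u hu
      exact pow_le_pow_left₀ hV.le hu.2.le 2
    · exact ((hFc.norm.pow 2).continuousOn.integrableOn_Icc).mono_set hsub
  have hM0 : 0 ≤ 500 * (2 * (s * Real.log (1 + U * s)) + m * (Real.sqrt U * q)) := by
    have : 0 ≤ Real.log (1 + U * s) := Real.log_nonneg (by have : 0 ≤ U * s := by positivity
                                                           linarith)
    positivity
  refine hlow.trans (hD.trans ((mul_le_mul_of_nonneg_right hsum hM0).trans (le_of_eq ?_)))
  rw [← hqq]
  field_simp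
  ring

lemma large_values (N M : ℕ) (hN : 1 ≤ N) (hM : M ≤ 2 * N) (a : ℕ → ℂ)
    (ha : ∀ n ∈ Finset.Ico N M, ‖a n‖ ≤ (N:ℝ) ^ (-(3/4):ℝ)) (V X α : ℝ) (hV : 0 < V) (hX : 0 ≤ X) (hVN : V ≤ (N:ℝ) ^ (1/4:ℝ)) :
    volume.real {u ∈ Set.Icc α (α + X) | V < ‖∑ n ∈ Finset.Ico N M, a n * ec (2 * u * Real.sqrt n)‖} ≤
      10 ^ 10 * Real.log (1 + (N:ℝ) ^ 2) * (1 / V ^ 2 + X / (V ^ 6 * Real.sqrt N)) := by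
  set F : ℝ → ℂ := fun u => ∑ n ∈ Finset.Ico N M, a n * ec (2 * u * Real.sqrt n) with hF
  have hFc : Continuous F := F_cont _ _
  have hN' : (1:ℝ) ≤ N := by exact_mod_cast hN
  set s := Real.sqrt N with hs
  have hs1 : 1 ≤ s := by rw [hs, Real.one_le_sqrt]; exact hN'
  have hss : s * s = N := Real.mul_self_sqrt (by linarith)
  set q := (N:ℝ) ^ (1/4:ℝ) with hq
  have hq0 : 0 < q := Real.rpow_pos_of_pos (by linarith) _
  have hqq : q * q = s := by
    rw [hq, hs, Real.sqrt_eq_rpow, ← Real.rpow_add (by linarith)]; norm_num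
  set U := V ^ 4 * s / 10 ^ 6 with hU
  have hU0 : 0 < U := by positivity
  set L := Real.log (1 + (N:ℝ) ^ 2) with hL
  have hL0 : 0 ≤ L := Real.log_nonneg (by have := sq_nonneg (N:ℝ); linarith)
  have hsU : Real.sqrt U = V ^ 2 * q / 1000 := by
    rw [Real.sqrt_eq_iff_mul_self_eq hU0.le (by positivity), hU, ← hqq]; ring
  have hV4 : V ^ 4 ≤ N := by
    calc V ^ 4 ≤ q ^ 4 := pow_le_pow_left₀ hV.le hVN 4
      _ = (q * q) * (q * q) := by ring
      _ = N := by rw [hqq, hss]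
  have hUs : Real.log (1 + U * s) ≤ L := by
    apply Real.log_le_log (by positivity)
    have e : U * s = V ^ 4 * N / 10 ^ 6 := by rw [hU, ← hss]; ring
    rw [e]
    have : V ^ 4 * N ≤ N * N := by gcongr
    have : 0 ≤ V ^ 4 * (N:ℝ) := by positivity
    nlinarith
  have hshort : ∀ β, volume.real {u ∈ Set.Icc β (β + U) | V < ‖F u‖} ≤ 2000 * L / V ^ 2 := by
    intro β
    have := large_short N M hN hM a ha V U β hV hU0
    change V ^ 2 * volume.real {u ∈ Set.Icc β (β + U) | V < ‖F u‖} ≤ 1000 * Real.log (1 + U * s) + 500 * volume.real {u ∈ Set.Icc β (β + U) | V < ‖F u‖} * (Real.sqrt U / q) at this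
    rw [hsU] at this
    have e : V ^ 2 * q / 1000 / q = V ^ 2 / 1000 := by field_simp
    rw [e] at this
    rw [le_div_iff₀ (by positivity)]
    nlinarith
  set m := ⌊X / U⌋₊ + 1 with hm
  have hcov : {u ∈ Set.Icc α (α + X) | V < ‖F u‖} ⊆ ⋃ i ∈ Finset.range m, {u ∈ Set.Icc (α + i * U) (α + i * U + U) | V < ‖F u‖} := by
    rintro u ⟨⟨h1, h2⟩, h3⟩
    simp only [Set.mem_iUnion]
    have h0 : 0 ≤ (u - α) / U := by apply div_nonneg <;> linarith
    refine ⟨⌊(u - α) / U⌋₊, ?_, ⟨?_, ?_⟩, h3⟩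
    · rw [Finset.mem_range, hm]
      apply Nat.lt_succ_of_le
      apply Nat.floor_mono
      gcongr
      linarith
    · have := Nat.floor_le h0
      rw [le_div_iff₀ hU0] at this
      linarith
    · have := (Nat.lt_floor_add_one ((u - α) / U)).le
      rw [div_le_iff₀ hU0] at this
      linarith
  have h1 : volume.real {u ∈ Set.Icc α (α + X) | V < ‖F u‖} ≤ ∑ i ∈ Finset.range m, volume.real {u ∈ Set.Icc (α + i * U) (α + i * U + U) | V < ‖F u‖} := by
    refine (measureReal_mono hcov ?_).trans (measureReal_biUnion_finset_le _ _)
    refine ((measure_biUnion_finset_le _ _).trans_lt ?_).ne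
    apply ENNReal.sum_lt_top.2
    intro i _
    exact (measure_mono (fun u hu => hu.1 : _ ⊆ Set.Icc (α + i * U) (α + i * U + U))).trans_lt (by simp)
  refine h1.trans ((Finset.sum_le_card_nsmul _ _ _ (fun i _ => hshort _)).trans ?_)
  rw [nsmul_eq_mul, Finset.card_range, hm]
  push_cast
  have h2 : (⌊X / U⌋₊ : ℝ) ≤ X / U := Nat.floor_le (by positivity)
  calc _ ≤ (X / U + 1) * (2000 * L / V ^ 2) := by gcongr
    _ = L * (2000 * (1 / V ^ 2) + 2 * 10 ^ 9 * (X / (V ^ 6 * s))) := by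
        rw [hU]; field_simp; ring
    _ ≤ L * (10 ^ 10 * (1 / V ^ 2) + 10 ^ 10 * (X / (V ^ 6 * s))) := by
        gcongr <;> norm_num
    _ = _ := by ring

lemma layer (f V0 : ℝ) (p L : ℕ) (hf : 0 ≤ f) (hV0 : 0 < V0) (h : f ≤ 2 ^ L * V0) :
    f ^ p ≤ V0 ^ p + ∑ k ∈ Finset.range L, (2 * (2 ^ k * V0)) ^ p * (if 2 ^ k * V0 < f then 1 else 0) := by
  induction L with
  | zero => simp at h ⊢; exact pow_le_pow_left₀ hf h p
  | succ L ih =>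
    rw [Finset.sum_range_succ]
    have h0 : 0 ≤ ∑ k ∈ Finset.range L, (2 * (2 ^ k * V0)) ^ p * (if 2 ^ k * V0 < f then (1:ℝ) else 0) := by
      apply Finset.sum_nonneg
      intro k _
      apply mul_nonneg (by positivity)
      split_ifs <;> norm_num
    by_cases hc : 2 ^ L * V0 < f
    · rw [if_pos hc, mul_one]
      have : f ^ p ≤ (2 * (2 ^ L * V0)) ^ p := by
        apply pow_le_pow_left₀ hf
        rw [pow_succ] at h
        linarith
      have : 0 ≤ V0 ^ p := by positivity
      linarith
    · rw [if_neg hc, mul_zero, add_zero]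
      exact ih (not_lt.1 hc)

lemma moment_gen (N M : ℕ) (hN : 1 ≤ N) (hM : M ≤ 2 * N) (a : ℕ → ℂ)
    (ha : ∀ n ∈ Finset.Ico N M, ‖a n‖ ≤ (N:ℝ) ^ (-(3/4):ℝ)) (X α : ℝ) (hX : 0 ≤ X) (V0 : ℝ) (hV0 : 0 < V0) (p L : ℕ)
    (hL1 : (N:ℝ) ^ (1/4:ℝ) ≤ 2 ^ L * V0) (hL2 : ∀ k < L, 2 ^ k * V0 ≤ (N:ℝ) ^ (1/4:ℝ)) :
    ∫ u in Set.Icc α (α + X), ‖∑ n ∈ Finset.Ico N M, a n * ec (2 * u * Real.sqrt n)‖ ^ p ≤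
      V0 ^ p * X + ∑ k ∈ Finset.range L, (2 * (2 ^ k * V0)) ^ p * (10 ^ 10 * Real.log (1 + (N:ℝ) ^ 2) * (1 / (2 ^ k * V0) ^ 2 + X / ((2 ^ k * V0) ^ 6 * Real.sqrt N))) := by
  set F : ℝ → ℂ := fun u => ∑ n ∈ Finset.Ico N M, a n * ec (2 * u * Real.sqrt n) with hF
  have hFc : Continuous F := F_cont _ _
  have hN' : (1:ℝ) ≤ N := by exact_mod_cast hN
  have hFb : ∀ u, ‖F u‖ ≤ (N:ℝ) ^ (1/4:ℝ) := by
    intro u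
    refine (norm_sum_le _ _).trans ?_
    have hterm : ∀ n ∈ Finset.Ico N M, ‖a n * ec (2 * u * Real.sqrt n)‖ ≤ (N:ℝ) ^ (-(3/4):ℝ) := fun n hn => by
      rw [norm_mul, ec_norm, mul_one]; exact ha n hn
    refine (Finset.sum_le_card_nsmul _ _ _ hterm).trans ?_
    rw [nsmul_eq_mul, Nat.card_Ico]
    have h1 : ((M - N : ℕ) : ℝ) ≤ N := by exact_mod_cast (by omega : M - N ≤ N)
    calc _ ≤ (N:ℝ) ^ (1:ℝ) * (N:ℝ) ^ (-(3/4):ℝ) := by rw [Real.rpow_one]; gcongr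
      _ = _ := by rw [← Real.rpow_add (by linarith)]; norm_num
  have hmeas : ∀ V : ℝ, MeasurableSet {u | V < ‖F u‖} := fun V => measurableSet_lt measurable_const hFc.norm.measurable
  have hi : ∀ V : ℝ, IntegrableOn (fun u => if V < ‖F u‖ then (1:ℝ) else 0) (Set.Icc α (α + X)) := by
    intro V
    have : (fun u => if V < ‖F u‖ then (1:ℝ) else 0) = Set.indicator {u | V < ‖F u‖} (fun _ => 1) := by
      ext u; simp [Set.indicator]
    rw [this]
    exact (integrable_const (1:ℝ)).indicator (hmeas V)
  have hIntg : ∀ V : ℝ, ∫ u in Set.Icc α (α + X), (if V < ‖F u‖ then (1:ℝ) else 0) = volume.real {u ∈ Set.Icc α (α + X) | V < ‖F u‖} := by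
    intro V
    have : (fun u => if V < ‖F u‖ then (1:ℝ) else 0) = Set.indicator {u | V < ‖F u‖} (fun _ => 1) := by
      ext u; simp [Set.indicator]
    rw [this, integral_indicator (hmeas V), setIntegral_const, smul_eq_mul, mul_one, measureReal_restrict_apply (hmeas V), Set.inter_comm]
    rfl
  calc _ ≤ ∫ u in Set.Icc α (α + X), (V0 ^ p + ∑ k ∈ Finset.range L, (2 * (2 ^ k * V0)) ^ p * (if 2 ^ k * V0 < ‖F u‖ then 1 else 0)) := by
        apply setIntegral_mono
        · exact (hFc.norm.pow p).continuousOn.integrableOn_Icc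
        · exact (integrable_const _).add (integrable_finsetSum _ fun k _ => (hi _).const_mul _)
        · intro u
          exact layer _ V0 p L (norm_nonneg _) hV0 ((hFb u).trans hL1)
    _ = V0 ^ p * X + ∑ k ∈ Finset.range L, (2 * (2 ^ k * V0)) ^ p * volume.real {u ∈ Set.Icc α (α + X) | 2 ^ k * V0 < ‖F u‖} := by
        rw [integral_add (integrable_const _) (integrable_finsetSum _ fun k _ => (hi _).const_mul _), integral_finsetSum _ (fun k _ => (hi _).const_mul _), setIntegral_const]
        congr 1
        · simp [hX, mul_comm]
        · apply Finset.sum_congr rfl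
          intro k _
          rw [integral_const_mul, hIntg]
    _ ≤ _ := by
        gcongr with k hk
        exact large_values N M hN hM a ha (2 ^ k * V0) X α (by positivity) hX (hL2 k (Finset.mem_range.1 hk))

lemma exists_L (ρ : ℝ) (hρ : 1 ≤ ρ) : ∃ L : ℕ, ρ ≤ 2 ^ L ∧ (∀ k < L, (2:ℝ) ^ k ≤ ρ) ∧ (L:ℝ) ≤ 1 + 2 * Real.log ρ := by
  have hex : ∃ L : ℕ, ρ ≤ 2 ^ L := by
    obtain ⟨L, hL⟩ := pow_unbounded_of_one_lt ρ (show (1:ℝ) < 2 by norm_num)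
    exact ⟨L, hL.le⟩
  classical
  have hk : ∀ k < Nat.find hex, (2:ℝ) ^ k ≤ ρ := fun k hk => (not_le.1 (Nat.find_min hex hk)).le
  refine ⟨Nat.find hex, Nat.find_spec hex, hk, ?_⟩
  have hlog := Real.log_nonneg hρ
  rcases Nat.eq_zero_or_pos (Nat.find hex) with h | h
  · rw [h]; push_cast; linarith
  · have h1 := hk (Nat.find hex - 1) (by omega)
    have h2 := Real.log_le_log (by positivity) h1
    rw [Real.log_pow] at h2
    have h3 : ((Nat.find hex - 1 : ℕ) : ℝ) = (Nat.find hex : ℝ) - 1 := by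
      rw [Nat.cast_sub h]; norm_num
    rw [h3] at h2
    have h4 := Real.log_two_gt_d9
    have h5 : (1:ℝ) ≤ (Nat.find hex : ℝ) := by exact_mod_cast h
    nlinarith

lemma logs (N : ℕ) (hN : 1 ≤ N) (T : ℝ) (hT : 10 ≤ T) (hNT : (N:ℝ) ≤ T) :
    1 ≤ Real.log T ∧ Real.log (1 + (N:ℝ) ^ 2) ≤ 3 * Real.log T ∧ 0 ≤ Real.log N ∧ Real.log N ≤ Real.log T ∧ 0 ≤ Real.log (1 + (N:ℝ) ^ 2) := by
  have hN' : (1:ℝ) ≤ N := by exact_mod_cast hN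
  refine ⟨?_, ?_, Real.log_nonneg hN', Real.log_le_log (by linarith) hNT, Real.log_nonneg (by have := sq_nonneg (N:ℝ); linarith)⟩
  · rw [Real.le_log_iff_exp_le (by linarith)]
    linarith [Real.exp_one_lt_d9]
  · have : 3 * Real.log T = Real.log (T ^ 3) := by rw [Real.log_pow]; norm_num
    rw [this]
    apply Real.log_le_log (by positivity)
    nlinarith [mul_nonneg (show (0:ℝ) ≤ N by linarith) (show (0:ℝ) ≤ T by linarith), sq_nonneg T]

lemma mom8 (N M : ℕ) (hN : 1 ≤ N) (hM : M ≤ 2 * N) (a : ℕ → ℂ)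
    (ha : ∀ n ∈ Finset.Ico N M, ‖a n‖ ≤ (N:ℝ) ^ (-(3/4):ℝ)) (X α : ℝ) (hX : 0 ≤ X) (T : ℝ) (hT : 10 ≤ T) (hNT : (N:ℝ) ≤ T) :
    ∫ u in Set.Icc α (α + X), ‖∑ n ∈ Finset.Ico N M, a n * ec (2 * u * Real.sqrt n)‖ ^ 8 ≤
      10 ^ 15 * Real.log T ^ 2 * (X + (N:ℝ) ^ (3/2:ℝ)) := by
  have hN' : (1:ℝ) ≤ N := by exact_mod_cast hN
  obtain ⟨l1, l2, l3, l4, l5⟩ := logs N hN T hT hNT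
  set q := (N:ℝ) ^ (1/4:ℝ) with hq
  have hq1 : 1 ≤ q := Real.one_le_rpow hN' (by norm_num)
  have hs : Real.sqrt N = q ^ 2 := by
    rw [hq, Real.sqrt_eq_rpow, ← Real.rpow_natCast, ← Real.rpow_mul (by linarith)]; norm_num
  have hq6 : (N:ℝ) ^ (3/2:ℝ) = q ^ 6 := by
    rw [hq, ← Real.rpow_natCast, ← Real.rpow_mul (by linarith)]; norm_num
  obtain ⟨L, L1, L2, L3⟩ := exists_L q hq1
  have hlq : Real.log q ≤ Real.log N / 4 := by rw [hq, Real.log_rpow (by linarith)]; linarith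
  have h := moment_gen N M hN hM a ha X α hX 1 one_pos 8 L (by rwa [mul_one]) (fun k hk => by rw [mul_one]; exact L2 k hk)
  refine h.trans ?_
  rw [hs, hq6]
  have hterm : ∀ k ∈ Finset.range L, (2 * (2 ^ k * (1:ℝ))) ^ 8 * (10 ^ 10 * Real.log (1 + (N:ℝ) ^ 2) * (1 / (2 ^ k * 1) ^ 2 + X / ((2 ^ k * 1) ^ 6 * q ^ 2))) ≤ 256 * 10 ^ 10 * (3 * Real.log T) * (X + q ^ 6) := by
    intro k hk
    have hk' := L2 k (Finset.mem_range.1 hk)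
    rw [mul_one]
    have hv0 : (0:ℝ) < 2 ^ k := by positivity
    generalize (2:ℝ) ^ k = v at *
    have e : (2 * v) ^ 8 * (10 ^ 10 * Real.log (1 + (N:ℝ) ^ 2) * (1 / v ^ 2 + X / (v ^ 6 * q ^ 2))) = 256 * 10 ^ 10 * Real.log (1 + (N:ℝ) ^ 2) * (X * (v ^ 2 / q ^ 2) + v ^ 6) := by
      field_simp; ring
    rw [e]
    have h1 : v ^ 2 / q ^ 2 ≤ 1 := by
      rw [div_le_one (by positivity)]; gcongr
    calc _ ≤ 256 * 10 ^ 10 * (3 * Real.log T) * (X * 1 + q ^ 6) := by gcongr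
      _ = _ := by ring
  have hsum := Finset.sum_le_card_nsmul _ _ _ hterm
  rw [nsmul_eq_mul, Finset.card_range] at hsum
  have hLT : (L:ℝ) ≤ 2 * Real.log T := by linarith
  have h0 : 0 ≤ X + q ^ 6 := by positivity
  have h2 : (L:ℝ) * (256 * 10 ^ 10 * (3 * Real.log T) * (X + q ^ 6)) ≤ 2 * Real.log T * (256 * 10 ^ 10 * (3 * Real.log T) * (X + q ^ 6)) := by gcongr
  have h3 : X ≤ Real.log T ^ 2 * (X + q ^ 6) := by
    have : 1 ≤ Real.log T ^ 2 := one_le_pow₀ l1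
    have : 0 ≤ q ^ 6 := by positivity
    nlinarith
  have h4 : 0 ≤ Real.log T ^ 2 * (X + q ^ 6) := by positivity
  rw [one_pow, one_mul]
  nlinarith

lemma mom4 (N M : ℕ) (hN : 1 ≤ N) (hM : M ≤ 2 * N) (a : ℕ → ℂ)
    (ha : ∀ n ∈ Finset.Ico N M, ‖a n‖ ≤ (N:ℝ) ^ (-(3/4):ℝ)) (X α : ℝ) (hX : 0 ≤ X) (T : ℝ) (hT : 10 ≤ T) (hNT : (N:ℝ) ≤ T) :
    ∫ u in Set.Icc α (α + X), ‖∑ n ∈ Finset.Ico N M, a n * ec (2 * u * Real.sqrt n)‖ ^ 4 ≤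
      10 ^ 15 * Real.log T ^ 2 * (X * (N:ℝ) ^ (-(1/3):ℝ) + (N:ℝ) ^ (1/2:ℝ)) := by
  have hN' : (1:ℝ) ≤ N := by exact_mod_cast hN
  obtain ⟨l1, l2, l3, l4, l5⟩ := logs N hN T hT hNT
  set r := (N:ℝ) ^ (1/12:ℝ) with hr
  have hr1 : 1 ≤ r := Real.one_le_rpow hN' (by norm_num)
  have hq : (N:ℝ) ^ (1/4:ℝ) = r ^ 3 := by
    rw [hr, ← Real.rpow_natCast, ← Real.rpow_mul (by linarith)]; norm_num
  have hs : Real.sqrt N = r ^ 6 := by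
    rw [hr, Real.sqrt_eq_rpow, ← Real.rpow_natCast, ← Real.rpow_mul (by linarith)]; norm_num
  have hs' : (N:ℝ) ^ (1/2:ℝ) = r ^ 6 := by rw [← Real.sqrt_eq_rpow, hs]
  have hr4 : (N:ℝ) ^ (-(1/3):ℝ) = 1 / r ^ 4 := by
    rw [Real.rpow_neg (by linarith), hr, ← Real.rpow_natCast, ← Real.rpow_mul (by linarith), one_div]; norm_num
  obtain ⟨L, L1, L2, L3⟩ := exists_L (r ^ 4) (one_le_pow₀ hr1)
  have hlq : Real.log (r ^ 4) ≤ Real.log N / 3 := by rw [Real.log_pow, hr, Real.log_rpow (by linarith)]; push_cast; linarith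
  have h := moment_gen N M hN hM a ha X α hX (1 / r) (by positivity) 4 L (by
      rw [hq, mul_one_div, le_div_iff₀ (by positivity)]; calc r ^ 3 * r = r ^ 4 := by ring
                                                          _ ≤ _ := L1) (fun k hk => by
      rw [hq, mul_one_div, div_le_iff₀ (by positivity)]; calc _ ≤ r ^ 4 := L2 k hk
                                                          _ = r ^ 3 * r := by ring)
  refine h.trans ?_
  rw [hs, hs', hr4]
  have hterm : ∀ k ∈ Finset.range L, (2 * (2 ^ k * (1 / r))) ^ 4 * (10 ^ 10 * Real.log (1 + (N:ℝ) ^ 2) * (1 / (2 ^ k * (1 / r)) ^ 2 + X / ((2 ^ k * (1 / r)) ^ 6 * r ^ 6))) ≤ 16 * 10 ^ 10 * (3 * Real.log T) * (X * (1 / r ^ 4) + r ^ 6) := by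
    intro k hk
    have hk' := L2 k (Finset.mem_range.1 hk)
    have hv1 : (1:ℝ) ≤ 2 ^ k := one_le_pow₀ (by norm_num)
    generalize (2:ℝ) ^ k = v at *
    have e : (2 * (v * (1 / r))) ^ 4 * (10 ^ 10 * Real.log (1 + (N:ℝ) ^ 2) * (1 / (v * (1 / r)) ^ 2 + X / ((v * (1 / r)) ^ 6 * r ^ 6))) = 16 * 10 ^ 10 * Real.log (1 + (N:ℝ) ^ 2) * (X * (1 / r ^ 4) * (1 / v ^ 2) + v ^ 2 / r ^ 2) := by
      field_simp; ring
    rw [e]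
    have h1 : 1 / v ^ 2 ≤ 1 := by
      rw [div_le_one (by positivity)]; exact one_le_pow₀ hv1
    have h2 : v ^ 2 / r ^ 2 ≤ r ^ 6 := by
      rw [div_le_iff₀ (by positivity)]
      calc v ^ 2 ≤ (r ^ 4) ^ 2 := by gcongr
        _ = _ := by ring
    calc _ ≤ 16 * 10 ^ 10 * (3 * Real.log T) * (X * (1 / r ^ 4) * 1 + r ^ 6) := by gcongr
      _ = _ := by ring
  have hsum := Finset.sum_le_card_nsmul _ _ _ hterm
  rw [nsmul_eq_mul, Finset.card_range] at hsum
  have hLT : (L:ℝ) ≤ 2 * Real.log T := by linarith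
  have e1 : (1 / r) ^ 4 * X = X * (1 / r ^ 4) := by rw [div_pow, one_pow]; ring
  rw [e1]
  set Z := X * (1 / r ^ 4) with hZ
  have hZ0 : 0 ≤ Z := by positivity
  have h0 : 0 ≤ Z + r ^ 6 := by positivity
  have h2 : (L:ℝ) * (16 * 10 ^ 10 * (3 * Real.log T) * (Z + r ^ 6)) ≤ 2 * Real.log T * (16 * 10 ^ 10 * (3 * Real.log T) * (Z + r ^ 6)) := by gcongr
  have h3 : Z ≤ Real.log T ^ 2 * (Z + r ^ 6) := by
    have : 1 ≤ Real.log T ^ 2 := one_le_pow₀ l1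
    have : 0 ≤ r ^ 6 := by positivity
    nlinarith
  have h4 : 0 ≤ Real.log T ^ 2 * (Z + r ^ 6) := by positivity
  nlinarith

lemma dyad_split (c : ℕ → ℂ) (J : ℕ) : ∑ n ∈ Finset.Ico 1 (2 ^ J), c n = ∑ j ∈ Finset.range J, ∑ n ∈ Finset.Ico (2 ^ j) (2 * 2 ^ j), c n := by
  induction J with
  | zero => simp
  | succ J ih =>
    rw [Finset.sum_range_succ, ← ih, Finset.sum_Ico_consecutive _ Nat.one_le_two_pow (by omega)]
    congr 2
    rw [pow_succ]; ring

lemma dyadic (p : ℕ) (Y M : ℕ) (T : ℝ) (hT : 10 ≤ T) (hMT : (M:ℝ) ≤ T) (c : ℕ → ℂ) (D : ℝ) (hD : 0 < D)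
    (hc : ∀ n : ℕ, 1 ≤ n → n ≤ M → ‖c n‖ ≤ D * (n:ℝ) ^ (-(3/4):ℝ)) (α X Bd : ℝ) (hBd : 0 ≤ Bd)
    (hB : ∀ N : ℕ, 1 ≤ N → N ≤ M → Y < 2 * N → ∀ a : ℕ → ℂ, (∀ n ∈ Finset.Ico N (2 * N), ‖a n‖ ≤ (N:ℝ) ^ (-(3/4):ℝ)) →
      ∫ u in Set.Icc α (α + X), ‖∑ n ∈ Finset.Ico N (2 * N), a n * ec (2 * u * Real.sqrt n)‖ ^ (p+1) ≤ Bd) :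
    ∫ u in Set.Icc α (α + X), ‖∑ n ∈ Finset.Ioc Y M, c n * ec (2 * u * Real.sqrt n)‖ ^ (p+1) ≤ (3 * Real.log T) ^ (p+1) * D ^ (p+1) * Bd := by
  set c' : ℕ → ℂ := fun n => if n ∈ Finset.Ioc Y M then c n else 0 with hc'
  set J := Nat.log 2 M + 1 with hJ
  have hMJ : M < 2 ^ J := Nat.lt_pow_succ_log_self (by norm_num) M
  have hlog1 : 1 ≤ Real.log T := (logs 1 le_rfl T hT (by push_cast; linarith)).1
  have hJT : (J:ℝ) ≤ 3 * Real.log T := by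
    rw [hJ]
    push_cast
    rcases Nat.eq_zero_or_pos M with h | h
    · rw [h]; simp; linarith
    · have h1 : 2 ^ Nat.log 2 M ≤ M := Nat.pow_log_le_self 2 (by omega)
      have h2 : (2:ℝ) ^ Nat.log 2 M ≤ T := le_trans (by exact_mod_cast h1) hMT
      have h3 := Real.log_le_log (by positivity) h2
      rw [Real.log_pow] at h3
      have := Real.log_two_gt_d9
      have : (0:ℝ) ≤ (Nat.log 2 M : ℝ) := Nat.cast_nonneg _
      nlinarith
  set G : ℕ → ℝ → ℂ := fun j u => ∑ n ∈ Finset.Ico (2 ^ j) (2 * 2 ^ j), c' n * ec (2 * u * Real.sqrt n) with hG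
  have hGc : ∀ j, Continuous (G j) := fun j => F_cont _ _
  have hsum : ∀ u, ∑ n ∈ Finset.Ioc Y M, c n * ec (2 * u * Real.sqrt n) = ∑ j ∈ Finset.range J, G j u := by
    intro u
    rw [hG]
    simp only
    rw [← dyad_split]
    have h1 : ∑ n ∈ Finset.Ioc Y M, c n * ec (2 * u * Real.sqrt n) = ∑ n ∈ Finset.Ioc Y M, c' n * ec (2 * u * Real.sqrt n) := by
      apply Finset.sum_congr rfl
      intro n hn
      rw [hc']; simp only; rw [if_pos hn]
    rw [h1]
    apply Finset.sum_subset
    · intro n hn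
      rw [Finset.mem_Ioc] at hn
      rw [Finset.mem_Ico]
      omega
    · intro n _ hn
      rw [hc']; simp only; rw [if_neg hn, zero_mul]
  have hblock : ∀ j ∈ Finset.range J, ∫ u in Set.Icc α (α + X), ‖G j u‖ ^ (p+1) ≤ D ^ (p+1) * Bd := by
    intro j _
    by_cases hj : 2 ^ j ≤ M ∧ Y < 2 * 2 ^ j
    · have h1 := hB (2 ^ j) Nat.one_le_two_pow hj.1 hj.2 (fun n => c' n / D) (by
        intro n hn
        rw [Finset.mem_Ico] at hn
        have hn1 : 1 ≤ n := le_trans Nat.one_le_two_pow hn.1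
        rw [norm_div, Complex.norm_real, Real.norm_of_nonneg hD.le, div_le_iff₀ hD]
        rw [hc']
        simp only
        split_ifs with hm
        · rw [Finset.mem_Ioc] at hm
          refine (hc n hn1 hm.2).trans ?_
          rw [mul_comm]
          gcongr ?_ * _
          apply Real.rpow_le_rpow_of_nonpos (by positivity) (by exact_mod_cast hn.1) (by norm_num)
        · rw [norm_zero]; positivity)
      have h2 : ∀ u, ‖G j u‖ ^ (p+1) = D ^ (p+1) * ‖∑ n ∈ Finset.Ico (2 ^ j) (2 * 2 ^ j), (c' n / D) * ec (2 * u * Real.sqrt n)‖ ^ (p+1) := by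
        intro u
        rw [← mul_pow]
        congr 1
        have : D = ‖(D:ℂ)‖ := by rw [Complex.norm_real, Real.norm_of_nonneg hD.le]
        nth_rewrite 1 [this]
        rw [← norm_mul, Finset.mul_sum, hG]
        simp only
        congr 1
        apply Finset.sum_congr rfl
        intro n _
        have : (D:ℂ) ≠ 0 := by exact_mod_cast hD.ne'
        field_simp
      simp_rw [h2]
      rw [integral_const_mul]
      gcongr
    · have h2 : ∀ u, ‖G j u‖ ^ (p+1) = 0 := by
        intro u
        have : G j u = 0 := by
          apply Finset.sum_eq_zero
          intro n hn
          rw [Finset.mem_Ico] at hn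
          rw [hc']; simp only
          rw [if_neg, zero_mul]
          rw [Finset.mem_Ioc]
          omega
        rw [this]; simp
      simp_rw [h2]
      simp
      positivity
  have hJ0 : (0:ℝ) ≤ J := Nat.cast_nonneg _
  have hGi : ∀ j, IntegrableOn (fun u => ‖G j u‖ ^ (p+1)) (Set.Icc α (α + X)) := fun j => ((hGc j).norm.pow _).continuousOn.integrableOn_Icc
  calc _ ≤ ∫ u in Set.Icc α (α + X), (J:ℝ) ^ p * ∑ j ∈ Finset.range J, ‖G j u‖ ^ (p+1) := by
        apply setIntegral_mono
        · exact ((F_cont _ _).norm.pow _).continuousOn.integrableOn_Icc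
        · exact (integrable_finsetSum _ fun j _ => hGi j).const_mul _
        · intro u
          simp only
          rw [hsum u]
          refine (pow_le_pow_left₀ (norm_nonneg _) (norm_sum_le _ _) _).trans ?_
          have h := pow_sum_div_card_le_sum_pow (s := Finset.range J) (f := fun j => ‖G j u‖) (fun _ _ => norm_nonneg _) p
          have hJpos : (0:ℝ) < (J:ℝ) ^ p := by
            rw [hJ]; positivity
          rw [Finset.card_range, div_le_iff₀ hJpos] at h
          rw [mul_comm]
          exact h
    _ = (J:ℝ) ^ p * ∑ j ∈ Finset.range J, ∫ u in Set.Icc α (α + X), ‖G j u‖ ^ (p+1) := by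
        rw [integral_const_mul, integral_finsetSum _ fun j _ => hGi j]
    _ ≤ (J:ℝ) ^ p * ((J:ℝ) * (D ^ (p+1) * Bd)) := by
        gcongr
        refine (Finset.sum_le_card_nsmul _ _ _ hblock).trans (le_of_eq ?_)
        rw [nsmul_eq_mul, Finset.card_range]
    _ = (J:ℝ) ^ (p+1) * D ^ (p+1) * Bd := by ring
    _ ≤ _ := by gcongr

lemma dyadic_final (p : ℕ) (hp : p + 1 ≤ 8) (C0 : ℝ) (hC0 : 0 < C0) : ∃ C : ℝ, 0 < C ∧ ∀ T : ℝ, 10 ≤ T → ∀ Y M : ℕ, (M:ℝ) ≤ T →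
    ∀ c : ℕ → ℂ, (∀ n : ℕ, ‖c n‖ ≤ C0 * divfun n * (n:ℝ) ^ (-(3/4):ℝ)) → ∀ Z α X : ℝ, 0 ≤ Z →
    (∀ N : ℕ, 1 ≤ N → N ≤ M → Y < 2 * N → ∀ a : ℕ → ℂ, (∀ n ∈ Finset.Ico N (2 * N), ‖a n‖ ≤ (N:ℝ) ^ (-(3/4):ℝ)) →
      ∫ u in Set.Icc α (α + X), ‖∑ n ∈ Finset.Ico N (2 * N), a n * ec (2 * u * Real.sqrt n)‖ ^ (p+1) ≤ 10 ^ 15 * Real.log T ^ 2 * Z) →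
    ∫ u in Set.Icc α (α + X), ‖∑ n ∈ Finset.Ioc Y M, c n * ec (2 * u * Real.sqrt n)‖ ^ (p+1) ≤ C * T ^ (1/500:ℝ) * Z := by
  obtain ⟨Cd, hCd, hd⟩ := divisor_bound (1/10000) (by norm_num)
  refine ⟨30000 ^ (p+1) * (C0 * Cd) ^ (p+1) * (10 ^ 15 * 10000 ^ 2), by positivity, ?_⟩
  intro T hT Y M hMT c hc Z α X hZ hB
  have hT0 : 0 < T := by linarith
  have hT1 : 1 ≤ T := by linarith
  set t := T ^ (1/10000:ℝ) with ht
  have ht1 : 1 ≤ t := Real.one_le_rpow hT1 (by norm_num)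
  have ht0 : 0 < t := by linarith
  have hlog0 : 0 ≤ Real.log T := Real.log_nonneg hT1
  have hlog : Real.log T ≤ 10000 * t := by
    have := Real.log_le_rpow_div hT0.le (show (0:ℝ) < 1/10000 by norm_num)
    rw [← ht] at this
    linarith
  have key := dyadic p Y M T hT hMT c (C0 * Cd * t) (by positivity) (by
    intro n hn hnM
    refine (hc n).trans ?_
    have h1 := hd n hn
    have h2 : (n:ℝ) ^ (1/10000:ℝ) ≤ t := by
      apply Real.rpow_le_rpow (Nat.cast_nonneg _) _ (by norm_num)
      exact le_trans (by exact_mod_cast hnM) hMT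
    gcongr ?_ * _
    calc C0 * (divfun n : ℝ) ≤ C0 * (Cd * (n:ℝ) ^ (1/10000:ℝ)) := by gcongr
      _ ≤ C0 * (Cd * t) := by gcongr
      _ = _ := by ring) α X (10 ^ 15 * Real.log T ^ 2 * Z) (by positivity) hB
  refine key.trans ?_
  have ht18 : t ^ (2 * (p + 1) + 2) ≤ T ^ (1/500:ℝ) := by
    calc t ^ (2 * (p + 1) + 2) ≤ t ^ 20 := pow_le_pow_right₀ ht1 (by omega)
      _ = T ^ (1/500:ℝ) := by
        rw [ht, ← Real.rpow_natCast, ← Real.rpow_mul hT0.le]; norm_num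
  calc (3 * Real.log T) ^ (p+1) * (C0 * Cd * t) ^ (p+1) * (10 ^ 15 * Real.log T ^ 2 * Z)
      ≤ (3 * (10000 * t)) ^ (p+1) * (C0 * Cd * t) ^ (p+1) * (10 ^ 15 * (10000 * t) ^ 2 * Z) := by gcongr
    _ = 30000 ^ (p+1) * (C0 * Cd) ^ (p+1) * (10 ^ 15 * 10000 ^ 2) * t ^ (2 * (p + 1) + 2) * Z := by
      rw [show 3 * (10000 * t) = 30000 * t by ring]
      rw [mul_pow 30000 t, mul_pow (C0 * Cd) t]
      rw [show 2 * (p + 1) + 2 = (p+1) + (p+1) + 2 by ring, pow_add t, pow_add t]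
      ring
    _ ≤ _ := by gcongr

lemma sqrt_len {T : ℝ} (hT : 10 ≤ T) : 0 ≤ Real.sqrt (2 * T) - Real.sqrt T ∧ Real.sqrt (2 * T) - Real.sqrt T ≤ Real.sqrt T := by
  have h1 : Real.sqrt T ≤ Real.sqrt (2 * T) := Real.sqrt_le_sqrt (by linarith)
  have h2 : Real.sqrt (2 * T) ≤ 2 * Real.sqrt T := by
    rw [Real.sqrt_le_left (by positivity), mul_pow, Real.sq_sqrt (by linarith)]; linarith
  constructor <;> linarith

lemma A8 : ∃ C : ℝ, 0 < C ∧ ∀ T : ℝ, 10 ≤ T → ∃ c : ℕ → ℂ,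
    (∀ u : ℝ, 0 < u → |R1 (T ^ ((1:ℝ)/4)) (u ^ 2)| / Real.sqrt u ≤ ‖∑ n ∈ Finset.Ioc 0 ⌊T ^ ((1:ℝ)/4)⌋₊, c n * ec (2 * u * Real.sqrt n)‖) ∧
    ∫ u in Set.Icc (Real.sqrt T) (Real.sqrt (2 * T)), ‖∑ n ∈ Finset.Ioc 0 ⌊T ^ ((1:ℝ)/4)⌋₊, c n * ec (2 * u * Real.sqrt n)‖ ^ 8 ≤ C * T ^ (1/500:ℝ) * T ^ (1/2:ℝ) := by
  obtain ⟨C, hC, h⟩ := dyadic_final 7 (by norm_num) 1 one_pos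
  refine ⟨2 * C, by positivity, ?_⟩
  intro T hT
  have hT0 : 0 < T := by linarith
  have hT1 : 1 ≤ T := by linarith
  have hK : (0:ℝ) ≤ 1 / (Real.sqrt 2 * Real.pi) ∧ 1 / (Real.sqrt 2 * Real.pi) ≤ 1 := by
    refine ⟨by positivity, ?_⟩
    rw [div_le_one (by positivity)]
    have := Real.pi_gt_three
    have h2 : 1 ≤ Real.sqrt 2 := Real.one_le_sqrt.2 (by norm_num)
    nlinarith
  set K := 1 / (Real.sqrt 2 * Real.pi) with hKd
  set c : ℕ → ℂ := fun n => (((divfun n : ℝ) * (K * (n:ℝ) ^ (-(3/4):ℝ)) : ℝ) : ℂ) * ec (1/8) with hcd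
  refine ⟨c, ?_, ?_⟩
  · intro u hu
    have h1 := R1_form (y := T ^ ((1:ℝ)/4)) hu
    have hsu : 0 < Real.sqrt u := Real.sqrt_pos.2 hu
    have h2 : R1 (T ^ ((1:ℝ)/4)) (u ^ 2) / Real.sqrt u = (∑ n ∈ Finset.Ioc 0 ⌊T ^ ((1:ℝ)/4)⌋₊, c n * ec (2 * u * Real.sqrt n)).im := by
      have h3 : R1 (T ^ ((1:ℝ)/4)) (u ^ 2) / Real.sqrt u = Real.sqrt u * (R1 (T ^ ((1:ℝ)/4)) (u ^ 2) / u) := by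
        rw [div_eq_iff hsu.ne']
        have := Real.mul_self_sqrt hu.le
        field_simp
        rw [Real.sq_sqrt hu.le, mul_comm]
      rw [h3, h1, Finset.mul_sum, Complex.im_sum]
      apply Finset.sum_congr rfl
      intro n _
      rw [hcd]
      simp only
      rw [mul_assoc ((_ : ℝ) : ℂ), ← ec_add, Complex.im_ofReal_mul, add_comm (1/8:ℝ), ← hKd]
      have := hsu.ne'
      field_simp
    rw [← abs_of_pos hsu, ← abs_div, h2]
    exact Complex.abs_im_le_norm _
  · have hlen := sqrt_len hT
    have hM : ((⌊T ^ ((1:ℝ)/4)⌋₊ : ℕ) : ℝ) ≤ T ^ ((1:ℝ)/4) := Nat.floor_le (by positivity)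
    have hMT : ((⌊T ^ ((1:ℝ)/4)⌋₊ : ℕ) : ℝ) ≤ T := hM.trans (by
      conv_rhs => rw [← Real.rpow_one T]
      exact Real.rpow_le_rpow_of_exponent_le hT1 (by norm_num))
    have key := h T hT 0 ⌊T ^ ((1:ℝ)/4)⌋₊ hMT c (by
      intro n
      rw [hcd]
      simp only
      rw [norm_mul, ec_norm, mul_one, Complex.norm_real, Real.norm_of_nonneg (by positivity), one_mul]
      gcongr
      exact mul_le_of_le_one_left (by positivity) hK.2) (2 * T ^ (1/2:ℝ)) (Real.sqrt T) (Real.sqrt (2 * T) - Real.sqrt T) (by positivity) (by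
      intro N hN hNM _ a ha
      have hNM' : (N:ℝ) ≤ T ^ ((1:ℝ)/4) := le_trans (by exact_mod_cast hNM) hM
      refine (mom8 N (2 * N) hN le_rfl a ha _ _ hlen.1 T hT (le_trans (by exact_mod_cast hNM) hMT)).trans ?_
      have h1 : (N:ℝ) ^ (3/2:ℝ) ≤ T ^ (1/2:ℝ) := by
        calc (N:ℝ) ^ (3/2:ℝ) ≤ (T ^ ((1:ℝ)/4)) ^ (3/2:ℝ) := Real.rpow_le_rpow (Nat.cast_nonneg _) hNM' (by norm_num)
          _ = T ^ (3/8:ℝ) := by rw [← Real.rpow_mul hT0.le]; norm_num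
          _ ≤ _ := Real.rpow_le_rpow_of_exponent_le hT1 (by norm_num)
      have h2 : Real.sqrt (2 * T) - Real.sqrt T ≤ T ^ (1/2:ℝ) := by
        rw [← Real.sqrt_eq_rpow]; exact hlen.2
      have : Real.sqrt (2 * T) - Real.sqrt T + (N:ℝ) ^ (3/2:ℝ) ≤ 2 * T ^ (1/2:ℝ) := by linarith
      gcongr)
    rw [show Real.sqrt T + (Real.sqrt (2 * T) - Real.sqrt T) = Real.sqrt (2 * T) by ring] at key
    refine key.trans (le_of_eq (by ring))

lemma B4 : ∃ C : ℝ, 0 < C ∧ ∀ T : ℝ, 10 ≤ T → ∃ c : ℕ → ℂ,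
    (∀ u : ℝ, Real.sqrt T ≤ u → u ≤ Real.sqrt (2 * T) → |R2 (T ^ ((1:ℝ)/4)) (u ^ 2)| / Real.sqrt u ≤ ‖∑ n ∈ Finset.Ioc ⌊T ^ ((1:ℝ)/4)⌋₊ ⌊T ^ (3/4:ℝ)⌋₊, c n * ec (2 * u * Real.sqrt n)‖ + C * T ^ (-(1/200):ℝ)) ∧
    ∫ u in Set.Icc (Real.sqrt T) (Real.sqrt (2 * T)), ‖∑ n ∈ Finset.Ioc ⌊T ^ ((1:ℝ)/4)⌋₊ ⌊T ^ (3/4:ℝ)⌋₊, c n * ec (2 * u * Real.sqrt n)‖ ^ 4 ≤ C * T ^ (1/500:ℝ) * T ^ (1/2-1/50:ℝ) := by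
  obtain ⟨C0, hC0, hV⟩ := trunc_voronoi
  obtain ⟨C, hC, h⟩ := dyadic_final 3 (by norm_num) C0 hC0
  refine ⟨C0 + 3 * C, by positivity, ?_⟩
  intro T hT
  have hT0 : 0 < T := by linarith
  have hT1 : 1 ≤ T := by linarith
  obtain ⟨c, hc, hR⟩ := hV T hT
  refine ⟨c, ?_, ?_⟩
  · intro u h1 h2
    refine (hR u h1 h2).trans ?_
    gcongr
    linarith
  · have hlen := sqrt_len hT
    have hM : ((⌊T ^ (3/4:ℝ)⌋₊ : ℕ) : ℝ) ≤ T ^ (3/4:ℝ) := Nat.floor_le (by positivity)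
    have hMT : ((⌊T ^ (3/4:ℝ)⌋₊ : ℕ) : ℝ) ≤ T := hM.trans (by
      conv_rhs => rw [← Real.rpow_one T]
      exact Real.rpow_le_rpow_of_exponent_le hT1 (by norm_num))
    have key := h T hT ⌊T ^ ((1:ℝ)/4)⌋₊ ⌊T ^ (3/4:ℝ)⌋₊ hMT c hc (3 * T ^ (1/2-1/50:ℝ)) (Real.sqrt T) (Real.sqrt (2 * T) - Real.sqrt T) (by positivity) (by
      intro N hN hNM hYN a ha
      have hNM' : (N:ℝ) ≤ T ^ (3/4:ℝ) := le_trans (by exact_mod_cast hNM) hM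
      refine (mom4 N (2 * N) hN le_rfl a ha _ _ hlen.1 T hT (le_trans (by exact_mod_cast hNM) hMT)).trans ?_
      have h1 : (N:ℝ) ^ (1/2:ℝ) ≤ T ^ (1/2-1/50:ℝ) := by
        calc (N:ℝ) ^ (1/2:ℝ) ≤ (T ^ (3/4:ℝ)) ^ (1/2:ℝ) := Real.rpow_le_rpow (Nat.cast_nonneg _) hNM' (by norm_num)
          _ = T ^ (3/8:ℝ) := by rw [← Real.rpow_mul hT0.le]; norm_num
          _ ≤ _ := Real.rpow_le_rpow_of_exponent_le hT1 (by norm_num)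
      have h2 : Real.sqrt (2 * T) - Real.sqrt T ≤ T ^ (1/2:ℝ) := by
        rw [← Real.sqrt_eq_rpow]; exact hlen.2
      have hNl : T ^ ((1:ℝ)/4) ≤ 2 * (N:ℝ) := by
        have h5 := (Nat.lt_floor_add_one (T ^ ((1:ℝ)/4))).le
        have h6 : ((⌊T ^ ((1:ℝ)/4)⌋₊ + 1 : ℕ) : ℝ) ≤ ((2 * N : ℕ) : ℝ) := by exact_mod_cast hYN
        push_cast at h6
        linarith
      have h3 : (N:ℝ) ^ (-(1/3):ℝ) ≤ 2 * T ^ (-(1/12):ℝ) := by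
        have h4 : T ^ ((1:ℝ)/4) / 2 ≤ (N:ℝ) := by linarith
        calc (N:ℝ) ^ (-(1/3):ℝ) ≤ (T ^ ((1:ℝ)/4) / 2) ^ (-(1/3):ℝ) := Real.rpow_le_rpow_of_nonpos (by positivity) h4 (by norm_num)
          _ = T ^ (-(1/12):ℝ) * (2:ℝ) ^ (1/3:ℝ) := by
            rw [Real.div_rpow (by positivity) (by norm_num), ← Real.rpow_mul hT0.le, div_eq_mul_inv, ← Real.rpow_neg (by norm_num)]
            norm_num
          _ ≤ T ^ (-(1/12):ℝ) * (2:ℝ) ^ (1:ℝ) := by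
            have : (2:ℝ) ^ (1/3:ℝ) ≤ (2:ℝ) ^ (1:ℝ) := Real.rpow_le_rpow_of_exponent_le (by norm_num) (by norm_num)
            gcongr
          _ = _ := by rw [Real.rpow_one]; ring
      have h4 : (Real.sqrt (2 * T) - Real.sqrt T) * (N:ℝ) ^ (-(1/3):ℝ) ≤ 2 * T ^ (1/2-1/50:ℝ) := by
        calc _ ≤ T ^ (1/2:ℝ) * (2 * T ^ (-(1/12):ℝ)) := mul_le_mul h2 h3 (by positivity) (by positivity)
          _ = 2 * T ^ (1/2-1/12:ℝ) := by
            rw [sub_eq_add_neg, Real.rpow_add hT0]; ring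
          _ ≤ _ := by
            have : T ^ (1/2-1/12:ℝ) ≤ T ^ (1/2-1/50:ℝ) := Real.rpow_le_rpow_of_exponent_le hT1 (by norm_num)
            linarith
      have : (Real.sqrt (2 * T) - Real.sqrt T) * (N:ℝ) ^ (-(1/3):ℝ) + (N:ℝ) ^ (1/2:ℝ) ≤ 3 * T ^ (1/2-1/50:ℝ) := by linarith
      gcongr)
    rw [show Real.sqrt T + (Real.sqrt (2 * T) - Real.sqrt T) = Real.sqrt (2 * T) by ring] at key
    refine key.trans ?_
    have h9 : 0 ≤ C0 * (T ^ (1/500:ℝ) * T ^ (1/2-1/50:ℝ)) := by positivity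
    nlinarith [h9]

lemma young_mix {A B l : ℝ} (hA : 0 ≤ A) (hB : 0 ≤ B) (hl : 0 < l) : A ^ 6 * B ≤ l * A ^ 8 + (l ^ 3)⁻¹ * B ^ 4 := by
  rcases le_total B (l * A ^ 2) with h | h
  · have : A ^ 6 * B ≤ A ^ 6 * (l * A ^ 2) := by gcongr
    have h2 : 0 ≤ (l ^ 3)⁻¹ * B ^ 4 := by positivity
    nlinarith
  · have h1 : A ^ 2 ≤ B / l := by rw [le_div_iff₀ hl]; linarith
    have h2 : A ^ 6 ≤ (B / l) ^ 3 := by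
      calc A ^ 6 = (A ^ 2) ^ 3 := by ring
        _ ≤ _ := by gcongr
    have h3 : A ^ 6 * B ≤ (B / l) ^ 3 * B := by gcongr
    have h4 : (B / l) ^ 3 * B = (l ^ 3)⁻¹ * B ^ 4 := by field_simp
    have h5 : 0 ≤ l * A ^ 8 := by positivity
    linarith

lemma pow4_add {a b : ℝ} (ha : 0 ≤ a) (hb : 0 ≤ b) : (a + b) ^ 4 ≤ 8 * (a ^ 4 + b ^ 4) := by
  have h1 : (a + b) ^ 2 ≤ 2 * (a ^ 2 + b ^ 2) := by nlinarith [sq_nonneg (a - b)]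
  have h2 : ((a + b) ^ 2) ^ 2 ≤ (2 * (a ^ 2 + b ^ 2)) ^ 2 := by gcongr
  nlinarith [sq_nonneg (a ^ 2 - b ^ 2)]

lemma subst_sq {T : ℝ} (hT : 10 ≤ T) (H : ℝ → ℝ) (hH : Continuous H) (hH0 : ∀ u, 0 ≤ H u) :
    ∫ x in T..(2 * T), H (Real.sqrt x) ≤ 4 * Real.sqrt T * ∫ u in Set.Icc (Real.sqrt T) (Real.sqrt (2 * T)), H u := by
  have hlen := sqrt_len hT
  have hs0 : 0 ≤ Real.sqrt T := Real.sqrt_nonneg _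
  have h1 := intervalIntegral.integral_comp_mul_deriv (a := Real.sqrt T) (b := Real.sqrt (2 * T)) (f := fun u => u ^ 2) (f' := fun u => 2 * u)
    (g := fun x => H (Real.sqrt x)) (fun u _ => by simpa using hasDerivAt_pow 2 u) (by fun_prop) (hH.comp Real.continuous_sqrt)
  simp only [Function.comp] at h1
  rw [Real.sq_sqrt (by linarith), Real.sq_sqrt (by linarith)] at h1
  rw [← h1, intervalIntegral.integral_of_le (by linarith), ← integral_Icc_eq_integral_Ioc, ← integral_const_mul]
  apply setIntegral_mono_on
  · apply Continuous.integrableOn_Icc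
    fun_prop
  · exact (hH.integrableOn_Icc).const_mul _
  · exact measurableSet_Icc
  · intro u hu
    have hu0 : 0 ≤ u := hs0.trans hu.1
    rw [Real.sqrt_sq hu0, mul_comm]
    have : 2 * u ≤ 4 * Real.sqrt T := by linarith [hu.2]
    exact mul_le_mul_of_nonneg_right this (hH0 u)

lemma main_bound : ∃ C : ℝ, 0 < C ∧ ∀ T : ℝ, 10 ≤ T →
      (∫ x in T..(2 * T), |R1 (T ^ ((1 : ℝ) / 4)) x| ^ 6 * |R2 (T ^ ((1 : ℝ) / 4)) x|) ≤
        C * T ^ ((11 : ℝ) / 4 - 3 / 1000) := by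
  obtain ⟨CA, hCA, hA⟩ := A8
  obtain ⟨CB, hCB, hB⟩ := B4
  refine ⟨16 * (CA + 8 * (CB + CB ^ 4)), by positivity, ?_⟩
  intro T hT
  have hT0 : 0 < T := by linarith
  have hT1 : 1 ≤ T := by linarith
  obtain ⟨cA, hA1, hA2⟩ := hA T hT
  obtain ⟨cB, hB1, hB2⟩ := hB T hT
  have hFAc := F_cont (Finset.Ioc 0 ⌊T ^ ((1:ℝ)/4)⌋₊) cA
  have hFBc := F_cont (Finset.Ioc ⌊T ^ ((1:ℝ)/4)⌋₊ ⌊T ^ (3/4:ℝ)⌋₊) cB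
  set FA : ℝ → ℂ := fun u => ∑ n ∈ Finset.Ioc 0 ⌊T ^ ((1:ℝ)/4)⌋₊, cA n * ec (2 * u * Real.sqrt n) with hFA
  set FB : ℝ → ℂ := fun u => ∑ n ∈ Finset.Ioc ⌊T ^ ((1:ℝ)/4)⌋₊ ⌊T ^ (3/4:ℝ)⌋₊, cB n * ec (2 * u * Real.sqrt n) with hFB
  change ∀ u : ℝ, 0 < u → |R1 (T ^ ((1:ℝ)/4)) (u ^ 2)| / Real.sqrt u ≤ ‖FA u‖ at hA1
  change ∫ u in Set.Icc (Real.sqrt T) (Real.sqrt (2 * T)), ‖FA u‖ ^ 8 ≤ _ at hA2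
  change ∀ u : ℝ, Real.sqrt T ≤ u → u ≤ Real.sqrt (2 * T) → |R2 (T ^ ((1:ℝ)/4)) (u ^ 2)| / Real.sqrt u ≤ ‖FB u‖ + _ at hB1
  change ∫ u in Set.Icc (Real.sqrt T) (Real.sqrt (2 * T)), ‖FB u‖ ^ 4 ≤ _ at hB2
  clear_value FA FB
  set l := T ^ (-(1/200):ℝ) with hl
  have hl0 : 0 < l := by positivity
  set H : ℝ → ℝ := fun u => l * ‖FA u‖ ^ 8 + (l ^ 3)⁻¹ * (8 * (‖FB u‖ ^ 4 + (CB * l) ^ 4)) with hH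
  have hHc : Continuous H := by
    rw [hH]
    exact (continuous_const.mul (hFAc.norm.pow 8)).add (continuous_const.mul (continuous_const.mul ((hFBc.norm.pow 4).add continuous_const)))
  have hH0 : ∀ u, 0 ≤ H u := fun u => by rw [hH]; positivity
  have hlen := sqrt_len hT
  -- pointwise bound
  have hpt : ∀ x ∈ Set.Ioc T (2 * T), |R1 (T ^ ((1 : ℝ) / 4)) x| ^ 6 * |R2 (T ^ ((1 : ℝ) / 4)) x| ≤ 4 * T ^ (7/4:ℝ) * H (Real.sqrt x) := by
    intro x hx
    have hx0 : 0 < x := hT0.trans hx.1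
    have hu0 : 0 < Real.sqrt x := Real.sqrt_pos.2 hx0
    have hs0 : 0 < Real.sqrt (Real.sqrt x) := Real.sqrt_pos.2 hu0
    have ha := hA1 _ hu0
    have hb := hB1 _ (Real.sqrt_le_sqrt hx.1.le) (Real.sqrt_le_sqrt hx.2)
    rw [Real.sq_sqrt hx0.le] at ha hb
    have hs7 : Real.sqrt (Real.sqrt x) ^ 7 ≤ 4 * T ^ (7/4:ℝ) := by
      calc Real.sqrt (Real.sqrt x) ^ 7 = x ^ (7/4:ℝ) := by
            rw [Real.sqrt_eq_rpow, Real.sqrt_eq_rpow, ← Real.rpow_mul hx0.le, ← Real.rpow_natCast, ← Real.rpow_mul hx0.le]; norm_num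
        _ ≤ (2 * T) ^ (7/4:ℝ) := Real.rpow_le_rpow hx0.le hx.2 (by norm_num)
        _ = (2:ℝ) ^ (7/4:ℝ) * T ^ (7/4:ℝ) := Real.mul_rpow (by norm_num) hT0.le
        _ ≤ 4 * T ^ (7/4:ℝ) := by
            have : (2:ℝ) ^ (7/4:ℝ) ≤ (2:ℝ) ^ (2:ℝ) := Real.rpow_le_rpow_of_exponent_le (by norm_num) (by norm_num)
            have h4 : (2:ℝ) ^ (2:ℝ) = 4 := by norm_num
            rw [h4] at this
            gcongr
    set s := Real.sqrt (Real.sqrt x) with hs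
    have e : |R1 (T ^ ((1 : ℝ) / 4)) x| ^ 6 * |R2 (T ^ ((1 : ℝ) / 4)) x| = s ^ 7 * ((|R1 (T ^ ((1 : ℝ) / 4)) x| / s) ^ 6 * (|R2 (T ^ ((1 : ℝ) / 4)) x| / s)) := by
      field_simp
    rw [e]
    apply mul_le_mul hs7 _ (by positivity) (by positivity)
    calc (|R1 (T ^ ((1 : ℝ) / 4)) x| / s) ^ 6 * (|R2 (T ^ ((1 : ℝ) / 4)) x| / s)
        ≤ ‖FA (Real.sqrt x)‖ ^ 6 * (‖FB (Real.sqrt x)‖ + CB * l) := by gcongr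
      _ ≤ l * ‖FA (Real.sqrt x)‖ ^ 8 + (l ^ 3)⁻¹ * (‖FB (Real.sqrt x)‖ + CB * l) ^ 4 := young_mix (norm_nonneg _) (by positivity) hl0
      _ ≤ H (Real.sqrt x) := by
        rw [hH]
        simp only
        have := pow4_add (norm_nonneg (FB (Real.sqrt x))) (show 0 ≤ CB * l by positivity)
        gcongr
  have hstep1 : (∫ x in T..(2 * T), |R1 (T ^ ((1 : ℝ) / 4)) x| ^ 6 * |R2 (T ^ ((1 : ℝ) / 4)) x|) ≤ 4 * T ^ (7/4:ℝ) * ∫ x in T..(2 * T), H (Real.sqrt x) := by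
    rw [intervalIntegral.integral_of_le (by linarith), intervalIntegral.integral_of_le (by linarith), ← integral_const_mul]
    apply integral_mono_of_nonneg
    · exact Filter.Eventually.of_forall fun x => by positivity
    · have : IntegrableOn (fun x => H (Real.sqrt x)) (Set.Icc T (2 * T)) := (hHc.comp Real.continuous_sqrt).integrableOn_Icc
      exact (this.mono_set Set.Ioc_subset_Icc_self).const_mul _
    · exact (ae_restrict_iff' measurableSet_Ioc).2 (Filter.Eventually.of_forall hpt)
  have hstep2 := subst_sq hT H hHc hH0
  have iA : IntegrableOn (fun u => ‖FA u‖ ^ 8) (Set.Icc (Real.sqrt T) (Real.sqrt (2 * T))) := (hFAc.norm.pow 8).integrableOn_Icc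
  have iB : IntegrableOn (fun u => ‖FB u‖ ^ 4) (Set.Icc (Real.sqrt T) (Real.sqrt (2 * T))) := (hFBc.norm.pow 4).integrableOn_Icc
  have iC : IntegrableOn (fun _ : ℝ => (CB * l) ^ 4) (Set.Icc (Real.sqrt T) (Real.sqrt (2 * T))) := continuous_const.integrableOn_Icc
  set E := T ^ (1/2 - 3/1000:ℝ) with hE
  have hstep3 : ∫ u in Set.Icc (Real.sqrt T) (Real.sqrt (2 * T)), H u ≤ (CA + 8 * (CB + CB ^ 4)) * E := by
    have e1 : ∫ u in Set.Icc (Real.sqrt T) (Real.sqrt (2 * T)), H u = l * (∫ u in Set.Icc (Real.sqrt T) (Real.sqrt (2 * T)), ‖FA u‖ ^ 8) +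
        (l ^ 3)⁻¹ * (8 * ((∫ u in Set.Icc (Real.sqrt T) (Real.sqrt (2 * T)), ‖FB u‖ ^ 4) + (Real.sqrt (2 * T) - Real.sqrt T) * (CB * l) ^ 4)) := by
      have iBC : IntegrableOn (fun u => (l ^ 3)⁻¹ * (8 * (‖FB u‖ ^ 4 + (CB * l) ^ 4))) (Set.Icc (Real.sqrt T) (Real.sqrt (2 * T))) :=
        ((iB.add iC).const_mul _).const_mul _
      rw [hH]
      beta_reduce
      rw [integral_add (iA.const_mul _) iBC, integral_const_mul, integral_const_mul, integral_const_mul,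
        integral_add iB iC, setIntegral_const, smul_eq_mul, Real.volume_real_Icc_of_le (by linarith)]
    rw [e1]
    have hl3 : (l ^ 3)⁻¹ = T ^ (3/200:ℝ) := by
      rw [hl, ← Real.rpow_natCast, ← Real.rpow_mul hT0.le, ← Real.rpow_neg hT0.le]; norm_num
    have hl4 : l ^ 4 = T ^ (-(1/50):ℝ) := by
      rw [hl, ← Real.rpow_natCast, ← Real.rpow_mul hT0.le]; norm_num
    have f1 : l * (CA * T ^ (1/500:ℝ) * T ^ (1/2:ℝ)) = CA * E := by
      have : l * T ^ (1/500:ℝ) * T ^ (1/2:ℝ) = E := by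
        rw [hl, hE, ← Real.rpow_add hT0, ← Real.rpow_add hT0]; norm_num
      rw [← this]; ring
    have f2 : (l ^ 3)⁻¹ * (CB * T ^ (1/500:ℝ) * T ^ (1/2-1/50:ℝ)) = CB * E := by
      have : (l ^ 3)⁻¹ * T ^ (1/500:ℝ) * T ^ (1/2-1/50:ℝ) = E := by
        rw [hl3, hE, ← Real.rpow_add hT0, ← Real.rpow_add hT0]; norm_num
      rw [← this]; ring
    have f3 : (l ^ 3)⁻¹ * (T ^ (1/2:ℝ) * (CB * l) ^ 4) ≤ CB ^ 4 * E := by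
      have : (l ^ 3)⁻¹ * T ^ (1/2:ℝ) * l ^ 4 ≤ E := by
        rw [hl3, hl4, hE, ← Real.rpow_add hT0, ← Real.rpow_add hT0]
        exact Real.rpow_le_rpow_of_exponent_le hT1 (by norm_num)
      calc _ = CB ^ 4 * ((l ^ 3)⁻¹ * T ^ (1/2:ℝ) * l ^ 4) := by ring
        _ ≤ _ := by gcongr
    have hX : Real.sqrt (2 * T) - Real.sqrt T ≤ T ^ (1/2:ℝ) := by
      rw [← Real.sqrt_eq_rpow]; exact hlen.2
    calc _ ≤ l * (CA * T ^ (1/500:ℝ) * T ^ (1/2:ℝ)) + (l ^ 3)⁻¹ * (8 * (CB * T ^ (1/500:ℝ) * T ^ (1/2-1/50:ℝ) + T ^ (1/2:ℝ) * (CB * l) ^ 4)) := by gcongr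
      _ = CA * E + 8 * (CB * E) + 8 * ((l ^ 3)⁻¹ * (T ^ (1/2:ℝ) * (CB * l) ^ 4)) := by
        rw [← f1, ← f2]; ring
      _ ≤ CA * E + 8 * (CB * E) + 8 * (CB ^ 4 * E) := by linarith
      _ = _ := by ring
  have hE0 : 0 < E := by positivity
  calc _ ≤ _ := hstep1
    _ ≤ 4 * T ^ (7/4:ℝ) * (4 * Real.sqrt T * ((CA + 8 * (CB + CB ^ 4)) * E)) := by
      refine mul_le_mul_of_nonneg_left (hstep2.trans ?_) (by positivity)
      exact mul_le_mul_of_nonneg_left hstep3 (by positivity)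
    _ = 16 * (CA + 8 * (CB + CB ^ 4)) * (T ^ (7/4:ℝ) * T ^ (1/2:ℝ) * E) := by
      rw [Real.sqrt_eq_rpow]; ring
    _ = _ := by
      congr 1
      rw [hE, ← Real.rpow_add hT0, ← Real.rpow_add hT0]; norm_num

theorem mixed_moment_R1_R2 (ε : ℝ) (hε : 0 < ε) :
    ∃ C : ℝ, 0 < C ∧ ∀ T : ℝ, 10 ≤ T →
      (∫ x in T..(2 * T), |R1 (T ^ ((1 : ℝ) / 4)) x| ^ 6 * |R2 (T ^ ((1 : ℝ) / 4)) x|) ≤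
        C * T ^ ((11 : ℝ) / 4 - 1 / 336 + ε) := by
  obtain ⟨C, hC, h⟩ := main_bound
  refine ⟨C, hC, fun T hT => (h T hT).trans ?_⟩
  refine mul_le_mul_of_nonneg_left ?_ hC.le
  exact Real.rpow_le_rpow_of_exponent_le (by linarith) (by linarith)
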